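/- Let n ≥ 2 be an integer, set r₀ = (n+1)/2, and let φ : ℝ → ℝ be a C^∞ function with |φ| ≤ 1 and φ(s) = 0 for |s| > 1/2. There exists a constant C such that for every 0 < δ ≤ 1, every Schwartz function f on ℝⁿ, and every measurable w : ℝⁿ → [0,∞), one has ∫_{ℝⁿ} (T_δ f(x))² w(x) dx ≤ C δ^{2/(n+1)} ∫_{ℝⁿ} |f(x)|² 𝔐_{r₀} w(x) dx, where T_δ f(x) = ( ∫_0^∞ | ∫_{ℝⁿ} φ(δ^{−1}(1 − |ξ|²/t²)) f̂(ξ) e^{2πi⟨x,ξ⟩} dξ |² dt/t )^{1/2} and 𝔐_{r₀} w(x) = sup_{B ∋ x} (|B|^{−1} ∫_B w^{r₀})^{1/r₀} is the uncentered r₀-maximal function. -/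

import Mathlib

open MeasureTheory Complex Filter
open scoped FourierTransform RealInnerProductSpace ENNReal Topology

/-- The square function
`T_δ f(x) = (∫_0^∞ |∫ φ(δ⁻¹(1 - |ξ|²/t²)) f̂(ξ) e^{2πi⟨x,ξ⟩} dξ|² dt/t)^{1/2}`,
as an extended nonnegative real. -/
noncomputable def squareFn (n : ℕ) (φ : ℝ → ℝ) (δ : ℝ)
    (f : EuclideanSpace ℝ (Fin n) → ℂ) (x : EuclideanSpace ℝ (Fin n)) : ℝ≥0∞ :=
  (∫⁻ t in Set.Ioi (0 : ℝ),
      (‖∫ ξ : EuclideanSpace ℝ (Fin n),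
          ((φ (δ⁻¹ * (1 - ‖ξ‖ ^ 2 / t ^ 2)) : ℝ) : ℂ) * 𝓕 f ξ *
            Complex.exp (2 * Real.pi * Complex.I * (⟪x, ξ⟫ : ℝ))‖₊ : ℝ≥0∞) ^ 2 *
        ENNReal.ofReal t⁻¹) ^ (1 / 2 : ℝ)

/-- The uncentered `r`-maximal function `𝔐_r w(x) = sup_{B ∋ x} (|B|⁻¹ ∫_B |w|^r)^{1/r}`
of a real-valued function, as an extended nonnegative real. -/
noncomputable def uncenteredMaximalR (n : ℕ) (r : ℝ) (w : EuclideanSpace ℝ (Fin n) → ℝ)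
    (x : EuclideanSpace ℝ (Fin n)) : ℝ≥0∞ :=
  ⨆ (c : EuclideanSpace ℝ (Fin n)) (ρ : ℝ) (_ : 0 < ρ) (_ : x ∈ Metric.ball c ρ),
    ((∫⁻ y in Metric.ball c ρ, (‖w y‖₊ : ℝ≥0∞) ^ r ∂volume) / volume (Metric.ball c ρ))
      ^ (1 / r)

section plancherel
variable {V : Type*} [NormedAddCommGroup V] [InnerProductSpace ℝ V] [FiniteDimensional ℝ V]
  [MeasurableSpace V] [BorelSpace V]

theorem ST_fourier_flip {f g : V → ℂ} (hf : Integrable f) (hg : Integrable g) :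
    ∫ ξ, 𝓕 f ξ * g ξ = ∫ x, f x * 𝓕 g x := by
  have := VectorFourier.integral_fourierIntegral_smul_eq_flip (L := innerₗ V)
    (μ := volume) (ν := volume) Real.continuous_fourierChar continuous_inner hf hg
  rw [flip_innerₗ] at this
  exact this

theorem ST_fourier_continuous {f : V → ℂ} (hf : Integrable f) : Continuous (𝓕 f) :=
  VectorFourier.fourierIntegral_continuous Real.continuous_fourierChar
    (by exact continuous_inner) hf

theorem ST_fourierInv_continuous {f : V → ℂ} (hf : Integrable f) : Continuous (𝓕⁻ f) := by
  have : 𝓕⁻ f = fun w => 𝓕 f (-w) := by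
    ext w; exact Real.fourierInv_eq_fourier_neg f w
  rw [this]
  exact (ST_fourier_continuous hf).comp continuous_neg

theorem ST_norm_fourier_le (f : V → ℂ) (ξ : V) : ‖𝓕 f ξ‖ ≤ ∫ x, ‖f x‖ :=
  VectorFourier.norm_fourierIntegral_le_integral_norm _ _ _ _ _

theorem ST_norm_fourierInv_le (f : V → ℂ) (ξ : V) : ‖𝓕⁻ f ξ‖ ≤ ∫ x, ‖f x‖ := by
  rw [Real.fourierInv_eq_fourier_neg]; exact ST_norm_fourier_le _ _

theorem ST_plancherel_ae {f : V → ℂ} (h1 : Integrable f) (h2 : MemLp f 2) :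
    ((𝓕 (h2.toLp f) : Lp (α := V) ℂ 2 volume) : V → ℂ) =ᵐ[volume] 𝓕 f := by
  apply ae_eq_of_integral_contDiff_smul_eq
  · exact (Lp.memLp _).locallyIntegrable (by norm_num)
  · exact (ST_fourier_continuous h1).locallyIntegrable
  intro g hg hgs
  have hgC : ContDiff ℝ (⊤ : ℕ∞) (fun x => (g x : ℂ)) := by
    exact Complex.ofRealCLM.contDiff.comp hg
  have hgsC : HasCompactSupport (fun x => (g x : ℂ)) := hgs.comp_left (g := Complex.ofReal) (by simp)
  set G : SchwartzMap V ℂ := hgsC.toSchwartzMap hgC with hG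
  have hGx : ∀ x, G x = (g x : ℂ) := fun x => rfl
  have e1 := congrArg (fun T => T G) (MeasureTheory.Lp.fourier_toTemperedDistribution_eq (h2.toLp f))
  beta_reduce at e1
  rw [TemperedDistribution.fourier_apply, Lp.toTemperedDistribution_apply (μ := volume),
    Lp.toTemperedDistribution_apply (μ := volume)] at e1
  calc ∫ x, g x • ((𝓕 (h2.toLp f) : Lp (α := V) ℂ 2 volume) : V → ℂ) x
      = ∫ x, G x • ((𝓕 (h2.toLp f) : Lp (α := V) ℂ 2 volume) : V → ℂ) x := by
        simp [hGx]
    _ = ∫ x, (𝓕 G) x • (h2.toLp f : V → ℂ) x := e1.symm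
    _ = ∫ x, (𝓕 G) x • f x := by
        apply integral_congr_ae
        filter_upwards [h2.coeFn_toLp] with x hx
        rw [hx]
    _ = ∫ x, 𝓕 f x * G x := by
        rw [ST_fourier_flip h1 (G.integrable)]
        simp only [smul_eq_mul, SchwartzMap.fourier_coe]
        congr 1; ext x; ring
    _ = ∫ x, g x • 𝓕 f x := by
        congr 1; ext x; rw [hGx]; simp [mul_comm]

theorem ST_plancherel {f : V → ℂ} (h1 : Integrable f) (h2 : MemLp f 2) :
    ∫⁻ ξ, ‖𝓕 f ξ‖ₑ ^ 2 = ∫⁻ x, ‖f x‖ₑ ^ 2 := by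
  have key : eLpNorm (𝓕 f) 2 volume = eLpNorm f 2 volume := by
    rw [← eLpNorm_congr_ae (ST_plancherel_ae h1 h2), ← eLpNorm_congr_ae h2.coeFn_toLp]
    have := MeasureTheory.Lp.norm_fourier_eq (h2.toLp f)
    rw [Lp.norm_def, Lp.norm_def] at this
    exact (ENNReal.toReal_eq_toReal_iff' (Lp.eLpNorm_ne_top _) (Lp.eLpNorm_ne_top _)).1 this
  have h := congrArg (fun a => a ^ (2:ℝ)) key
  simp only [eLpNorm_eq_lintegral_rpow_enorm_toReal (two_ne_zero) (ENNReal.ofNat_ne_top)] at h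
  simp only [ENNReal.toReal_ofNat, ← ENNReal.rpow_mul] at h
  norm_num at h
  exact h

theorem ST_plancherel_inv {f : V → ℂ} (h1 : Integrable f) (h2 : MemLp f 2) :
    ∫⁻ ξ, ‖𝓕⁻ f ξ‖ₑ ^ 2 = ∫⁻ x, ‖f x‖ₑ ^ 2 := by
  rw [← ST_plancherel h1 h2, ← lintegral_neg_eq_self]
  congr 1; ext x
  rw [Real.fourierInv_eq_fourier_neg, neg_neg]

theorem ST_sesq_flip {f g : V → ℂ} (hf : Integrable f) (hg : Integrable g) :
    ∫ x, 𝓕⁻ f x * (starRingEnd ℂ) (g x) = ∫ ξ, f ξ * (starRingEnd ℂ) (𝓕 g ξ) := by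
  have h2 : ∀ ξ, (starRingEnd ℂ) (𝓕 g ξ) = 𝓕 (fun x => (starRingEnd ℂ) (g x)) (-ξ) := by
    intro ξ
    rw [Real.fourier_eq', Real.fourier_eq', ← integral_conj]
    congr 1; ext v
    simp [← Complex.exp_conj]
    left; congr 4; exact Complex.conj_ofReal 2
  have h3 : Integrable (fun x => (starRingEnd ℂ) (g x)) :=
    (Complex.conjLIE.toContinuousLinearEquiv.toContinuousLinearMap.integrable_comp hg)
  simp_rw [h2, Real.fourierInv_eq_fourier_neg]
  have h4 : Integrable (fun x => f (-x)) := hf.comp_neg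
  have := ST_fourier_flip h4 h3
  rw [← integral_neg_eq_self (fun ξ => f ξ * 𝓕 (fun x => (starRingEnd ℂ) (g x)) (-ξ))]
  simp only [neg_neg]
  rw [← this]
  congr 1; ext x; congr 1
  rw [← Real.fourierInv_eq_fourier_neg, Real.fourierInv_eq_fourier_comp_neg]

end plancherel

theorem ST_lintegral_comp_abs (g : ℝ → ℝ≥0∞) :
    ∫⁻ u, g |u| = 2 * ∫⁻ u in Set.Ioi (0:ℝ), g u := by
  have h1 : ∫⁻ u in Set.Ioi (0:ℝ), g |u| = ∫⁻ u in Set.Ioi (0:ℝ), g u := by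
    apply setLIntegral_congr_fun measurableSet_Ioi
    intro u hu
    simp only
    rw [abs_of_pos hu]
  have h2 : ∫⁻ u in Set.Iic (0:ℝ), g |u| = ∫⁻ u in Set.Ioi (0:ℝ), g u := by
    rw [← h1, setLIntegral_congr Iio_ae_eq_Iic.symm]
    rw [← lintegral_indicator measurableSet_Iio, ← lintegral_indicator measurableSet_Ioi,
      ← lintegral_neg_eq_self]
    congr 1; ext u
    simp [Set.indicator]
  rw [← lintegral_add_compl _ (measurableSet_Iic (a := (0:ℝ))), h2, Set.compl_Iic, h1, two_mul]

theorem ST_near (γ : ℝ) (h0 : 0 < γ) (h1 : γ < 1) (R : ℝ) (hR : 0 < R) (x : ℝ) :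
    ∫⁻ y, (if |x - y| < R then (ENNReal.ofReal |x - y|) ^ (-γ) else 0)
      ≤ ENNReal.ofReal (2 / (1 - γ) * R ^ (1 - γ)) := by
  rw [lintegral_sub_left_eq_self (fun u : ℝ => if |u| < R then (ENNReal.ofReal |u|) ^ (-γ) else 0)]
  rw [ST_lintegral_comp_abs (fun u : ℝ => if u < R then (ENNReal.ofReal u) ^ (-γ) else 0)]
  have e : ∫⁻ u in Set.Ioi (0:ℝ), (if u < R then (ENNReal.ofReal u) ^ (-γ) else 0)
      ≤ ∫⁻ u in Set.Ioc 0 R, ENNReal.ofReal (u ^ (-γ)) := by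
    rw [← lintegral_indicator measurableSet_Ioi, ← lintegral_indicator measurableSet_Ioc]
    apply lintegral_mono
    intro u
    simp only [Set.indicator, Set.mem_Ioi, Set.mem_Ioc]
    by_cases hu : 0 < u
    · by_cases hu2 : u < R
      · simp [hu, hu2, hu2.le, ENNReal.ofReal_rpow_of_pos]
      · simp [hu, hu2]
    · simp [hu]
  have hi : IntegrableOn (fun u : ℝ => u ^ (-γ)) (Set.Ioc 0 R) :=
    (intervalIntegrable_iff_integrableOn_Ioc_of_le hR.le).1
      (intervalIntegral.intervalIntegrable_rpow' (by linarith))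
  rw [← ofReal_integral_eq_lintegral_ofReal hi, ← intervalIntegral.integral_of_le hR.le,
    integral_rpow (Or.inl (by linarith))] at e
  · refine (mul_le_mul_right e 2).trans ?_
    rw [show (2:ℝ≥0∞) = ENNReal.ofReal 2 by simp, ← ENNReal.ofReal_mul (by norm_num)]
    apply ENNReal.ofReal_le_ofReal
    rw [Real.zero_rpow (by linarith), show -γ + 1 = 1 - γ by ring]
    apply le_of_eq; field_simp; ring
  · filter_upwards [ae_restrict_mem measurableSet_Ioc] with u hu
    exact Real.rpow_nonneg hu.1.le _

theorem ST_far (R : ℝ) (hR : 0 < R) (x : ℝ) :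
    ∫⁻ y, (if |x - y| < R then 0 else (ENNReal.ofReal |x - y|) ^ (-2:ℝ))
      ≤ ENNReal.ofReal (2 / R) := by
  rw [lintegral_sub_left_eq_self (fun u : ℝ => if |u| < R then 0 else (ENNReal.ofReal |u|) ^ (-2:ℝ))]
  rw [ST_lintegral_comp_abs (fun u : ℝ => if u < R then 0 else (ENNReal.ofReal u) ^ (-2:ℝ))]
  have e : ∫⁻ u in Set.Ioi (0:ℝ), (if u < R then 0 else (ENNReal.ofReal u) ^ (-2:ℝ))
      ≤ ∫⁻ u in Set.Ioi R, ENNReal.ofReal (u ^ (-2:ℝ)) := by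
    rw [setLIntegral_congr (Ioi_ae_eq_Ici (a := R))]
    rw [← lintegral_indicator measurableSet_Ioi, ← lintegral_indicator measurableSet_Ici]
    apply lintegral_mono
    intro u
    simp only [Set.indicator, Set.mem_Ioi, Set.mem_Ici]
    by_cases hu : 0 < u
    · by_cases hu2 : u < R
      · simp [hu2]
      · rw [ENNReal.ofReal_rpow_of_pos hu]
        simp [hu, hu2, not_lt.1 hu2]
    · simp [hu]
  have hi := integrableOn_Ioi_rpow_of_lt (show (-2:ℝ) < -1 by norm_num) hR
  rw [← ofReal_integral_eq_lintegral_ofReal hi, integral_Ioi_rpow_of_lt (by norm_num) hR] at e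
  · refine (mul_le_mul_right e 2).trans ?_
    rw [show (2:ℝ≥0∞) = ENNReal.ofReal 2 by simp, ← ENNReal.ofReal_mul (by norm_num)]
    apply ENNReal.ofReal_le_ofReal
    norm_num
    rw [Real.rpow_neg_one]
    apply le_of_eq; field_simp
  · filter_upwards [ae_restrict_mem measurableSet_Ioi] with u hu
    exact Real.rpow_nonneg (hR.le.trans (le_of_lt hu)) _

theorem ST_hls_inner (γ : ℝ) (h0 : 0 < γ) (h1 : γ < 1) (f : ℝ → ℝ≥0∞) (hf : Measurable f)
    (hN0 : ∫⁻ x, f x ^ (2 / (2 - γ)) ≠ 0) (hN : ∫⁻ x, f x ^ (2 / (2 - γ)) ≠ ∞)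
    (x : ℝ) (hx : f x ≠ ∞) :
    ∫⁻ y, (if f y ≤ f x then f y * (ENNReal.ofReal |x - y|) ^ (-γ) else 0)
      ≤ ENNReal.ofReal (2 / (1 - γ) + 2 ^ (γ / 2)) * ((∫⁻ x, f x ^ (2 / (2 - γ))) ^ (1 - γ) *
          f x ^ (γ / (2 - γ))) := by
  by_cases hx0 : f x = 0
  · have : ∀ y, (if f y ≤ f x then f y * (ENNReal.ofReal |x - y|) ^ (-γ) else 0) = 0 := by
      intro y; rw [hx0]; split_ifs with h
      · rw [le_zero_iff] at h; simp [h]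
      · rfl
    simp [this]
  set N := ∫⁻ x, f x ^ (2 / (2 - γ)) with hNdef
  set p := 2 / (2 - γ) with hp
  set l := (f x).toReal with hl
  have hl0 : 0 < l := ENNReal.toReal_pos hx0 hx
  have hfl : f x = ENNReal.ofReal l := (ENNReal.ofReal_toReal hx).symm
  set M := N.toReal with hM
  have hM0 : 0 < M := ENNReal.toReal_pos hN0 hN
  have hNM : N = ENNReal.ofReal M := (ENNReal.ofReal_toReal hN).symm
  have h2g : 0 < 2 - γ := by linarith
  have hp0 : 0 < p := by positivity
  set R := M / l ^ p with hR
  have hR0 : 0 < R := by positivity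
  have hconj : p.HolderConjugate (2 / γ) := by
    rw [Real.holderConjugate_iff]
    refine ⟨?_, ?_⟩
    · rw [hp, lt_div_iff₀ h2g]; linarith
    · rw [hp]; field_simp; ring
  have hm : Measurable fun y => (if |x - y| < R then 0 else (ENNReal.ofReal |x - y|) ^ (-γ)) := by
    apply Measurable.ite
    · exact measurableSet_lt (by fun_prop) measurable_const
    · fun_prop
    · fun_prop
  calc ∫⁻ y, (if f y ≤ f x then f y * (ENNReal.ofReal |x - y|) ^ (-γ) else 0)
      ≤ ∫⁻ y, (f x * (if |x - y| < R then (ENNReal.ofReal |x - y|) ^ (-γ) else 0) +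
          f y * (if |x - y| < R then 0 else (ENNReal.ofReal |x - y|) ^ (-γ))) := by
        apply lintegral_mono
        intro y
        simp only
        by_cases h : f y ≤ f x
        · by_cases h' : |x - y| < R
          · simp only [h, h', if_true, mul_zero, add_zero]
            gcongr
          · simp [h, h']
        · simp [h]
    _ = f x * (∫⁻ y, (if |x - y| < R then (ENNReal.ofReal |x - y|) ^ (-γ) else 0)) +
        ∫⁻ y, f y * (if |x - y| < R then 0 else (ENNReal.ofReal |x - y|) ^ (-γ)) := by
        have hm2 : Measurable fun y => f y *
            (if |x - y| < R then 0 else (ENNReal.ofReal |x - y|) ^ (-γ)) := hf.mul hm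
        rw [lintegral_add_right _ hm2, lintegral_const_mul' _ _ hx]
    _ ≤ f x * ENNReal.ofReal (2 / (1 - γ) * R ^ (1 - γ)) +
        N ^ (1 / p) * (ENNReal.ofReal (2 / R)) ^ (1 / (2 / γ)) := by
        gcongr
        · exact ST_near γ h0 h1 R hR0 x
        · refine (ENNReal.lintegral_mul_le_Lp_mul_Lq volume hconj hf.aemeasurable
            hm.aemeasurable).trans ?_
          gcongr
          refine le_trans (le_of_eq ?_) (ST_far R hR0 x)
          congr 1; ext y
          split_ifs
          · rw [ENNReal.zero_rpow_of_pos (by positivity)]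
          · rw [← ENNReal.rpow_mul]; congr 1; field_simp
    _ = _ := by
        rw [hNM, hfl, ENNReal.ofReal_rpow_of_pos hM0, ENNReal.ofReal_rpow_of_pos (by positivity),
          ENNReal.ofReal_rpow_of_pos hM0, ENNReal.ofReal_rpow_of_pos hl0,
          ← ENNReal.ofReal_mul (by positivity), ← ENNReal.ofReal_mul (by positivity),
          ← ENNReal.ofReal_mul (by positivity), ← ENNReal.ofReal_mul (by
            have : 0 < 1 - γ := by linarith
            positivity), ← ENNReal.ofReal_add (by
            have : 0 < 1 - γ := by linarith
            positivity) (by positivity)]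
        congr 1
        have e1 : l * R ^ (1 - γ) = M ^ (1 - γ) * l ^ (γ / (2 - γ)) := by
          rw [hR, Real.div_rpow hM0.le (by positivity), ← Real.rpow_mul hl0.le]
          have : l ^ (γ / (2 - γ)) = l / l ^ (p * (1 - γ)) := by
            conv_rhs => rw [← Real.rpow_one l]
            rw [← Real.rpow_mul hl0.le, ← Real.rpow_sub hl0]
            congr 1; rw [hp]; field_simp; ring
          rw [this]; ring
        have e2 : M ^ (1 / p) * (2 / R) ^ (1 / (2 / γ)) =
            2 ^ (γ / 2) * (M ^ (1 - γ) * l ^ (γ / (2 - γ))) := by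
          rw [hR, show 2 / (M / l ^ p) = 2 * l ^ p / M from div_div_eq_mul_div _ _ _, Real.div_rpow (by positivity) hM0.le,
            Real.mul_rpow (by norm_num) (by positivity), ← Real.rpow_mul hl0.le]
          have a1 : M ^ (1 - γ) = M ^ (1 / p) / M ^ (1 / (2 / γ)) := by
            rw [← Real.rpow_sub hM0]; congr 1; rw [hp]; field_simp; ring
          have a2 : p * (1 / (2 / γ)) = γ / (2 - γ) := by rw [hp]; field_simp
          have a3 : 1 / (2 / γ) = γ / 2 := by field_simp
          rw [a2, a1, a3]; ring
        rw [e2]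
        calc _ = 2 / (1 - γ) * (l * R ^ (1 - γ)) +
              2 ^ (γ / 2) * (M ^ (1 - γ) * l ^ (γ / (2 - γ))) := by ring
          _ = _ := by rw [e1]; ring

theorem ST_hls (γ : ℝ) (h0 : 0 < γ) (h1 : γ < 1) : ∃ C : ℝ≥0∞, C ≠ ∞ ∧ ∀ f : ℝ → ℝ≥0∞,
    Measurable f → ∫⁻ x, ∫⁻ y, f x * f y * (ENNReal.ofReal |x - y|) ^ (-γ) ≤
      C * (∫⁻ x, f x ^ (2 / (2 - γ))) ^ (2 - γ) := by
  set A := ENNReal.ofReal (2 / (1 - γ) + 2 ^ (γ / 2)) with hA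
  have h2g : 0 < 2 - γ := by linarith
  have h1g : 0 < 1 - γ := by linarith
  refine ⟨2 * A, ENNReal.mul_ne_top (by simp) ENNReal.ofReal_ne_top, fun f hf => ?_⟩
  have hA0 : A ≠ 0 := by
    rw [hA]; simp only [ne_eq, ENNReal.ofReal_eq_zero, not_le]; positivity
  by_cases hN : ∫⁻ x, f x ^ (2 / (2 - γ)) = ∞
  · rw [hN, ENNReal.top_rpow_of_pos h2g, ENNReal.mul_top]
    · exact le_top
    · simp [hA0]
  by_cases hN0 : ∫⁻ x, f x ^ (2 / (2 - γ)) = 0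
  · rw [lintegral_eq_zero_iff (hf.pow_const _)] at hN0
    have : ∀ᵐ x, f x = 0 := by
      filter_upwards [hN0] with x hx
      simp only [Pi.zero_apply] at hx
      exact (ENNReal.rpow_eq_zero_iff_of_pos (by positivity)).1 hx
    have : ∫⁻ x, ∫⁻ y, f x * f y * (ENNReal.ofReal |x - y|) ^ (-γ) = 0 := by
      rw [lintegral_eq_zero_iff' ]
      · filter_upwards [this] with x hx
        simp [hx]
      · apply Measurable.aemeasurable
        apply Measurable.lintegral_prod_right'
          (f := fun z : ℝ × ℝ => f z.1 * f z.2 * (ENNReal.ofReal |z.1 - z.2|) ^ (-γ))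
        fun_prop
    rw [this]; exact bot_le
  set N := ∫⁻ x, f x ^ (2 / (2 - γ)) with hNdef
  have hfin : ∀ᵐ x, f x ≠ ∞ := by
    filter_upwards [ae_lt_top (hf.pow_const _) hN] with x hx hx'
    rw [hx', ENNReal.top_rpow_of_pos (by positivity)] at hx
    exact lt_irrefl _ hx
  set K : ℝ → ℝ → ℝ≥0∞ := fun x y =>
    if f y ≤ f x then f x * f y * (ENNReal.ofReal |x - y|) ^ (-γ) else 0 with hK
  have hKm : Measurable (fun z : ℝ × ℝ => K z.1 z.2) := by
    apply Measurable.ite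
    · exact measurableSet_le (by fun_prop) (by fun_prop)
    · fun_prop
    · fun_prop
  have hKm' : Measurable (fun z : ℝ × ℝ => K z.2 z.1) := hKm.comp measurable_swap
  have hB : ∫⁻ x, ∫⁻ y, K x y ≤ A * N ^ (2 - γ) := by
    calc ∫⁻ x, ∫⁻ y, K x y ≤ ∫⁻ x, A * N ^ (1 - γ) * f x ^ (2 / (2 - γ)) := by
          apply lintegral_mono_ae
          filter_upwards [hfin] with x hx
          have := ST_hls_inner γ h0 h1 f hf hN0 hN x hx
          calc ∫⁻ y, K x y = f x * ∫⁻ y, (if f y ≤ f x then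
                f y * (ENNReal.ofReal |x - y|) ^ (-γ) else 0) := by
                rw [← lintegral_const_mul' _ _ hx]
                congr 1; ext y
                simp only [hK]; split_ifs
                · ring
                · simp
            _ ≤ f x * (A * (N ^ (1 - γ) * f x ^ (γ / (2 - γ)))) := by gcongr
            _ = A * N ^ (1 - γ) * (f x ^ (1:ℝ) * f x ^ (γ / (2 - γ))) := by
                rw [ENNReal.rpow_one]; ring
            _ = _ := by
                rw [← ENNReal.rpow_add_of_nonneg _ _ (by norm_num) (by positivity)]
                congr 2; field_simp; ring
      _ = A * N ^ (1 - γ) * N := by rw [lintegral_const_mul _ (hf.pow_const _)]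
      _ = A * N ^ (2 - γ) := by
          rw [mul_assoc]; congr 1
          conv_lhs => rw [← ENNReal.rpow_one N, ← ENNReal.rpow_mul,
            ← ENNReal.rpow_add_of_nonneg _ _ (by linarith) (by norm_num)]
          congr 1; ring
  calc ∫⁻ x, ∫⁻ y, f x * f y * (ENNReal.ofReal |x - y|) ^ (-γ)
      ≤ ∫⁻ x, ∫⁻ y, (K x y + K y x) := by
        apply lintegral_mono; intro x
        apply lintegral_mono; intro y
        simp only [hK]
        rcases le_total (f y) (f x) with h | h
        · rw [if_pos h]; exact le_self_add
        · rw [if_pos h, mul_comm (f x), abs_sub_comm]; exact le_add_self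
    _ = (∫⁻ x, ∫⁻ y, K x y) + ∫⁻ x, ∫⁻ y, K y x := by
        rw [← lintegral_add_left]
        · congr 1; ext x
          rw [lintegral_add_left]
          exact hKm.comp (measurable_prodMk_left)
        · exact hKm.lintegral_prod_right'
    _ = (∫⁻ x, ∫⁻ y, K x y) + ∫⁻ x, ∫⁻ y, K x y := by
        congr 1
        rw [lintegral_lintegral_swap]
        exact hKm'.aemeasurable
    _ ≤ A * N ^ (2 - γ) + A * N ^ (2 - γ) := add_le_add hB hB
    _ = _ := by ring

/-- class of bounded integrable measurable functions -/
def ST_nice {X : Type*} [MeasurableSpace X] (μ : Measure X) (f : X → ℂ) : Prop :=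
  Measurable f ∧ Integrable f μ ∧ ∃ K : ℝ, ∀ x, ‖f x‖ ≤ K

theorem ST_nice_indicator {X : Type*} [MeasurableSpace X] {μ : Measure X} {f : X → ℂ}
    (h : ST_nice μ f) {S : Set X} (hS : MeasurableSet S) : ST_nice μ (S.indicator f) := by
  obtain ⟨h1, h2, K, hK⟩ := h
  refine ⟨h1.indicator hS, h2.indicator hS, K, fun x => ?_⟩
  exact (norm_indicator_le_norm_self _ _).trans (hK x)

theorem ST_interp_level {X : Type*} [MeasurableSpace X] (μ : Measure X)
    (T : (X → ℂ) → X → ℂ) (A B : ℝ) (hA : 0 < A) (hB : 0 < B)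
    (hadd : ∀ f g, ST_nice μ f → ST_nice μ g → ∀ x, T (fun y => f y + g y) x = T f x + T g x)
    (hmeas : ∀ f, ST_nice μ f → Measurable (T f))
    (h1 : ∀ f, ST_nice μ f → ∀ x, ‖T f x‖ ≤ B * ∫ y, ‖f y‖ ∂μ)
    (h2 : ∀ f, ST_nice μ f → ∫⁻ x, ‖T f x‖ₑ ^ 2 ∂μ ≤ ENNReal.ofReal (A ^ 2) * ∫⁻ x, ‖f x‖ₑ ^ 2 ∂μ)
    (p : ℝ) (hp : 1 < p) (f : X → ℂ) (hf : ST_nice μ f) (M : ℝ) (hM : 0 < M)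
    (hMf : ∫⁻ x, ‖f x‖ₑ ^ p ∂μ = ENNReal.ofReal M) (a : ℝ) (ha : 0 < a) :
    μ {x | a < ‖T f x‖} ≤ ENNReal.ofReal (4 * A ^ 2 / a ^ 2) *
      ∫⁻ y, (if a * ‖f y‖ ^ (p - 1) ≤ 2 * B * M then ‖f y‖ₑ ^ 2 else 0) ∂μ := by
  set S : Set X := {y | a * ‖f y‖ ^ (p - 1) ≤ 2 * B * M} with hSd
  have hS : MeasurableSet S := measurableSet_le (by have := hf.1; fun_prop) measurable_const
  have hs := ST_nice_indicator hf hS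
  have hl := ST_nice_indicator hf hS.compl
  have e : f = fun y => S.indicator f y + Sᶜ.indicator f y := by
    ext y
    exact congrFun (Set.indicator_self_add_compl S f).symm y
  have hlarge : ∀ x, ‖T (Sᶜ.indicator f) x‖ ≤ a / 2 := by
    intro x
    refine (h1 _ hl x).trans ?_
    have : ∫ y, ‖Sᶜ.indicator f y‖ ∂μ ≤ a / (2 * B) := by
      rw [integral_eq_lintegral_of_nonneg_ae (Eventually.of_forall fun _ => norm_nonneg _)
        hl.2.1.norm.aestronglyMeasurable]
      apply ENNReal.toReal_le_of_le_ofReal (by positivity)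
      calc ∫⁻ y, ENNReal.ofReal ‖Sᶜ.indicator f y‖ ∂μ
          ≤ ∫⁻ y, ENNReal.ofReal (a / (2 * B * M)) * ‖f y‖ₑ ^ p ∂μ := by
            apply lintegral_mono
            intro y
            simp only
            by_cases hy : y ∈ S
            · simp [hy]
            · rw [Set.indicator_of_mem (show y ∈ Sᶜ from hy)]
              have hy' : 2 * B * M < a * ‖f y‖ ^ (p - 1) := not_le.1 hy
              have hf0 : 0 < ‖f y‖ := by
                by_contra hc
                have : ‖f y‖ = 0 := le_antisymm (not_lt.1 hc) (norm_nonneg _)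
                rw [this, Real.zero_rpow (by linarith), mul_zero] at hy'
                have : 0 < 2 * B * M := by positivity
                linarith
              rw [← ofReal_norm, ENNReal.ofReal_rpow_of_pos hf0,
                ← ENNReal.ofReal_mul (by positivity)]
              apply ENNReal.ofReal_le_ofReal
              have : ‖f y‖ ^ p = ‖f y‖ ^ (p - 1) * ‖f y‖ := by
                rw [← Real.rpow_add_one hf0.ne']; congr 1; ring
              rw [this, div_mul_eq_mul_div, le_div_iff₀ (by positivity)]
              nlinarith
        _ = ENNReal.ofReal (a / (2 * B * M)) * ENNReal.ofReal M := by
            rw [lintegral_const_mul' _ _ ENNReal.ofReal_ne_top, hMf]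
        _ = ENNReal.ofReal (a / (2 * B)) := by
            rw [← ENNReal.ofReal_mul (by positivity)]; congr 1; field_simp
    calc B * ∫ y, ‖Sᶜ.indicator f y‖ ∂μ ≤ B * (a / (2 * B)) := by gcongr
      _ = a / 2 := by field_simp
  have hsub : {x | a < ‖T f x‖} ⊆ {x | ENNReal.ofReal (a ^ 2 / 4) ≤ ‖T (S.indicator f) x‖ₑ ^ 2} := by
    intro x hx
    simp only [Set.mem_ofPred_eq] at hx ⊢
    have h3 : T f x = T (S.indicator f) x + T (Sᶜ.indicator f) x := by
      conv_lhs => rw [e]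
      exact hadd _ _ hs hl x
    have h4 : a / 2 ≤ ‖T (S.indicator f) x‖ := by
      have := norm_add_le (T (S.indicator f) x) (T (Sᶜ.indicator f) x)
      rw [← h3] at this
      linarith [hlarge x]
    rw [← ofReal_norm, ← ENNReal.ofReal_pow (norm_nonneg _)]
    apply ENNReal.ofReal_le_ofReal
    nlinarith
  have hpos : 0 < a ^ 2 / 4 := by positivity
  calc μ {x | a < ‖T f x‖} ≤ _ := measure_mono hsub
    _ ≤ (∫⁻ x, ‖T (S.indicator f) x‖ₑ ^ 2 ∂μ) / ENNReal.ofReal (a ^ 2 / 4) :=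
        meas_ge_le_lintegral_div ((hmeas _ hs).enorm.pow_const 2).aemeasurable
          (by simpa using hpos) ENNReal.ofReal_ne_top
    _ ≤ (ENNReal.ofReal (A ^ 2) * ∫⁻ x, ‖S.indicator f x‖ₑ ^ 2 ∂μ) / ENNReal.ofReal (a ^ 2 / 4) := by
        gcongr; exact h2 _ hs
    _ = ENNReal.ofReal (4 * A ^ 2 / a ^ 2) * ∫⁻ x, ‖S.indicator f x‖ₑ ^ 2 ∂μ := by
        rw [ENNReal.div_eq_inv_mul, ← mul_assoc, ← ENNReal.ofReal_inv_of_pos hpos,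
          ← ENNReal.ofReal_mul (by positivity)]
        congr 2; field_simp
    _ = _ := by
        congr 2; ext y
        by_cases hy : y ∈ S
        · have : a * ‖f y‖ ^ (p - 1) ≤ 2 * B * M := hy
          simp [hy, this]
        · have : ¬ a * ‖f y‖ ^ (p - 1) ≤ 2 * B * M := hy
          simp [hy, this]

theorem ST_interp_inner (q b : ℝ) (hq : 2 < q) (hb : 0 < b) :
    ∫⁻ a in Set.Ioi (0:ℝ), (if a ≤ b then ENNReal.ofReal (a ^ (q - 3)) else 0)
      = ENNReal.ofReal (b ^ (q - 2) / (q - 2)) := by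
  have e : ∫⁻ a in Set.Ioi (0:ℝ), (if a ≤ b then ENNReal.ofReal (a ^ (q - 3)) else 0)
      = ∫⁻ u in Set.Ioc 0 b, ENNReal.ofReal (u ^ (q - 3)) := by
    rw [← lintegral_indicator measurableSet_Ioi, ← lintegral_indicator measurableSet_Ioc]
    congr 1; ext u
    simp only [Set.indicator, Set.mem_Ioi, Set.mem_Ioc]
    by_cases hu : 0 < u
    · by_cases hu2 : u ≤ b
      · simp [hu, hu2]
      · simp [hu, hu2]
    · simp [hu]
  have hi : IntegrableOn (fun u : ℝ => u ^ (q - 3)) (Set.Ioc 0 b) :=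
    (intervalIntegrable_iff_integrableOn_Ioc_of_le hb.le).1
      (intervalIntegral.intervalIntegrable_rpow' (by linarith))
  rw [e, ← ofReal_integral_eq_lintegral_ofReal hi, ← intervalIntegral.integral_of_le hb.le,
    integral_rpow (Or.inl (by linarith))]
  · rw [Real.zero_rpow (by linarith), sub_zero, show q - 3 + 1 = q - 2 by ring]
  · filter_upwards [ae_restrict_mem measurableSet_Ioc] with u hu
    exact Real.rpow_nonneg hu.1.le _

theorem ST_interp {X : Type*} [MeasurableSpace X] (μ : Measure X) [SigmaFinite μ]
    (T : (X → ℂ) → X → ℂ) (A B : ℝ) (hA : 0 < A) (hB : 0 < B)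
    (hadd : ∀ f g, ST_nice μ f → ST_nice μ g → ∀ x, T (fun y => f y + g y) x = T f x + T g x)
    (hmeas : ∀ f, ST_nice μ f → Measurable (T f))
    (h1 : ∀ f, ST_nice μ f → ∀ x, ‖T f x‖ ≤ B * ∫ y, ‖f y‖ ∂μ)
    (h2 : ∀ f, ST_nice μ f → ∫⁻ x, ‖T f x‖ₑ ^ 2 ∂μ ≤ ENNReal.ofReal (A ^ 2) * ∫⁻ x, ‖f x‖ₑ ^ 2 ∂μ)
    (p q : ℝ) (hp : 1 < p) (hq : 2 < q) (hpq : (p - 1) * q = p)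
    (f : X → ℂ) (hf : ST_nice μ f) :
    ∫⁻ x, ‖T f x‖ₑ ^ q ∂μ ≤
      ENNReal.ofReal (4 * q / (q - 2) * A ^ 2 * (2 * B) ^ (q - 2)) *
       (∫⁻ x, ‖f x‖ₑ ^ p ∂μ) ^ (q - 1) := by
  have hq2 : 0 < q - 2 := by linarith
  by_cases hN : ∫⁻ x, ‖f x‖ₑ ^ p ∂μ = ∞
  · rw [hN, ENNReal.top_rpow_of_pos (by linarith), ENNReal.mul_top]
    · exact le_top
    · simp only [ne_eq, ENNReal.ofReal_eq_zero, not_le]; positivity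
  by_cases hN0 : ∫⁻ x, ‖f x‖ₑ ^ p ∂μ = 0
  · rw [lintegral_eq_zero_iff (hf.1.enorm.pow_const _)] at hN0
    have h0 : ∀ᵐ x ∂μ, ‖f x‖ = 0 := by
      filter_upwards [hN0] with x hx
      simpa [show (0:ℝ) < p by linarith] using hx
    have h0' : ∫ y, ‖f y‖ ∂μ = 0 := by
      rw [integral_congr_ae h0]; simp
    have : ∀ x, T f x = 0 := by
      intro x
      have := h1 f hf x
      rw [h0', mul_zero] at this
      exact norm_le_zero_iff.1 this
    simp [this, show (0:ℝ) < q by linarith]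
  set M := (∫⁻ x, ‖f x‖ₑ ^ p ∂μ).toReal with hMd
  have hM : 0 < M := ENNReal.toReal_pos hN0 hN
  have hNM : ∫⁻ x, ‖f x‖ₑ ^ p ∂μ = ENNReal.ofReal M := (ENNReal.ofReal_toReal hN).symm
  have hfm := hf.1
  have hmain : ∀ y, (∫⁻ a in Set.Ioi (0:ℝ), ENNReal.ofReal (4 * A ^ 2) *
      (if a * ‖f y‖ ^ (p - 1) ≤ 2 * B * M then ENNReal.ofReal (a ^ (q - 3)) * ‖f y‖ₑ ^ 2 else 0))
      ≤ ENNReal.ofReal (4 * A ^ 2 * (2 * B * M) ^ (q - 2) / (q - 2)) * ‖f y‖ₑ ^ p := by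
    intro y
    by_cases hy : f y = 0
    · simp [hy]
    have hy0 : 0 < ‖f y‖ := norm_pos_iff.2 hy
    have hy1 : 0 < ‖f y‖ ^ (p - 1) := by positivity
    have hpw : ‖f y‖ ^ p = ‖f y‖ ^ 2 / (‖f y‖ ^ (p - 1)) ^ (q - 2) := by
      rw [← Real.rpow_mul hy0.le, ← Real.rpow_natCast, ← Real.rpow_sub hy0]
      congr 1; push_cast; linarith
    calc _ = ∫⁻ a in Set.Ioi (0:ℝ), (ENNReal.ofReal (4 * A ^ 2) * ‖f y‖ₑ ^ 2) *
        (if a ≤ 2 * B * M / ‖f y‖ ^ (p - 1) then ENNReal.ofReal (a ^ (q - 3)) else 0) := by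
          congr 1; ext a
          simp only [le_div_iff₀ hy1]
          split_ifs <;> ring
      _ = (ENNReal.ofReal (4 * A ^ 2) * ‖f y‖ₑ ^ 2) *
          ENNReal.ofReal ((2 * B * M / ‖f y‖ ^ (p - 1)) ^ (q - 2) / (q - 2)) := by
          rw [lintegral_const_mul', ST_interp_inner q _ hq (by positivity)]
          exact ENNReal.mul_ne_top ENNReal.ofReal_ne_top (by simp)
      _ = _ := by
          rw [← ofReal_norm, ← ENNReal.ofReal_pow (norm_nonneg _),
            ENNReal.ofReal_rpow_of_pos hy0, ← ENNReal.ofReal_mul (by positivity),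
            ← ENNReal.ofReal_mul (by positivity), ← ENNReal.ofReal_mul (by positivity)]
          congr 1
          rw [hpw, Real.div_rpow (by positivity) (by positivity)]
          field_simp
      _ ≤ _ := le_rfl
  have hlc := lintegral_rpow_eq_lintegral_meas_lt_mul μ (f := fun x => ‖T f x‖)
    (Eventually.of_forall fun _ => norm_nonneg _) (hmeas f hf).norm.aemeasurable
    (show 0 < q by linarith)
  calc ∫⁻ x, ‖T f x‖ₑ ^ q ∂μ = ∫⁻ x, ENNReal.ofReal (‖T f x‖ ^ q) ∂μ := by
        congr 1; ext x
        rw [← ofReal_norm, ENNReal.ofReal_rpow_of_nonneg (norm_nonneg _) (by linarith)]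
    _ = _ := hlc
    _ ≤ ENNReal.ofReal q * ∫⁻ a in Set.Ioi 0, ∫⁻ y, ENNReal.ofReal (4 * A ^ 2) *
      (if a * ‖f y‖ ^ (p - 1) ≤ 2 * B * M then ENNReal.ofReal (a ^ (q - 3)) * ‖f y‖ₑ ^ 2 else 0) ∂μ := by
        gcongr ENNReal.ofReal q * ?_
        apply setLIntegral_mono' measurableSet_Ioi
        intro a ha
        have ha : 0 < a := ha
        refine (mul_le_mul_left (ST_interp_level μ T A B hA hB hadd hmeas h1 h2 p hp f hf M hM hNM a ha)
          _).trans ?_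
        rw [mul_right_comm, ← ENNReal.ofReal_mul (by positivity),
          ← lintegral_const_mul' _ _ ENNReal.ofReal_ne_top]
        apply lintegral_mono
        intro y
        simp only
        have : 4 * A ^ 2 / a ^ 2 * a ^ (q - 1) = 4 * A ^ 2 * a ^ (q - 3) := by
          rw [show q - 1 = q - 3 + 2 by ring, Real.rpow_add ha]; norm_num; field_simp
        rw [this, ENNReal.ofReal_mul (by positivity)]
        split_ifs
        · rw [mul_assoc]
        · simp
    _ = ENNReal.ofReal q * ∫⁻ y, (∫⁻ a in Set.Ioi (0:ℝ), ENNReal.ofReal (4 * A ^ 2) *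
      (if a * ‖f y‖ ^ (p - 1) ≤ 2 * B * M then ENNReal.ofReal (a ^ (q - 3)) * ‖f y‖ₑ ^ 2 else 0)) ∂μ := by
        congr 1
        rw [lintegral_lintegral_swap]
        apply Measurable.aemeasurable
        apply Measurable.const_mul
        apply Measurable.ite
        · exact measurableSet_le (by fun_prop) measurable_const
        · fun_prop
        · fun_prop
    _ ≤ ENNReal.ofReal q * ∫⁻ y, ENNReal.ofReal (4 * A ^ 2 * (2 * B * M) ^ (q - 2) / (q - 2)) *
          ‖f y‖ₑ ^ p ∂μ := by
        gcongr ENNReal.ofReal q * ?_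
        exact lintegral_mono hmain
    _ = _ := by
        rw [lintegral_const_mul' _ _ ENNReal.ofReal_ne_top, hNM, ENNReal.ofReal_rpow_of_pos hM,
          ← ENNReal.ofReal_mul (by positivity), ← ENNReal.ofReal_mul (by positivity),
          ← ENNReal.ofReal_mul (by positivity)]
        congr 1
        have : M ^ (q - 1) = M ^ (q - 2) * M := by
          rw [← Real.rpow_add_one hM.ne']; congr 1; ring
        rw [this, Real.mul_rpow (by positivity) hM.le]
        field_simp

section
variable {V : Type*} [NormedAddCommGroup V] [InnerProductSpace ℝ V] [FiniteDimensional ℝ V]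
  [MeasurableSpace V] [BorelSpace V]

theorem ST_conv (m f : V → ℂ) (hm : Integrable m) (hf : Integrable f) (x : V) :
    𝓕⁻ (fun ξ => m ξ * 𝓕 f ξ) x = ∫ y, 𝓕⁻ m (x - y) * f y := by
  have h1 : Integrable (fun ξ => Complex.exp (2 * Real.pi * Complex.I * (⟪x, ξ⟫ : ℝ)) * m ξ) := by
    apply hm.bdd_mul (c := 1)
    · apply Continuous.aestronglyMeasurable; fun_prop
    · apply Eventually.of_forall; intro ξ
      rw [show 2 * (Real.pi:ℂ) * Complex.I * (⟪x, ξ⟫ : ℝ) = ((2 * Real.pi * ⟪x, ξ⟫ : ℝ) : ℂ) * I by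
        push_cast; ring, norm_exp_ofReal_mul_I]
  have h2 := ST_fourier_flip hf h1
  have e1 : ∀ y, 𝓕 (fun ξ => Complex.exp (2 * Real.pi * Complex.I * (⟪x, ξ⟫ : ℝ)) * m ξ) y
      = 𝓕⁻ m (x - y) := by
    intro y
    rw [Real.fourier_eq', Real.fourierInv_eq']
    congr 1; ext ξ
    simp only [smul_eq_mul]
    rw [← mul_assoc, ← Complex.exp_add]
    congr 2
    rw [inner_sub_right, real_inner_comm x ξ]
    push_cast; ring
  simp only [e1] at h2
  rw [Real.fourierInv_eq']
  calc _ = ∫ ξ, 𝓕 f ξ * (Complex.exp (2 * Real.pi * Complex.I * (⟪x, ξ⟫ : ℝ)) * m ξ) := by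
        congr 1; ext ξ
        simp only [smul_eq_mul]
        rw [real_inner_comm x ξ]
        rw [mul_comm (𝓕 f ξ), mul_comm (m ξ), mul_right_comm, mul_comm (𝓕 f ξ), ← mul_assoc]
        congr 3
        push_cast; ring
    _ = _ := by
        rw [h2]; congr 1; ext y; rw [mul_comm]

theorem ST_memLp_two {f : V → ℂ} (h2 : Integrable f) (K : ℝ) (hK : ∀ x, ‖f x‖ ≤ K) :
    MemLp f 2 volume := by
  rw [memLp_two_iff_integrable_sq_norm h2.aestronglyMeasurable]
  refine (h2.norm.const_mul K).mono' (h2.aestronglyMeasurable.norm.pow 2)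
    (Eventually.of_forall fun x => ?_)
  rw [Real.norm_of_nonneg (by positivity), sq]
  exact mul_le_mul_of_nonneg_right (hK x) (norm_nonneg _)

theorem ST_nice_memLp {f : V → ℂ} (hf : ST_nice volume f) : MemLp f 2 volume := by
  obtain ⟨h1, h2, K, hK⟩ := hf
  exact ST_memLp_two h2 K hK

theorem ST_mult_integrable {m f : V → ℂ} (hm : Integrable m) (hf : Integrable f) :
    Integrable (fun ξ => m ξ * 𝓕 f ξ) :=
  hm.mul_bdd (c := ∫ x, ‖f x‖) (ST_fourier_continuous hf).aestronglyMeasurable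
    (Eventually.of_forall fun ξ => ST_norm_fourier_le f ξ)

theorem ST_mult_L2 {m f : V → ℂ} (hm : Integrable m) (A : ℝ) (hA : ∀ ξ, ‖m ξ‖ ≤ A)
    (hf : ST_nice volume f) :
    ∫⁻ x, ‖𝓕⁻ (fun ξ => m ξ * 𝓕 f ξ) x‖ₑ ^ 2 ≤ ENNReal.ofReal (A ^ 2) * ∫⁻ x, ‖f x‖ₑ ^ 2 := by
  have hA0 : 0 ≤ A := (norm_nonneg _).trans (hA 0)
  have hi := ST_mult_integrable hm hf.2.1
  have hb : ∀ ξ, ‖m ξ * 𝓕 f ξ‖ ≤ A * ∫ x, ‖f x‖ := fun ξ => by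
    rw [norm_mul]
    exact mul_le_mul (hA ξ) (ST_norm_fourier_le f ξ) (norm_nonneg _) hA0
  rw [ST_plancherel_inv hi (ST_memLp_two hi _ hb), ← ST_plancherel hf.2.1 (ST_nice_memLp hf),
    ← lintegral_const_mul' _ _ ENNReal.ofReal_ne_top]
  apply lintegral_mono
  intro ξ
  simp only
  rw [enorm_mul, mul_pow, ENNReal.ofReal_pow hA0]
  gcongr
  rw [← ofReal_norm]
  exact ENNReal.ofReal_le_ofReal (hA ξ)

theorem ST_bilin (γ : ℝ) (h0 : 0 < γ) (h1 : γ < 1) : ∃ C : ℝ, 0 < C ∧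
    ∀ (m : V → ℂ) (A B : ℝ), 0 < A → 0 < B → Integrable m → (∀ ξ, ‖m ξ‖ ≤ A) →
      (∀ x, ‖𝓕⁻ m x‖ ≤ B) → ∀ u v : V → ℂ, ST_nice volume u → ST_nice volume v →
      ∫⁻ x, ‖∫ y, 𝓕⁻ m (x - y) * u y‖ₑ * ‖v x‖ₑ ≤
        ENNReal.ofReal (C * A ^ γ * B ^ (1 - γ)) *
          ((∫⁻ x, ‖u x‖ₑ ^ (2 / (2 - γ))) ^ ((2 - γ) / 2) *
           (∫⁻ x, ‖v x‖ₑ ^ (2 / (2 - γ))) ^ ((2 - γ) / 2)) := by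
  set p := 2 / (2 - γ) with hp
  set q := 2 / γ with hq
  have h2g : 0 < 2 - γ := by linarith
  have hp1 : 1 < p := by rw [hp, lt_div_iff₀ h2g]; linarith
  have hq1 : 2 < q := by rw [hq, lt_div_iff₀ h0]; linarith
  have hq2 : 0 < q - 2 := by linarith
  have hpq : (p - 1) * q = p := by rw [hp, hq]; field_simp; ring
  have hconj : q.HolderConjugate p := by
    rw [Real.holderConjugate_iff]
    refine ⟨by linarith, ?_⟩
    · rw [hp, hq]; field_simp; ring
  refine ⟨(4 * q / (q - 2) * 2 ^ (q - 2)) ^ (1 / q), by positivity, ?_⟩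
  intro m A B hA hB hm hmA hmB u v hu hv
  have hT : ∀ f, ST_nice volume f → (fun x => ∫ y, 𝓕⁻ m (x - y) * f y) =
      𝓕⁻ (fun ξ => m ξ * 𝓕 f ξ) := by
    intro f hf; ext x; exact (ST_conv m f hm hf.2.1 x).symm
  have hki : ∀ f, Integrable f → ∀ x, Integrable (fun y => 𝓕⁻ m (x - y) * f y) := by
    intro f hf x
    apply hf.bdd_mul (c := B)
    · exact ((ST_fourierInv_continuous hm).comp (by fun_prop)).aestronglyMeasurable
    · exact Eventually.of_forall fun y => hmB _
  have hcont : ∀ f, ST_nice volume f → Continuous (fun x => ∫ y, 𝓕⁻ m (x - y) * f y) := by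
    intro f hf; rw [hT f hf]
    exact ST_fourierInv_continuous (ST_mult_integrable hm hf.2.1)
  have main := ST_interp volume (fun f x => ∫ y, 𝓕⁻ m (x - y) * f y) A B hA hB
    (by
      intro f g hf hg x
      simp only [mul_add]
      exact integral_add (hki f hf.2.1 x) (hki g hg.2.1 x))
    (fun f hf => (hcont f hf).measurable)
    (by
      intro f hf x
      rw [← integral_const_mul]
      refine norm_integral_le_of_norm_le (hf.2.1.norm.const_mul B) (Eventually.of_forall fun y => ?_)
      rw [norm_mul]
      exact mul_le_mul_of_nonneg_right (hmB _) (norm_nonneg _))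
    (by
      intro f hf
      have := ST_mult_L2 hm A hmA hf
      rw [← hT f hf] at this
      exact this)
    p q hp1 hq1 hpq u hu
  refine (ENNReal.lintegral_mul_le_Lp_mul_Lq volume hconj
    (hcont u hu).measurable.enorm.aemeasurable hv.1.enorm.aemeasurable).trans ?_
  rw [← mul_assoc]
  have ep : 1 / p = (2 - γ) / 2 := by rw [hp]; field_simp
  rw [ep]
  gcongr
  calc _ ≤ (ENNReal.ofReal (4 * q / (q - 2) * A ^ 2 * (2 * B) ^ (q - 2)) *
       (∫⁻ x, ‖u x‖ₑ ^ p) ^ (q - 1)) ^ (1 / q) := by gcongr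
    _ = _ := by
      rw [ENNReal.mul_rpow_of_nonneg _ _ (by positivity), ← ENNReal.rpow_mul]
      congr 2
      · rw [ENNReal.ofReal_rpow_of_pos (by positivity)]
        congr 1
        rw [Real.mul_rpow (by norm_num) hB.le]
        rw [show 4 * q / (q - 2) * A ^ 2 * (2 ^ (q - 2) * B ^ (q - 2)) =
          4 * q / (q - 2) * 2 ^ (q - 2) * A ^ 2 * B ^ (q - 2) by ring,
          Real.mul_rpow (by positivity) (by positivity),
          Real.mul_rpow (by positivity) (by positivity)]
        rw [← Real.rpow_mul hB.le, ← Real.rpow_natCast, ← Real.rpow_mul hA.le]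
        congr 3
        · rw [hq]; push_cast; field_simp
        · rw [hq]; field_simp
      · rw [hq]; field_simp

end

noncomputable def ST_e (r θ : ℝ) : ℂ := Complex.exp (((r * Real.cos θ : ℝ) : ℂ) * Complex.I)

theorem ST_e_norm (r θ : ℝ) : ‖ST_e r θ‖ = 1 := by
  unfold ST_e; rw [norm_exp_ofReal_mul_I]

theorem ST_e_cont (r : ℝ) : Continuous (ST_e r) := by
  unfold ST_e; fun_prop

theorem ST_e_deriv (r θ : ℝ) :
    HasDerivAt (ST_e r) (ST_e r θ * (((-(r * Real.sin θ) : ℝ) : ℂ) * Complex.I)) θ := by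
  unfold ST_e
  apply HasDerivAt.cexp
  apply HasDerivAt.mul_const
  have := ((Real.hasDerivAt_cos θ).const_mul r).ofReal_comp
  rw [mul_neg] at this
  exact this

theorem ST_byparts (r : ℝ) (hr : r ≠ 0) (g g' : ℝ → ℝ) (a b : ℝ)
    (hg : ∀ x ∈ Set.uIcc a b, HasDerivAt g (g' x) x) (hi : IntervalIntegrable g' volume a b) :
    ∫ θ in a..b, ((g θ * Real.sin θ : ℝ) : ℂ) * ST_e r θ =
      (Complex.I / r) * ((g b : ℂ) * ST_e r b - (g a : ℂ) * ST_e r a -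
        ∫ θ in a..b, (g' θ : ℂ) * ST_e r θ) := by
  have h := intervalIntegral.integral_mul_deriv_eq_deriv_mul (a := a) (b := b)
    (u := fun x => (g x : ℂ)) (u' := fun x => (g' x : ℂ)) (v := ST_e r)
    (v' := fun θ => ST_e r θ * (((-(r * Real.sin θ) : ℝ) : ℂ) * Complex.I))
    (fun x hx => (hg x hx).ofReal_comp) (fun x _ => ST_e_deriv r x)
    ⟨hi.1.ofReal, hi.2.ofReal⟩ (by
      apply Continuous.intervalIntegrable
      have := ST_e_cont r
      fun_prop)
  rw [← h, ← intervalIntegral.integral_const_mul]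
  congr 1; ext θ
  have hr' : (r : ℂ) ≠ 0 := by exact_mod_cast hr
  push_cast
  field_simp
  ring_nf
  simp

noncomputable def ST_K (m : ℕ) (P : Polynomial ℝ) (r : ℝ) : ℂ :=
  ∫ θ in (0:ℝ)..Real.pi, ((P.eval (Real.cos θ) * Real.sin θ ^ m : ℝ) : ℂ) * ST_e r θ

theorem ST_poly_bdd (P : Polynomial ℝ) : ∃ C, 0 < C ∧ ∀ θ : ℝ, |P.eval (Real.cos θ)| ≤ C := by
  obtain ⟨C, hC⟩ := (isCompact_Icc (a := (-1:ℝ)) (b := 1)).exists_bound_of_continuousOn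
    (f := fun x => P.eval x) P.continuous.continuousOn
  refine ⟨max C 1, by positivity, fun θ => ?_⟩
  exact (hC _ ⟨Real.neg_one_le_cos θ, Real.cos_le_one θ⟩).trans (le_max_left _ _)

theorem ST_polycos_deriv (P : Polynomial ℝ) (θ : ℝ) :
    HasDerivAt (fun θ => P.eval (Real.cos θ)) (P.derivative.eval (Real.cos θ) * (-Real.sin θ)) θ :=
  (P.hasDerivAt (Real.cos θ)).comp θ (Real.hasDerivAt_cos θ)

theorem ST_polycos_cont (P : Polynomial ℝ) : Continuous (fun θ => P.eval (Real.cos θ)) :=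
  P.continuous.comp Real.continuous_cos

theorem ST_K_trivial (m : ℕ) (P : Polynomial ℝ) : ∃ C, 0 < C ∧ ∀ r, ‖ST_K m P r‖ ≤ C := by
  obtain ⟨C, hC, h⟩ := ST_poly_bdd P
  refine ⟨C * Real.pi, by positivity, fun r => ?_⟩
  have := intervalIntegral.norm_integral_le_of_norm_le_const (a := 0) (b := Real.pi) (C := C)
    (f := fun θ => ((P.eval (Real.cos θ) * Real.sin θ ^ m : ℝ) : ℂ) * ST_e r θ) (by
      intro θ _
      rw [norm_mul, ST_e_norm, mul_one, norm_real, norm_mul, norm_pow]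
      have h1 := h θ
      have h2 : ‖Real.sin θ‖ ^ m ≤ 1 := pow_le_one₀ (norm_nonneg _) (Real.abs_sin_le_one θ)
      calc _ ≤ C * 1 := mul_le_mul h1 h2 (by positivity) hC.le
        _ = C := mul_one C)
  rw [sub_zero, abs_of_pos Real.pi_pos] at this
  exact this

theorem ST_K_step (m : ℕ) (P : Polynomial ℝ) (r : ℝ) (hr : r ≠ 0) :
    ST_K (m + 2) P r = -(Complex.I / r) * ST_K m
      (-P.derivative * (1 - Polynomial.X ^ 2) + (m + 1 : ℝ) • (Polynomial.X * P)) r := by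
  have h := ST_byparts r hr (fun θ => P.eval (Real.cos θ) * Real.sin θ ^ (m + 1))
    (fun θ => P.derivative.eval (Real.cos θ) * (-Real.sin θ) * Real.sin θ ^ (m + 1) +
      P.eval (Real.cos θ) * (((m + 1 : ℕ) : ℝ) * Real.sin θ ^ m * Real.cos θ)) 0 Real.pi
    (fun θ _ => (ST_polycos_deriv P θ).mul (by
      have := (Real.hasDerivAt_sin θ).pow (m + 1)
      rw [show m + 1 - 1 = m from rfl] at this
      exact this))
    (by
      apply Continuous.intervalIntegrable
      have h1 := ST_polycos_cont P
      have h2 := ST_polycos_cont P.derivative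
      have := Real.continuous_sin
      have := Real.continuous_cos
      fun_prop)
  simp only [Real.sin_pi, Real.sin_zero, ne_eq, Nat.add_eq_zero_iff, one_ne_zero, and_false,
    not_false_eq_true, zero_pow, mul_zero, ofReal_zero, zero_mul, sub_zero, zero_sub] at h
  unfold ST_K
  rw [neg_mul, ← mul_neg]
  convert h using 1
  · congr 1; ext θ; congr 2; ring
  · congr 2
    congr 1; ext θ; congr 2
    simp only [Polynomial.eval_add, Polynomial.eval_mul, Polynomial.eval_neg, Polynomial.eval_sub,
      Polynomial.eval_one, Polynomial.eval_pow, Polynomial.eval_X, Polynomial.eval_smul, smul_eq_mul]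
    have : 1 - Real.cos θ ^ 2 = Real.sin θ ^ 2 := by rw [Real.sin_sq]
    rw [this]; push_cast; ring

theorem ST_K_one (P : Polynomial ℝ) : ∃ C, 0 < C ∧ ∀ r, 1 ≤ r → ‖ST_K 1 P r‖ ≤ C / r := by
  obtain ⟨C, hC, h⟩ := ST_poly_bdd P
  obtain ⟨D, hD, hd⟩ := ST_K_trivial 1 P.derivative
  refine ⟨C + C + D, by positivity, fun r hr => ?_⟩
  have hr0 : 0 < r := by linarith
  have hb := ST_byparts r hr0.ne' (fun θ => P.eval (Real.cos θ))
    (fun θ => P.derivative.eval (Real.cos θ) * (-Real.sin θ)) 0 Real.pi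
    (fun θ _ => ST_polycos_deriv P θ) (by
      apply Continuous.intervalIntegrable
      have h2 := ST_polycos_cont P.derivative
      have := Real.continuous_sin
      fun_prop)
  have e : ∫ θ in (0:ℝ)..Real.pi, ((P.derivative.eval (Real.cos θ) * (-Real.sin θ) : ℝ) : ℂ) * ST_e r θ
      = - ST_K 1 P.derivative r := by
    unfold ST_K
    rw [← intervalIntegral.integral_neg]
    congr 1; ext θ; push_cast; ring
  rw [e] at hb
  have : ST_K 1 P r = ∫ θ in (0:ℝ)..Real.pi, ((P.eval (Real.cos θ) * Real.sin θ : ℝ) : ℂ) * ST_e r θ := by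
    unfold ST_K; simp only [pow_one]
  rw [this, hb, norm_mul, norm_div, norm_I, norm_real, Real.norm_of_nonneg hr0.le, div_mul_eq_mul_div,
    one_mul]
  gcongr
  refine (norm_sub_le _ _).trans ?_
  refine add_le_add ((norm_sub_le _ _).trans (add_le_add ?_ ?_)) ?_
  · rw [norm_mul, ST_e_norm, mul_one, norm_real]; exact h _
  · rw [norm_mul, ST_e_norm, mul_one, norm_real]; exact h _
  · rw [norm_neg]; exact hd r

theorem ST_K_zero (P : Polynomial ℝ) :
    ∃ C, 0 < C ∧ ∀ r, 1 ≤ r → ‖ST_K 0 P r‖ ≤ C * r ^ (-(1/2:ℝ)) := by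
  obtain ⟨C, hC, h⟩ := ST_poly_bdd P
  obtain ⟨D, hD, hd⟩ := ST_poly_bdd P.derivative
  refine ⟨2 * C + 2 * C * Real.pi + (C + D) * Real.pi, by positivity, fun r hr => ?_⟩
  have hr0 : 0 < r := by linarith
  set ε := r ^ (-(1/2:ℝ)) with hε
  have hε0 : 0 < ε := by positivity
  have hε1 : ε ≤ 1 := Real.rpow_le_one_of_one_le_of_nonpos hr (by norm_num)
  have hεr : ε * ε * r = 1 := by
    rw [hε, ← Real.rpow_add hr0, ← Real.rpow_add_one hr0.ne']; norm_num
  have hpi := Real.pi_gt_three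
  have hsin : 2 / Real.pi * ε ≤ Real.sin ε := Real.mul_le_sin hε0.le (by linarith)
  have hsin0 : 0 < Real.sin ε := lt_of_lt_of_le (by positivity) hsin
  have hsinpos : ∀ x ∈ Set.uIcc ε (Real.pi - ε), 0 < Real.sin x := by
    intro x hx
    rw [Set.uIcc_of_le (by linarith)] at hx
    exact Real.sin_pos_of_pos_of_lt_pi (by linarith [hx.1]) (by linarith [hx.2])
  set F : ℝ → ℂ := fun θ => ((P.eval (Real.cos θ) * Real.sin θ ^ 0 : ℝ) : ℂ) * ST_e r θ with hF
  have hFc : Continuous F := by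
    have h1 := ST_polycos_cont P
    have h2 := ST_e_cont r
    have h3 := Real.continuous_sin
    simp only [hF]
    fun_prop
  have hFb : ∀ θ, ‖F θ‖ ≤ C := by
    intro θ
    simp only [hF, pow_zero, mul_one]
    rw [norm_mul, ST_e_norm, mul_one, norm_real]; exact h θ
  have hsplit : ST_K 0 P r = (∫ θ in (0:ℝ)..ε, F θ) + (∫ θ in ε..(Real.pi - ε), F θ) +
      ∫ θ in (Real.pi - ε)..Real.pi, F θ := by
    rw [intervalIntegral.integral_add_adjacent_intervals, intervalIntegral.integral_add_adjacent_intervals]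
    · rfl
    all_goals exact hFc.intervalIntegrable _ _
  have hA : ‖∫ θ in (0:ℝ)..ε, F θ‖ ≤ C * ε := by
    have := intervalIntegral.norm_integral_le_of_norm_le_const (a := 0) (b := ε) (C := C)
      (f := F) (fun θ _ => hFb θ)
    rwa [sub_zero, abs_of_pos hε0] at this
  have hB : ‖∫ θ in (Real.pi - ε)..Real.pi, F θ‖ ≤ C * ε := by
    have := intervalIntegral.norm_integral_le_of_norm_le_const (a := Real.pi - ε) (b := Real.pi) (C := C)
      (f := F) (fun θ _ => hFb θ)
    rwa [sub_sub_cancel, abs_of_pos hε0] at this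
  set g' : ℝ → ℝ := fun θ => (P.derivative.eval (Real.cos θ) * (-Real.sin θ) * Real.sin θ -
      P.eval (Real.cos θ) * Real.cos θ) / Real.sin θ ^ 2 with hg'
  have hg'i : IntervalIntegrable g' volume ε (Real.pi - ε) := by
    apply ContinuousOn.intervalIntegrable
    intro x hx
    apply ContinuousAt.continuousWithinAt
    have h1 := (ST_polycos_cont P).continuousAt (x := x)
    have h2 := (ST_polycos_cont P.derivative).continuousAt (x := x)
    apply ContinuousAt.div
    · fun_prop
    · fun_prop
    · exact (pow_pos (hsinpos x hx) 2).ne'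
  have hb := ST_byparts r hr0.ne' (fun θ => P.eval (Real.cos θ) / Real.sin θ) g' ε (Real.pi - ε)
    (fun θ hθ => (ST_polycos_deriv P θ).div (Real.hasDerivAt_sin θ) (hsinpos θ hθ).ne') hg'i
  have hmid : ∫ θ in ε..(Real.pi - ε), F θ = ∫ θ in ε..(Real.pi - ε),
      ((P.eval (Real.cos θ) / Real.sin θ * Real.sin θ : ℝ) : ℂ) * ST_e r θ := by
    apply intervalIntegral.integral_congr
    intro θ hθ
    simp only [hF, pow_zero, mul_one]
    rw [div_mul_cancel₀ _ (hsinpos θ hθ).ne']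
  have hcot : ∀ x ∈ Set.uIcc ε (Real.pi - ε),
      HasDerivAt (fun x => -(Real.cos x / Real.sin x)) (1 / Real.sin x ^ 2) x := by
    intro x hx
    have := ((Real.hasDerivAt_cos x).div (Real.hasDerivAt_sin x) (hsinpos x hx).ne').neg
    have e : 1 / Real.sin x ^ 2 =
        -((-Real.sin x * Real.sin x - Real.cos x * Real.cos x) / Real.sin x ^ 2) := by
      rw [← neg_div]; congr 1
      nlinarith [Real.sin_sq_add_cos_sq x]
    rw [e]
    exact this
  have hii : IntervalIntegrable (fun x => 1 / Real.sin x ^ 2) volume ε (Real.pi - ε) := by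
    apply ContinuousOn.intervalIntegrable
    intro x hx
    apply ContinuousAt.continuousWithinAt
    apply ContinuousAt.div
    · fun_prop
    · fun_prop
    · exact (pow_pos (hsinpos x hx) 2).ne'
  have hIntg : ∫ x in ε..(Real.pi - ε), 1 / Real.sin x ^ 2 = 2 * (Real.cos ε / Real.sin ε) := by
    rw [intervalIntegral.integral_eq_sub_of_hasDerivAt hcot hii, Real.cos_pi_sub, Real.sin_pi_sub]
    ring
  have hlast : ‖∫ θ in ε..(Real.pi - ε), (g' θ : ℂ) * ST_e r θ‖ ≤ (C + D) * (2 * (Real.cos ε / Real.sin ε)) := by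
    rw [← hIntg, ← intervalIntegral.integral_const_mul]
    apply intervalIntegral.norm_integral_le_of_norm_le (by linarith)
    · apply Eventually.of_forall
      intro θ hθ
      have hs := hsinpos θ (by
        rw [Set.uIcc_of_le (by linarith)]; exact ⟨hθ.1.le, hθ.2⟩)
      rw [norm_mul, ST_e_norm, mul_one, norm_real]
      simp only [hg', norm_div, norm_pow]
      rw [Real.norm_of_nonneg hs.le, ← mul_div_assoc, mul_one]
      gcongr
      refine (norm_sub_le _ _).trans ?_
      rw [add_comm C]
      apply add_le_add
      · rw [norm_mul, norm_mul, norm_neg]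
        have a1 := hd θ
        have a2 : ‖Real.sin θ‖ ≤ 1 := Real.abs_sin_le_one θ
        calc _ ≤ D * 1 * 1 := by gcongr; exact a1
          _ = D := by ring
      · rw [norm_mul]
        have a1 := h θ
        have a2 : ‖Real.cos θ‖ ≤ 1 := Real.abs_cos_le_one θ
        calc _ ≤ C * 1 := by gcongr; exact a1
          _ = C := by ring
    · exact hii.const_mul _
  have hcs : Real.cos ε / Real.sin ε ≤ Real.pi / (2 * ε) := by
    rw [div_le_div_iff₀ hsin0 (by positivity)]
    have : 2 * ε ≤ Real.pi * Real.sin ε := by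
      calc 2 * ε = Real.pi * (2 / Real.pi * ε) := by field_simp
        _ ≤ _ := by gcongr
    nlinarith [Real.cos_le_one ε]
  have hinvs : 1 / Real.sin ε ≤ Real.pi / (2 * ε) := by
    rw [div_le_div_iff₀ hsin0 (by positivity)]
    have : 2 * ε ≤ Real.pi * Real.sin ε := by
      calc 2 * ε = Real.pi * (2 / Real.pi * ε) := by field_simp
        _ ≤ _ := by gcongr
    linarith
  have hend : ∀ θ, Real.sin θ = Real.sin ε → ‖((P.eval (Real.cos θ) / Real.sin θ : ℝ) : ℂ) * ST_e r θ‖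
      ≤ C * (Real.pi / (2 * ε)) := by
    intro θ hθ
    rw [norm_mul, ST_e_norm, mul_one, norm_real, norm_div, hθ, Real.norm_of_nonneg hsin0.le,
      div_eq_mul_one_div]
    gcongr
    exact h θ
  have hM : ‖∫ θ in ε..(Real.pi - ε), F θ‖ ≤ (2 * C * Real.pi + (C + D) * Real.pi) * ε := by
    rw [hmid, hb, norm_mul, norm_div, norm_I, norm_real, Real.norm_of_nonneg hr0.le]
    have h1r : 1 / r = ε * ε := by field_simp; linarith
    rw [h1r]
    have := (norm_sub_le (((P.eval (Real.cos (Real.pi - ε)) / Real.sin (Real.pi - ε) : ℝ) : ℂ) * ST_e r (Real.pi - ε) -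
      ((P.eval (Real.cos ε) / Real.sin ε : ℝ) : ℂ) * ST_e r ε) (∫ θ in ε..(Real.pi - ε), (g' θ : ℂ) * ST_e r θ))
    have h3 := norm_sub_le (((P.eval (Real.cos (Real.pi - ε)) / Real.sin (Real.pi - ε) : ℝ) : ℂ) * ST_e r (Real.pi - ε))
      (((P.eval (Real.cos ε) / Real.sin ε : ℝ) : ℂ) * ST_e r ε)
    have h4 := hend (Real.pi - ε) (Real.sin_pi_sub ε)
    have h5 := hend ε rfl
    have h6 : (C + D) * (2 * (Real.cos ε / Real.sin ε)) ≤ (C + D) * (2 * (Real.pi / (2 * ε))) := by gcongr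
    have h7 : ‖((P.eval (Real.cos (Real.pi - ε)) / Real.sin (Real.pi - ε) : ℝ) : ℂ) * ST_e r (Real.pi - ε) -
      ((P.eval (Real.cos ε) / Real.sin ε : ℝ) : ℂ) * ST_e r ε - ∫ θ in ε..(Real.pi - ε), (g' θ : ℂ) * ST_e r θ‖
      ≤ C * (Real.pi / (2 * ε)) + C * (Real.pi / (2 * ε)) + (C + D) * (2 * (Real.pi / (2 * ε))) := by
      linarith
    calc _ ≤ ε * ε * (C * (Real.pi / (2 * ε)) + C * (Real.pi / (2 * ε)) + (C + D) * (2 * (Real.pi / (2 * ε)))) := by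
          gcongr
      _ = (C * Real.pi + (C + D) * Real.pi) * ε := by field_simp; ring
      _ ≤ _ := by
        have : 0 ≤ C * Real.pi := by positivity
        gcongr; linarith
  rw [hsplit]
  refine (norm_add_le _ _).trans ?_
  have := norm_add_le (∫ θ in (0:ℝ)..ε, F θ) (∫ θ in ε..(Real.pi - ε), F θ)
  nlinarith

theorem ST_K_decay (m : ℕ) : ∀ P : Polynomial ℝ,
    ∃ C, 0 < C ∧ ∀ r, 1 ≤ r → ‖ST_K m P r‖ ≤ C * r ^ (-(((m:ℝ) + 1)/2)) := by
  induction m using Nat.twoStepInduction with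
  | zero => intro P; simpa using ST_K_zero P
  | one =>
    intro P
    obtain ⟨C, hC, h⟩ := ST_K_one P
    refine ⟨C, hC, fun r hr => ?_⟩
    convert h r hr using 1
    rw [show -((((1:ℕ):ℝ) + 1)/2) = -1 by norm_num, Real.rpow_neg_one]; rfl
  | more m ih _ =>
    intro P
    obtain ⟨C, hC, h⟩ := ih (-P.derivative * (1 - Polynomial.X ^ 2) + (m + 1 : ℝ) • (Polynomial.X * P))
    refine ⟨C, hC, fun r hr => ?_⟩
    have hr0 : 0 < r := by linarith
    rw [ST_K_step m P r hr0.ne', norm_mul, norm_neg, norm_div, norm_I, norm_real,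
      Real.norm_of_nonneg hr0.le]
    calc _ ≤ 1 / r * (C * r ^ (-(((m:ℝ) + 1)/2))) := by gcongr; exact h r hr
      _ = C * r ^ (-((((m + 2 : ℕ):ℝ) + 1)/2)) := by
        rw [show -((((m + 2 : ℕ):ℝ) + 1)/2) = -(((m:ℝ) + 1)/2) - 1 by push_cast; ring,
          Real.rpow_sub_one hr0.ne']
        ring

theorem ST_split (m : ℕ) (v : EuclideanSpace ℝ (Fin (m + 1))) (hv : ‖v‖ = 1) :
    ∃ e : (ℝ × EuclideanSpace ℝ (Fin m)) ≃L[ℝ] EuclideanSpace ℝ (Fin (m + 1)),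
      MeasurePreserving e volume volume ∧
      (∀ a b, ⟪e a, e b⟫ = a.1 * b.1 + ⟪a.2, b.2⟫) ∧ (∀ a, ⟪v, e a⟫ = a.1) := by
  have hfr : Module.finrank ℝ (WithLp 2 (ℝ × EuclideanSpace ℝ (Fin m))) =
      m + 1 := by
    rw [LinearEquiv.finrank_eq (WithLp.linearEquiv 2 ℝ (ℝ × EuclideanSpace ℝ (Fin m)))]
    simp; ring
  let L0 : WithLp 2 (ℝ × EuclideanSpace ℝ (Fin m)) ≃ₗᵢ[ℝ] EuclideanSpace ℝ (Fin (m + 1)) :=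
    ((stdOrthonormalBasis ℝ _).reindex (finCongr hfr)).repr
  let u : WithLp 2 (ℝ × EuclideanSpace ℝ (Fin m)) := WithLp.toLp 2 (1, 0)
  have hu : ‖u‖ = 1 := by
    simp [u]
  have hn : ‖L0 u‖ = ‖v‖ := by rw [L0.norm_map, hu, hv]
  let L := L0.trans (ℝ ∙ (L0 u - v))ᗮ.reflection
  have hL : L u = v := Submodule.reflection_sub hn
  let e := (WithLp.prodContinuousLinearEquiv 2 ℝ ℝ (EuclideanSpace ℝ (Fin m))).symm.trans
    L.toContinuousLinearEquiv
  have he : ∀ a, e a = L (WithLp.toLp 2 a) := fun a => rfl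
  refine ⟨e, ?_, ?_, ?_⟩
  · exact L.measurePreserving.comp (WithLp.volume_preserving_toLp ..)
  · intro a b
    rw [he, he, L.inner_map_map]
    simp [mul_comm]
  · intro a
    rw [he, ← hL, L.inner_map_map]
    simp [u]

theorem ST_ball_fourier (m : ℕ) (x : EuclideanSpace ℝ (Fin (m + 1))) (R : ℝ) (hR : 0 ≤ R) :
    ∫ ξ in Metric.closedBall (0 : EuclideanSpace ℝ (Fin (m + 1))) R,
      Complex.exp (((2 * Real.pi * ⟪x, ξ⟫ : ℝ) : ℂ) * Complex.I) =
    ((volume (Metric.ball (0 : EuclideanSpace ℝ (Fin m)) 1)).toReal * R ^ (m + 1) : ℝ) *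
      ST_K (m + 1) 1 (2 * Real.pi * ‖x‖ * R) := by
  set ω := (volume (Metric.ball (0 : EuclideanSpace ℝ (Fin m)) 1)).toReal with hω
  have hv : ∃ v : EuclideanSpace ℝ (Fin (m + 1)), ‖v‖ = 1 ∧ x = ‖x‖ • v := by
    by_cases hx : x = 0
    · exact ⟨EuclideanSpace.single 0 1, by simp, by simp [hx]⟩
    · refine ⟨‖x‖⁻¹ • x, norm_smul_inv_norm hx, ?_⟩
      rw [smul_smul, mul_inv_cancel₀ (norm_ne_zero_iff.2 hx), one_smul]
  obtain ⟨v, hv1, hxv⟩ := hv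
  obtain ⟨e, he, hin, hev⟩ := ST_split m v hv1
  have hemb : MeasurableEmbedding e := e.toHomeomorph.measurableEmbedding
  set r := ‖x‖ with hr
  set c : ℝ → ℂ := fun s => Complex.exp (((2 * Real.pi * r * s : ℝ) : ℂ) * Complex.I) with hc
  have hcc : Continuous c := by simp only [hc]; fun_prop
  set S : Set (ℝ × EuclideanSpace ℝ (Fin m)) := {a | a.1 ^ 2 + ‖a.2‖ ^ 2 ≤ R ^ 2} with hS
  have hSm : MeasurableSet S := measurableSet_le (by fun_prop) measurable_const
  have hpre : e ⁻¹' Metric.closedBall 0 R = S := by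
    ext a
    simp only [Set.mem_preimage, mem_closedBall_zero_iff, hS, Set.mem_ofPred_eq]
    rw [← sq_le_sq₀ (norm_nonneg _) hR, ← real_inner_self_eq_norm_sq, hin, real_inner_self_eq_norm_sq,
      ← sq a.1]
  have hSfin : volume S < ∞ := by
    rw [← hpre, he.measure_preimage_emb hemb]
    exact measure_closedBall_lt_top
  have hslice : ∀ s, |s| ≤ R → volume (Prod.mk s ⁻¹' S) = ENNReal.ofReal (√(R ^ 2 - s ^ 2) ^ m * ω) := by
    intro s hs
    have h1 : Prod.mk s ⁻¹' S = Metric.closedBall 0 √(R ^ 2 - s ^ 2) := by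
      ext y
      simp only [Set.mem_preimage, mem_closedBall_zero_iff, hS, Set.mem_ofPred_eq]
      have h0 : 0 ≤ R ^ 2 - s ^ 2 := by
        rw [← sq_abs s]; nlinarith [abs_nonneg s]
      rw [Real.le_sqrt (norm_nonneg _), le_sub_iff_add_le, add_comm]
      exact h0
    rw [h1, Measure.addHaar_closedBall _ _ (Real.sqrt_nonneg _), ENNReal.ofReal_mul (by positivity), hω,
      ENNReal.ofReal_toReal measure_ball_lt_top.ne]
    simp
  calc _ = ∫ a in S, c a.1 := by
        rw [← hpre, ← he.setIntegral_preimage_emb hemb]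
        congr 1; ext a
        simp only [hc]
        rw [hxv, inner_smul_left, hev]
        congr 3; simp [mul_assoc]
    _ = ∫ s, ∫ y, S.indicator (fun a => c a.1) (s, y) := by
        rw [← integral_indicator hSm]
        rw [← integral_prod]
        · rfl
        · rw [← Measure.volume_eq_prod, integrable_indicator_iff hSm]
          refine Measure.integrableOn_of_bounded (M := 1) hSfin.ne ?_ ?_
          · exact (hcc.comp continuous_fst).aestronglyMeasurable
          · apply Eventually.of_forall; intro a
            simp only [hc]; rw [norm_exp_ofReal_mul_I]
    _ = ∫ s in Set.Icc (-R) R, ((√(R ^ 2 - s ^ 2) ^ m * ω : ℝ) : ℂ) * c s := by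
        rw [← integral_indicator measurableSet_Icc]
        congr 1; ext s
        by_cases hs : |s| ≤ R
        · rw [Set.indicator_of_mem (by rwa [Set.mem_Icc, ← abs_le])]
          have : ∀ y, S.indicator (fun a : ℝ × EuclideanSpace ℝ (Fin m) => c a.1) (s, y) =
            (Prod.mk s ⁻¹' S).indicator (fun _ => c s) y := by
            intro y; simp [Set.indicator]
          simp_rw [this]
          rw [integral_indicator (measurable_prodMk_left hSm), setIntegral_const, Measure.real, hslice s hs,
            ENNReal.toReal_ofReal (by positivity), real_smul]
        · rw [Set.indicator_of_notMem (by rwa [Set.mem_Icc, ← abs_le])]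
          have : ∀ y, S.indicator (fun a : ℝ × EuclideanSpace ℝ (Fin m) => c a.1) (s, y) = 0 := by
            intro y
            apply Set.indicator_of_notMem
            simp only [hS, Set.mem_ofPred_eq, not_le]
            have : R ^ 2 < s ^ 2 := by
              rw [← sq_abs s]; exact pow_lt_pow_left₀ (not_le.1 hs) hR (by norm_num)
            nlinarith [sq_nonneg ‖y‖]
          simp [this]
    _ = ∫ s in (-R)..R, ((√(R ^ 2 - s ^ 2) ^ m * ω : ℝ) : ℂ) * c s := by
        rw [intervalIntegral.integral_of_le (by linarith), integral_Icc_eq_integral_Ioc]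
    _ = _ := by
        have hcv := intervalIntegral.integral_deriv_smul_comp (a := 0) (b := Real.pi)
          (f := fun θ => R * Real.cos θ) (f' := fun θ => R * (-Real.sin θ))
          (g := fun s => ((√(R ^ 2 - s ^ 2) ^ m * ω : ℝ) : ℂ) * c s)
          (fun θ _ => (Real.hasDerivAt_cos θ).const_mul R)
          (by
            have := Real.continuous_sin
            apply Continuous.continuousOn; fun_prop)
          (by fun_prop)
        simp only [Real.cos_zero, Real.cos_pi, mul_one, mul_neg] at hcv
        rw [intervalIntegral.integral_symm, ← hcv]
        unfold ST_K
        rw [← intervalIntegral.integral_const_mul, ← intervalIntegral.integral_neg]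
        apply intervalIntegral.integral_congr
        intro θ hθ
        rw [Set.uIcc_of_le Real.pi_pos.le] at hθ
        have hs : 0 ≤ Real.sin θ := Real.sin_nonneg_of_nonneg_of_le_pi hθ.1 hθ.2
        have hsq : √(R ^ 2 - (R * Real.cos θ) ^ 2) = R * Real.sin θ := by
          rw [show R ^ 2 - (R * Real.cos θ) ^ 2 = (R * Real.sin θ) ^ 2 by
            rw [mul_pow, mul_pow, Real.sin_sq]; ring]
          exact Real.sqrt_sq (by positivity)
        simp only [Function.comp, hsq, hc, ST_e, Polynomial.eval_one, real_smul]
        rw [show 2 * Real.pi * r * (R * Real.cos θ) = 2 * Real.pi * r * R * Real.cos θ by ring]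
        push_cast
        ring

theorem ST_K_deriv (m : ℕ) (P : Polynomial ℝ) (r : ℝ) :
    HasDerivAt (ST_K m P) (Complex.I * ST_K m (Polynomial.X * P) r) r := by
  obtain ⟨C, hC, h⟩ := ST_poly_bdd (Polynomial.X * P)
  have hP := ST_polycos_cont P
  have hXP := ST_polycos_cont (Polynomial.X * P)
  have hs := Real.continuous_sin
  have key := intervalIntegral.hasDerivAt_integral_of_dominated_loc_of_deriv_le
    (μ := volume) (a := 0) (b := Real.pi) (x₀ := r) (s := Set.univ)
    (F := fun r θ => ((P.eval (Real.cos θ) * Real.sin θ ^ m : ℝ) : ℂ) * ST_e r θ)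
    (F' := fun r θ => Complex.I *
      ((((Polynomial.X * P).eval (Real.cos θ) * Real.sin θ ^ m : ℝ) : ℂ) * ST_e r θ))
    (bound := fun _ => C) Filter.univ_mem
    (by
      apply Eventually.of_forall; intro r
      apply Continuous.aestronglyMeasurable
      have := ST_e_cont r
      fun_prop)
    (by
      apply Continuous.intervalIntegrable
      have := ST_e_cont r
      fun_prop)
    (by
      apply Continuous.aestronglyMeasurable
      have := ST_e_cont r
      fun_prop)
    (by
      apply Eventually.of_forall; intro θ _ r _
      rw [norm_mul, norm_I, one_mul, norm_mul, ST_e_norm, mul_one, norm_real, norm_mul, norm_pow]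
      have h1 := h θ
      have h2 : ‖Real.sin θ‖ ^ m ≤ 1 := pow_le_one₀ (norm_nonneg _) (Real.abs_sin_le_one θ)
      calc _ ≤ C * 1 := mul_le_mul h1 h2 (by positivity) hC.le
        _ = C := mul_one C)
    (by simp)
    (by
      apply Eventually.of_forall; intro θ _ r _
      have h1 : HasDerivAt (fun r => ST_e r θ) (ST_e r θ * ((Real.cos θ : ℂ) * Complex.I)) r := by
        unfold ST_e
        apply HasDerivAt.cexp
        apply HasDerivAt.mul_const
        have := ((hasDerivAt_id r).mul_const (Real.cos θ)).ofReal_comp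
        simpa using this
      have h2 := h1.const_mul ((P.eval (Real.cos θ) * Real.sin θ ^ m : ℝ) : ℂ)
      have e : Complex.I * ((((Polynomial.X * P).eval (Real.cos θ) * Real.sin θ ^ m : ℝ) : ℂ) * ST_e r θ)
        = ((P.eval (Real.cos θ) * Real.sin θ ^ m : ℝ) : ℂ) * (ST_e r θ * ((Real.cos θ : ℂ) * Complex.I)) := by
        simp only [Polynomial.eval_mul, Polynomial.eval_X]
        push_cast; ring
      rw [e]; exact h2)
  have := key.2
  rw [intervalIntegral.integral_const_mul] at this
  exact this

theorem ST_K_decay' (m : ℕ) (P : Polynomial ℝ) :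
    ∃ C, 0 < C ∧ ∀ r, 0 ≤ r → ‖ST_K m P r‖ ≤ C * (1 + r) ^ (-(((m:ℝ) + 1)/2)) := by
  obtain ⟨C, hC, h⟩ := ST_K_decay m P
  obtain ⟨D, hD, hd⟩ := ST_K_trivial m P
  set α := ((m:ℝ) + 1)/2 with hα
  have hα0 : 0 < α := by positivity
  refine ⟨(C + D) * 2 ^ α, by positivity, fun r hr => ?_⟩
  have key : ∀ s, 0 < s → 1 + r ≤ 2 * s → s ^ (-α) ≤ 2 ^ α * (1 + r) ^ (-α) := by
    intro s hs h2
    have : (2 * s) ^ (-α) ≤ (1 + r) ^ (-α) :=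
      Real.rpow_le_rpow_of_nonpos (by linarith) h2 (by linarith)
    rw [Real.mul_rpow (by norm_num) hs.le] at this
    calc s ^ (-α) = 2 ^ α * (2 ^ (-α) * s ^ (-α)) := by
          rw [← mul_assoc, ← Real.rpow_add (by norm_num)]; simp
      _ ≤ _ := by gcongr
  rcases le_total 1 r with h1 | h1
  · calc _ ≤ C * r ^ (-α) := h r h1
      _ ≤ C * (2 ^ α * (1 + r) ^ (-α)) := by gcongr; exact key r (by linarith) (by linarith)
      _ ≤ (C + D) * (2 ^ α * (1 + r) ^ (-α)) := by
        gcongr; linarith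
      _ = _ := by ring
  · calc _ ≤ D * 1 ^ (-α) := by rw [Real.one_rpow, mul_one]; exact hd r
      _ ≤ D * (2 ^ α * (1 + r) ^ (-α)) := by gcongr; exact key 1 (by linarith) (by linarith)
      _ ≤ (C + D) * (2 ^ α * (1 + r) ^ (-α)) := by
        gcongr; linarith
      _ = _ := by ring

/-- half-open annulus -/
def ST_ann (n : ℕ) (a b : ℝ) : Set (EuclideanSpace ℝ (Fin n)) := {ξ | a < ‖ξ‖ ∧ ‖ξ‖ ≤ b}

theorem ST_ann_meas (n : ℕ) (a b : ℝ) : MeasurableSet (ST_ann n a b) :=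
  (measurableSet_lt measurable_const measurable_norm).inter
    (measurableSet_le measurable_norm measurable_const)

theorem ST_ann_sub (n : ℕ) (a b : ℝ) : ST_ann n a b ⊆ Metric.closedBall 0 b := by
  intro x hx; simpa using hx.2

theorem ST_ann_fin (n : ℕ) (a b : ℝ) : volume (ST_ann n a b) < ∞ :=
  (measure_mono (ST_ann_sub n a b)).trans_lt measure_closedBall_lt_top

theorem ST_annulus (m : ℕ) : ∃ C : ℝ, 0 < C ∧ ∀ a b : ℝ, 1 / 2 ≤ a → a ≤ b → b ≤ 3 →
    ∀ x : EuclideanSpace ℝ (Fin (m + 1)),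
    ‖𝓕⁻ ((ST_ann (m + 1) a b).indicator (fun _ => (1:ℂ))) x‖ ≤
      C * (b - a) * (1 + ‖x‖) ^ (-((m:ℝ) / 2)) := by
  obtain ⟨C, hC, hK⟩ := ST_K_decay' (m + 1) 1
  obtain ⟨D, hD, hK'⟩ := ST_K_decay' (m + 1) (Polynomial.X * 1)
  set ω := (volume (Metric.ball (0 : EuclideanSpace ℝ (Fin m)) 1)).toReal with hω
  have hω0 : 0 ≤ ω := ENNReal.toReal_nonneg
  have hpi := Real.pi_pos
  set M := ω * ((m + 1 : ℝ) * 3 ^ m * C + 3 ^ (m + 1) * (2 * Real.pi) * D) with hM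
  have hM0 : 0 ≤ M := by positivity
  refine ⟨M + 1, by positivity, fun a b ha hab hb x => ?_⟩
  set ρ := 2 * Real.pi * ‖x‖ with hρ
  have hρ0 : 0 ≤ ρ := by positivity
  set c : EuclideanSpace ℝ (Fin (m + 1)) → ℂ := fun ξ => Complex.exp (((2 * Real.pi * ⟪x, ξ⟫ : ℝ) : ℂ) * Complex.I) with hc
  have hcc : Continuous c := by simp only [hc]; fun_prop
  set Φ : ℝ → ℂ := fun R => ((ω * R ^ (m + 1) : ℝ) : ℂ) * ST_K (m + 1) 1 (ρ * R) with hΦ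
  have hIntg : 𝓕⁻ ((ST_ann (m + 1) a b).indicator (fun _ => (1:ℂ))) x = Φ b - Φ a := by
    rw [Real.fourierInv_eq']
    have h1 : ∫ ξ in Metric.closedBall (0:EuclideanSpace ℝ (Fin (m + 1))) b, c ξ = Φ b := ST_ball_fourier m x b (by linarith)
    have h2 : ∫ ξ in Metric.closedBall (0:EuclideanSpace ℝ (Fin (m + 1))) a, c ξ = Φ a := ST_ball_fourier m x a (by linarith)
    rw [← h1, ← h2]
    have hd : ST_ann (m + 1) a b = Metric.closedBall (0:EuclideanSpace ℝ (Fin (m + 1))) b \ Metric.closedBall (0:EuclideanSpace ℝ (Fin (m + 1))) a := by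
      ext ξ; simp [ST_ann]; exact and_comm
    rw [← setIntegral_sdiff measurableSet_closedBall]
    · rw [← hd, ← integral_indicator (ST_ann_meas _ _ _)]
      congr 1; ext ξ
      by_cases h : ξ ∈ ST_ann (m + 1) a b
      · simp only [h, Set.indicator_of_mem, hc]
        rw [real_inner_comm x ξ]; simp
      · simp [h]
    · exact hcc.continuousOn.integrableOn_compact (isCompact_closedBall _ _)
    · exact Metric.closedBall_subset_closedBall hab
  rw [hIntg]
  set Φ' : ℝ → ℂ := fun R => ((ω * ((m + 1 : ℕ) * R ^ m) : ℝ) : ℂ) * ST_K (m + 1) 1 (ρ * R) +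
      ((ω * R ^ (m + 1) : ℝ) : ℂ) * (Complex.I * ST_K (m + 1) (Polynomial.X * 1) (ρ * R) * ρ) with hΦ'
  have hder : ∀ R, HasDerivAt Φ (Φ' R) R := by
    intro R
    apply HasDerivAt.mul
    · apply HasDerivAt.ofReal_comp
      have := (hasDerivAt_pow (m + 1) R).const_mul ω
      simpa using this
    · have h1 : HasDerivAt (fun R : ℝ => ρ * R) ρ R := by
        simpa using (hasDerivAt_id R).const_mul ρ
      have := (ST_K_deriv (m + 1) 1 (ρ * R)).scomp R h1
      rw [real_smul, mul_comm] at this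
      exact this
  have hbd : ∀ R ∈ Set.Icc a b, ‖Φ' R‖ ≤ M * (1 + ‖x‖) ^ (-((m:ℝ) / 2)) := by
    intro R hR
    have hR1 : 1 / 2 ≤ R := ha.trans hR.1
    have hR3 : R ≤ 3 := hR.2.trans hb
    have hxn := norm_nonneg x
    have hρR : ‖x‖ ≤ ρ * R := by
      rw [hρ]; nlinarith [Real.pi_gt_three, mul_nonneg hpi.le hxn]
    have hdec : (1 + ρ * R) ^ (-((((m + 1 : ℕ):ℝ) + 1)/2)) ≤ (1 + ‖x‖) ^ (-((((m + 1 : ℕ):ℝ) + 1)/2)) :=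
      Real.rpow_le_rpow_of_nonpos (by linarith) (by linarith) (by
        have : (0:ℝ) ≤ (((m + 1 : ℕ):ℝ) + 1)/2 := by positivity
        linarith)
    have hsplit : (1 + ‖x‖) ^ (-((((m + 1 : ℕ):ℝ) + 1)/2)) = (1 + ‖x‖) ^ (-((m:ℝ) / 2)) / (1 + ‖x‖) := by
      rw [← Real.rpow_sub_one (by positivity)]; congr 1; push_cast; ring
    have h1 := hK (ρ * R) (by positivity)
    have h2 := hK' (ρ * R) (by positivity)
    set y := (1 + ‖x‖) ^ (-((m:ℝ) / 2)) with hy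
    have hy0 : 0 ≤ y := by positivity
    rw [hsplit] at hdec
    have hC1 : ‖ST_K (m + 1) 1 (ρ * R)‖ ≤ C * y := by
      refine h1.trans ?_
      gcongr
      exact hdec.trans (div_le_self hy0 (by linarith))
    have hC2 : ‖ST_K (m + 1) (Polynomial.X * 1) (ρ * R)‖ * ρ ≤ D * (2 * Real.pi) * y := by
      calc _ ≤ D * (y / (1 + ‖x‖)) * (2 * Real.pi * (1 + ‖x‖)) := by
            gcongr
            · exact h2.trans (by gcongr)
            · rw [hρ]; gcongr; linarith
        _ = _ := by field_simp
    refine (norm_add_le _ _).trans ?_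
    rw [norm_mul, norm_mul, norm_mul, norm_mul, norm_I, one_mul, norm_real, norm_real, norm_real,
      Real.norm_of_nonneg hρ0, Real.norm_of_nonneg (by positivity), Real.norm_of_nonneg (by positivity)]
    calc _ ≤ ω * ((m + 1 : ℕ) * 3 ^ m) * (C * y) + ω * 3 ^ (m + 1) * (D * (2 * Real.pi) * y) := by
          gcongr
      _ = M * y := by rw [hM]; push_cast; ring
  have hmv := Convex.norm_image_sub_le_of_norm_hasDerivWithin_le (f := Φ) (f' := Φ') (s := Set.Icc a b)
    (x := a) (y := b) (C := M * (1 + ‖x‖) ^ (-((m:ℝ) / 2)))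
    (fun R _ => (hder R).hasDerivWithinAt) hbd (convex_Icc a b) (Set.left_mem_Icc.2 hab)
    (Set.right_mem_Icc.2 hab)
  refine hmv.trans ?_
  rw [Real.norm_of_nonneg (by linarith)]
  have : 0 ≤ b - a := by linarith
  calc _ = M * (b - a) * (1 + ‖x‖) ^ (-((m:ℝ) / 2)) := by ring
    _ ≤ _ := by gcongr; linarith

/-- the annulus multiplier weighted by a squared coordinate -/
noncomputable def ST_am (m : ℕ) (v : EuclideanSpace ℝ (Fin (m + 1))) (a b : ℝ) :
    EuclideanSpace ℝ (Fin (m + 1)) → ℂ :=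
  (ST_ann (m + 1) a b).indicator (fun ξ => ((⟪v, ξ⟫ ^ 2 : ℝ) : ℂ))

theorem ST_ind_int (n : ℕ) (a b : ℝ) :
    Integrable ((ST_ann n a b).indicator (fun _ => (1:ℂ))) := by
  rw [integrable_indicator_iff (ST_ann_meas n a b)]
  exact integrableOn_const (ST_ann_fin n a b).ne

theorem ST_am_int (m : ℕ) (v : EuclideanSpace ℝ (Fin (m + 1))) (a b : ℝ) :
    Integrable (ST_am m v a b) := by
  unfold ST_am
  rw [integrable_indicator_iff (ST_ann_meas _ a b)]
  apply IntegrableOn.mono_set _ (ST_ann_sub _ a b)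
  apply ContinuousOn.integrableOn_compact (isCompact_closedBall _ _)
  fun_prop

theorem ST_cutoff (m : ℕ) (v : EuclideanSpace ℝ (Fin (m + 1))) :
    ∃ ψ : SchwartzMap (EuclideanSpace ℝ (Fin (m + 1))) ℂ, ∀ ξ, ‖ξ‖ ≤ 3 →
      ψ ξ = ((⟪v, ξ⟫ ^ 2 : ℝ) : ℂ) := by
  let χ : ContDiffBump (0 : EuclideanSpace ℝ (Fin (m + 1))) := ⟨3, 4, by norm_num, by norm_num⟩
  have hs : ContDiff ℝ (⊤ : ℕ∞) (fun ξ => ((χ ξ * ⟪v, ξ⟫ ^ 2 : ℝ) : ℂ)) := by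
    apply Complex.ofRealCLM.contDiff.comp
    apply ContDiff.mul χ.contDiff
    apply ContDiff.pow
    exact contDiff_const.inner ℝ contDiff_id
  have hc : HasCompactSupport (fun ξ => ((χ ξ * ⟪v, ξ⟫ ^ 2 : ℝ) : ℂ)) := by
    have h1 : HasCompactSupport (fun ξ => χ ξ * ⟪v, ξ⟫ ^ 2) := χ.hasCompactSupport.mul_right
    exact h1.comp_left (g := fun x : ℝ => (x : ℂ)) (by simp)
  refine ⟨hc.toSchwartzMap hs, fun ξ hξ => ?_⟩
  have : χ ξ = 1 := χ.one_of_mem_closedBall (by simpa using hξ)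
  simp [this]

theorem ST_peetre {V : Type*} [NormedAddCommGroup V] (x y : V) (α : ℝ) (hα : 0 ≤ α) :
    (1 + ‖x - y‖) ^ (-α) ≤ (1 + ‖x‖) ^ (-α) * (1 + ‖y‖) ^ α := by
  have h1 : (1 + ‖x‖) ≤ (1 + ‖x - y‖) * (1 + ‖y‖) := by
    have : ‖x‖ ≤ ‖x - y‖ + ‖y‖ := by simpa using norm_add_le (x - y) y
    nlinarith [norm_nonneg (x - y), norm_nonneg y, mul_nonneg (norm_nonneg (x - y)) (norm_nonneg y)]
  have h2 : (1 + ‖x‖) ^ α ≤ (1 + ‖x - y‖) ^ α * (1 + ‖y‖) ^ α := by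
    rw [← Real.mul_rpow (by positivity) (by positivity)]
    exact Real.rpow_le_rpow (by positivity) h1 hα
  rw [Real.rpow_neg (by positivity), Real.rpow_neg (by positivity), inv_mul_eq_div,
    le_div_iff₀ (by positivity), inv_mul_le_iff₀ (by positivity)]
  exact h2

theorem ST_schwartz_rpow_int {V : Type*} [NormedAddCommGroup V] [InnerProductSpace ℝ V]
    [FiniteDimensional ℝ V] [MeasurableSpace V] [BorelSpace V] (g : SchwartzMap V ℂ) (α : ℝ) (hα : 0 ≤ α) :
    Integrable (fun y => (1 + ‖y‖) ^ α * ‖g y‖) := by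
  obtain ⟨k, hk⟩ := exists_nat_ge α
  have h1 := g.integrable.norm (μ := volume)
  have h2 := g.integrable_pow_mul (volume) k
  have h3 := (h1.add h2).const_mul (2 ^ k)
  refine h3.mono' ?_ ?_
  · apply Continuous.aestronglyMeasurable
    have := g.continuous
    apply Continuous.mul _ this.norm
    apply Continuous.rpow_const (by fun_prop)
    intro x; left; positivity
  · apply Eventually.of_forall; intro y
    simp only [norm_mul, norm_norm, Pi.add_apply]
    rw [Real.norm_of_nonneg (by positivity)]
    have h4 : (1 + ‖y‖) ^ α ≤ 2 ^ k * (1 + ‖y‖ ^ k) := by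
      calc _ ≤ (1 + ‖y‖) ^ (k:ℝ) := Real.rpow_le_rpow_of_exponent_le (by linarith [norm_nonneg y]) hk
        _ = (1 + ‖y‖) ^ k := Real.rpow_natCast _ _
        _ ≤ (2 * max 1 ‖y‖) ^ k := by
          gcongr
          rcases le_total 1 ‖y‖ with h | h
          · rw [max_eq_right h]; linarith
          · rw [max_eq_left h]; linarith
        _ = 2 ^ k * max 1 ‖y‖ ^ k := mul_pow _ _ _
        _ ≤ _ := by
          gcongr
          rcases le_total 1 ‖y‖ with h | h
          · rw [max_eq_right h]; linarith
          · rw [max_eq_left h]; simp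
    calc _ ≤ 2 ^ k * (1 + ‖y‖ ^ k) * ‖g y‖ := by gcongr
      _ = _ := by ring

theorem ST_am_eq (m : ℕ) (v : EuclideanSpace ℝ (Fin (m + 1))) (a b : ℝ) (hb : b ≤ 3)
    (ψ : EuclideanSpace ℝ (Fin (m + 1)) → ℂ) (hψ : ∀ ξ, ‖ξ‖ ≤ 3 → ψ ξ = ((⟪v, ξ⟫ ^ 2 : ℝ) : ℂ)) (ξ) :
    ST_am m v a b ξ = (ST_ann (m + 1) a b).indicator (fun _ => (1:ℂ)) ξ * ψ ξ := by
  unfold ST_am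
  by_cases h : ξ ∈ ST_ann (m + 1) a b
  · simp only [h, Set.indicator_of_mem, one_mul]
    rw [hψ ξ (h.2.trans hb)]
  · simp [h]

theorem ST_wkernel (m : ℕ) (v : EuclideanSpace ℝ (Fin (m + 1))) : ∃ C : ℝ, 0 < C ∧
    ∀ a b : ℝ, 1 / 2 ≤ a → a ≤ b → b ≤ 3 → ∀ x,
    ‖𝓕⁻ (ST_am m v a b) x‖ ≤ C * (b - a) * (1 + ‖x‖) ^ (-((m:ℝ) / 2)) := by
  obtain ⟨C, hC, h⟩ := ST_annulus m
  obtain ⟨ψ, hψ⟩ := ST_cutoff m v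
  set g : SchwartzMap (EuclideanSpace ℝ (Fin (m + 1))) ℂ := 𝓕⁻ ψ with hg
  have hgψ : 𝓕 (g : EuclideanSpace ℝ (Fin (m + 1)) → ℂ) = ψ := by
    rw [← SchwartzMap.fourier_coe, hg, FourierTransform.fourier_fourierInv_eq]
  have hα : (0:ℝ) ≤ (m:ℝ) / 2 := by positivity
  have hgi := ST_schwartz_rpow_int g ((m:ℝ)/2) hα
  set D := ∫ y, (1 + ‖y‖) ^ ((m:ℝ)/2) * ‖g y‖ with hD
  have hD0 : 0 ≤ D := integral_nonneg (fun y => by positivity)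
  refine ⟨C * D + 1, by positivity, fun a b ha hab hb x => ?_⟩
  have hba : 0 ≤ b - a := by linarith
  have e1 : ST_am m v a b = fun ξ => (ST_ann (m + 1) a b).indicator (fun _ => (1:ℂ)) ξ *
      𝓕 (g : EuclideanSpace ℝ (Fin (m + 1)) → ℂ) ξ := by
    ext ξ; rw [hgψ, ST_am_eq m v a b hb ψ hψ]
  rw [e1, ST_conv _ _ (ST_ind_int _ a b) g.integrable]
  calc _ ≤ ∫ y, (C * (b - a) * (1 + ‖x‖) ^ (-((m:ℝ) / 2))) * ((1 + ‖y‖) ^ ((m:ℝ)/2) * ‖g y‖) := by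
        apply norm_integral_le_of_norm_le (hgi.const_mul _)
        apply Eventually.of_forall; intro y
        rw [norm_mul]
        calc _ ≤ C * (b - a) * (1 + ‖x - y‖) ^ (-((m:ℝ) / 2)) * ‖g y‖ := by
              gcongr; exact h a b ha hab hb _
          _ ≤ C * (b - a) * ((1 + ‖x‖) ^ (-((m:ℝ) / 2)) * (1 + ‖y‖) ^ ((m:ℝ)/2)) * ‖g y‖ := by
              gcongr; exact ST_peetre _ _ _ hα
          _ = _ := by ring
    _ = C * D * (b - a) * (1 + ‖x‖) ^ (-((m:ℝ) / 2)) := by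
        rw [integral_const_mul, ← hD]; ring
    _ ≤ _ := by
        gcongr; linarith

/-- slice bound -/
theorem ST_slice_bound (a b c : ℝ) (ha : 0 ≤ a) (hab : a ≤ b) (hb : b ≤ 3) (hc : 0 ≤ c)
    (S : Set ℝ) (hSm : MeasurableSet S)
    (hS : ∀ τ ∈ S, a ^ 2 < τ ^ 2 + c ∧ τ ^ 2 + c ≤ b ^ 2) (g : ℝ → ℂ)
    (hg : ∀ τ, ‖g τ‖ ≤ 1) :
    ‖∫ τ, S.indicator (fun τ => ((τ ^ 2 : ℝ) : ℂ)) τ * g τ‖ ≤ 36 * (b - a) := by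
  set α := Real.sqrt (max (a ^ 2 - c) 0) with hα
  set β := Real.sqrt (max (b ^ 2 - c) 0) with hβ
  have hα0 : 0 ≤ α := Real.sqrt_nonneg _
  have hβ0 : 0 ≤ β := Real.sqrt_nonneg _
  have hα2 : α ^ 2 = max (a ^ 2 - c) 0 := Real.sq_sqrt (le_max_right _ _)
  have hβ2 : β ^ 2 = max (b ^ 2 - c) 0 := Real.sq_sqrt (le_max_right _ _)
  have hαβ : α ≤ β := by
    apply Real.sqrt_le_sqrt
    apply max_le_max _ le_rfl
    nlinarith
  have hβ3 : β ≤ 3 := by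
    apply Real.sqrt_le_iff.2 ⟨by norm_num, max_le (by nlinarith) (by norm_num)⟩
  have hd : β ^ 2 - α ^ 2 ≤ b ^ 2 - a ^ 2 := by
    rw [hα2, hβ2]
    have h1 : a ^ 2 ≤ b ^ 2 := by nlinarith
    rcases le_total (b ^ 2 - c) 0 with h | h
    · rw [max_eq_right h]; linarith [le_max_right (a ^ 2 - c) 0]
    · rw [max_eq_left h]; linarith [le_max_left (a ^ 2 - c) 0]
  have hsub : S ⊆ Set.Icc α β ∪ Set.Icc (-β) (-α) := by
    intro τ hτ
    obtain ⟨h1, h2⟩ := hS τ hτ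
    have h3 : α ≤ |τ| := by
      apply abs_le_of_sq_le_sq' _ (abs_nonneg _) |>.2
      rw [hα2, sq_abs]; exact max_le (by linarith) (sq_nonneg _)
    have h4 : |τ| ≤ β := by
      apply abs_le_of_sq_le_sq' _ hβ0 |>.2
      rw [hβ2, sq_abs]; exact le_max_of_le_left (by linarith)
    rcases le_total 0 τ with h | h
    · rw [abs_of_nonneg h] at h3 h4; exact Or.inl ⟨h3, h4⟩
    · rw [abs_of_nonpos h] at h3 h4; right; constructor <;> linarith
  have hvol : volume.real S ≤ 2 * (β - α) := by
    have h1 : volume S ≤ ENNReal.ofReal (β - α) + ENNReal.ofReal (β - α) := by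
      refine (measure_mono hsub).trans ((measure_union_le _ _).trans ?_)
      rw [Real.volume_Icc, Real.volume_Icc]
      exact add_le_add le_rfl (ENNReal.ofReal_le_ofReal (by linarith))
    rw [← ENNReal.ofReal_add (by linarith) (by linarith)] at h1
    refine (ENNReal.toReal_mono ENNReal.ofReal_ne_top h1).trans ?_
    rw [ENNReal.toReal_ofReal (by linarith)]; linarith
  have hfin : volume S < ∞ := by
    refine (measure_mono hsub).trans_lt ((measure_union_le _ _).trans_lt ?_)
    rw [Real.volume_Icc, Real.volume_Icc]
    exact ENNReal.add_lt_top.2 ⟨ENNReal.ofReal_lt_top, ENNReal.ofReal_lt_top⟩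
  have e : ∫ τ, S.indicator (fun τ => ((τ ^ 2 : ℝ) : ℂ)) τ * g τ =
      ∫ τ in S, ((τ ^ 2 : ℝ) : ℂ) * g τ := by
    rw [← integral_indicator hSm]
    congr 1; ext τ
    by_cases h : τ ∈ S <;> simp [h]
  rw [e]
  calc _ ≤ β ^ 2 * volume.real S := by
        apply norm_setIntegral_le_of_norm_le_const hfin
        intro τ hτ
        rw [norm_mul, norm_real, Real.norm_of_nonneg (sq_nonneg _)]
        have h2 : τ ^ 2 ≤ β ^ 2 := by
          rw [hβ2]; exact le_max_of_le_left (by linarith [(hS τ hτ).2])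
        calc _ ≤ β ^ 2 * 1 := mul_le_mul h2 (hg τ) (norm_nonneg _) (sq_nonneg _)
          _ = _ := mul_one _
    _ ≤ β ^ 2 * (2 * (β - α)) := by gcongr
    _ ≤ 3 * β * (2 * (β - α)) := by
        have : β ^ 2 ≤ 3 * β := by nlinarith
        have h0 : 0 ≤ β - α := by linarith
        gcongr
    _ ≤ 6 * (β ^ 2 - α ^ 2) := by nlinarith
    _ ≤ 6 * (b ^ 2 - a ^ 2) := by linarith
    _ ≤ _ := by nlinarith

/-- partial inverse transform of the multiplier in the distinguished direction -/
theorem ST_slice_kernel (m : ℕ) (v : EuclideanSpace ℝ (Fin (m + 1)))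
    (e : (ℝ × EuclideanSpace ℝ (Fin m)) ≃L[ℝ] EuclideanSpace ℝ (Fin (m + 1)))
    (he : MeasurePreserving e volume volume)
    (hin : ∀ a b, ⟪e a, e b⟫ = a.1 * b.1 + ⟪a.2, b.2⟫) (hv : ∀ a, ⟪v, e a⟫ = a.1)
    (a b : ℝ) (ha : 0 ≤ a) (hab : a ≤ b) (hb : b ≤ 3) (s : ℝ) :
    ∃ μ : EuclideanSpace ℝ (Fin m) → ℂ, Integrable μ ∧ (∀ ξ, ‖μ ξ‖ ≤ 36 * (b - a)) ∧
      ∀ z, 𝓕⁻ μ z = 𝓕⁻ (ST_am m v a b) (e (s, z)) := by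
  have hem := e.toHomeomorph.measurableEmbedding
  have hexp : ∀ r : ℝ, ‖Complex.exp (((r:ℝ):ℂ) * Complex.I)‖ = 1 := fun r => norm_exp_ofReal_mul_I r
  set H : ℝ × EuclideanSpace ℝ (Fin m) → ℂ := fun p => ST_am m v a b (e p) *
      Complex.exp (((2 * Real.pi * (s * p.1) : ℝ):ℂ) * Complex.I) with hH
  have hI0 : Integrable (fun p => ST_am m v a b (e p)) :=
    (he.integrable_comp_emb hem).2 (ST_am_int m v a b)
  have hHI : Integrable H := by
    apply hI0.mul_bdd (c := 1)
    · apply Continuous.aestronglyMeasurable; fun_prop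
    · apply Eventually.of_forall; intro p; rw [hexp]
  refine ⟨fun ξ => ∫ τ, H (τ, ξ), hHI.integral_prod_right, ?_, ?_⟩
  · intro ξ
    have hnorm : ∀ τ : ℝ, ‖e (τ, ξ)‖ ^ 2 = τ ^ 2 + ‖ξ‖ ^ 2 := by
      intro τ
      rw [← real_inner_self_eq_norm_sq, hin, real_inner_self_eq_norm_sq]; simp [sq]
    set S : Set ℝ := (fun τ : ℝ => e (τ, ξ)) ⁻¹' (ST_ann (m + 1) a b) with hS
    have hSm : MeasurableSet S := by
      apply (ST_ann_meas _ a b).preimage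
      apply Continuous.measurable
      exact e.continuous.comp (by fun_prop)
    have := ST_slice_bound a b (‖ξ‖ ^ 2) ha hab hb (sq_nonneg _) S hSm
      (by
        intro τ hτ
        have hτ : a < ‖e (τ, ξ)‖ ∧ ‖e (τ, ξ)‖ ≤ b := hτ
        rw [← hnorm]
        exact ⟨pow_lt_pow_left₀ hτ.1 ha (by norm_num), pow_le_pow_left₀ (norm_nonneg _) hτ.2 2⟩)
      (fun τ => Complex.exp (((2 * Real.pi * (s * τ) : ℝ):ℂ) * Complex.I))
      (fun τ => (hexp _).le)
    convert this using 3
    ext τ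
    simp only [hH, ST_am]
    congr 1
    by_cases h : e (τ, ξ) ∈ ST_ann (m + 1) a b
    · have h' : τ ∈ S := h
      simp only [h, h', Set.indicator_of_mem, hv]
    · have h' : τ ∉ S := h
      simp only [h, h', not_false_eq_true, Set.indicator_of_notMem]
  · intro z
    rw [Real.fourierInv_eq', Real.fourierInv_eq', ← he.integral_comp hem]
    have hI1 : Integrable (fun p : ℝ × EuclideanSpace ℝ (Fin m) =>
        Complex.exp (((2 * Real.pi * ⟪e p, e (s, z)⟫ : ℝ):ℂ) * Complex.I) • ST_am m v a b (e p)) := by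
      simp only [smul_eq_mul]
      apply hI0.bdd_mul (c := 1)
      · apply Continuous.aestronglyMeasurable
        have := e.continuous
        fun_prop
      · apply Eventually.of_forall; intro p; rw [hexp]
    have h3 := integral_prod_symm _ hI1
    rw [Measure.volume_eq_prod, h3]
    congr 1; ext ξ
    rw [smul_eq_mul, ← integral_const_mul]
    congr 1; ext τ
    simp only [hH, hin, smul_eq_mul]
    rw [mul_left_comm, mul_comm (cexp _) (ST_am _ _ _ _ _)]
    congr 1
    rw [← Complex.exp_add]; congr 1; push_cast; ring

/-- bounded, measurable, boundedly supported -/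
def ST_bcs {V : Type*} [NormedAddCommGroup V] [MeasurableSpace V] (G : V → ℂ) : Prop :=
  Measurable G ∧ (∃ K, ∀ x, ‖G x‖ ≤ K) ∧ ∃ R, ∀ x, R < ‖x‖ → G x = 0

theorem ST_bcs.nice {V : Type*} [NormedAddCommGroup V] [InnerProductSpace ℝ V]
    [FiniteDimensional ℝ V] [MeasurableSpace V] [BorelSpace V] {G : V → ℂ} (h : ST_bcs G) :
    ST_nice volume G := by
  obtain ⟨h1, ⟨K, hK⟩, R, hR⟩ := h
  refine ⟨h1, ?_, K, hK⟩
  have : G = (Metric.closedBall (0:V) R).indicator G := by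
    ext x
    by_cases h : x ∈ Metric.closedBall (0:V) R
    · simp [h]
    · rw [Set.indicator_of_notMem h]; apply hR; simpa using h
  rw [this, integrable_indicator_iff measurableSet_closedBall]
  apply Measure.integrableOn_of_bounded (M := K) (measure_closedBall_lt_top.ne) h1.aestronglyMeasurable
  exact Eventually.of_forall hK

theorem ST_quad (m : ℕ) (v : EuclideanSpace ℝ (Fin (m + 1))) (a b : ℝ)
    (G : EuclideanSpace ℝ (Fin (m + 1)) → ℂ) (hG : Integrable G) :
    ∫⁻ ξ, ‖ST_am m v a b ξ‖ₑ * ‖𝓕 G ξ‖ₑ ^ 2 ≤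
      ∫⁻ x, ‖∫ y, 𝓕⁻ (ST_am m v a b) (x - y) * G y‖ₑ * ‖G x‖ₑ := by
  have hm := ST_am_int m v a b
  have hFc := ST_fourier_continuous hG
  obtain ⟨M, hM⟩ : ∃ M, ∀ ξ, ‖𝓕 G ξ‖ ≤ M := ⟨_, ST_norm_fourier_le G⟩
  have hmF : Integrable (fun ξ => ST_am m v a b ξ * 𝓕 G ξ) :=
    hm.mul_bdd (c := M) hFc.aestronglyMeasurable (Eventually.of_forall hM)
  have hmFF : Integrable (fun ξ => ST_am m v a b ξ * 𝓕 G ξ * (starRingEnd ℂ) (𝓕 G ξ)) :=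
    hmF.mul_bdd (c := M) (Complex.continuous_conj.comp hFc).aestronglyMeasurable
      (Eventually.of_forall (by intro x; simpa using hM x))
  have e1 : ∀ ξ, ST_am m v a b ξ * 𝓕 G ξ * (starRingEnd ℂ) (𝓕 G ξ) =
      ((‖ST_am m v a b ξ * 𝓕 G ξ * (starRingEnd ℂ) (𝓕 G ξ)‖ : ℝ) : ℂ) := by
    intro ξ
    rw [mul_assoc, Complex.mul_conj, norm_mul]
    have : ST_am m v a b ξ = ((‖ST_am m v a b ξ‖ : ℝ) : ℂ) := by
      unfold ST_am
      by_cases h : ξ ∈ ST_ann (m + 1) a b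
      · simp only [h, Set.indicator_of_mem]
        rw [norm_real, Real.norm_of_nonneg (sq_nonneg _)]
      · simp [h]
    rw [norm_real, Real.norm_of_nonneg (Complex.normSq_nonneg _), ofReal_mul, ← this]
  calc _ = ∫⁻ ξ, ‖ST_am m v a b ξ * 𝓕 G ξ * (starRingEnd ℂ) (𝓕 G ξ)‖ₑ := by
        congr 1; ext ξ
        simp only [enorm_mul, RCLike.enorm_conj, sq, mul_assoc]
    _ = ENNReal.ofReal (∫ ξ, ‖ST_am m v a b ξ * 𝓕 G ξ * (starRingEnd ℂ) (𝓕 G ξ)‖) :=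
        (ofReal_integral_norm_eq_lintegral_enorm hmFF).symm
    _ = ‖∫ ξ, ST_am m v a b ξ * 𝓕 G ξ * (starRingEnd ℂ) (𝓕 G ξ)‖ₑ := by
        rw [integral_congr_ae (Eventually.of_forall e1), integral_complex_ofReal, ← ofReal_norm, norm_real,
          Real.norm_of_nonneg (integral_nonneg (fun _ => norm_nonneg _))]
    _ = ‖∫ x, 𝓕⁻ (fun ξ => ST_am m v a b ξ * 𝓕 G ξ) x * (starRingEnd ℂ) (G x)‖ₑ := by
        rw [ST_sesq_flip hmF hG]
    _ ≤ ∫⁻ x, ‖𝓕⁻ (fun ξ => ST_am m v a b ξ * 𝓕 G ξ) x * (starRingEnd ℂ) (G x)‖ₑ :=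
        enorm_integral_le_lintegral_enorm _
    _ = _ := by
        congr 1; ext x
        rw [ST_conv _ _ hm hG, enorm_mul, RCLike.enorm_conj]

theorem ST_restrict (m : ℕ) (hm1 : 1 ≤ m) (v : EuclideanSpace ℝ (Fin (m + 1))) (hv1 : ‖v‖ = 1)
    (γ : ℝ) (hγ : γ = m / (m + 2)) :
    ∃ C : ℝ, 0 < C ∧ ∀ a b : ℝ, 1 / 2 ≤ a → a < b → b ≤ 3 →
    ∀ G : EuclideanSpace ℝ (Fin (m + 1)) → ℂ, ST_bcs G →
    ∫⁻ ξ, ‖ST_am m v a b ξ‖ₑ * ‖𝓕 G ξ‖ₑ ^ 2 ≤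
      ENNReal.ofReal (C * (b - a)) * (∫⁻ x, ‖G x‖ₑ ^ (2 / (2 - γ))) ^ (2 - γ) := by
  have hm0 : (0:ℝ) < m := by exact_mod_cast hm1
  have h0 : 0 < γ := by rw [hγ]; positivity
  have h1 : γ < 1 := by rw [hγ, div_lt_one (by positivity)]; linarith
  have hγm : (m:ℝ) / 2 * (1 - γ) = γ := by rw [hγ]; field_simp; ring
  obtain ⟨e, he, hin, hve⟩ := ST_split m v hv1
  obtain ⟨C₁, hC₁, hbil⟩ := ST_bilin (V := EuclideanSpace ℝ (Fin m)) γ h0 h1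
  obtain ⟨C₂, hC₂, hker⟩ := ST_wkernel m v
  obtain ⟨C₃, hC₃, hhls⟩ := ST_hls γ h0 h1
  have hem := e.toHomeomorph.measurableEmbedding
  have h2g : 0 < 2 - γ := by linarith
  set C₄ := C₁ * 36 ^ γ * C₂ ^ (1 - γ) with hC₄
  have hC₄0 : 0 < C₄ := by positivity
  refine ⟨C₄ * (C₃.toReal + 1), by positivity, fun a b ha hab hb G hG => ?_⟩
  have hη : 0 < b - a := by linarith
  have hGn := hG.nice
  obtain ⟨hGm, ⟨K, hK⟩, R, hR⟩ := hG
  set k := 𝓕⁻ (ST_am m v a b) with hk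
  have hkc : Continuous k := ST_fourierInv_continuous (ST_am_int m v a b)
  have hkb : ∀ x, ‖k x‖ ≤ ∫ x, ‖ST_am m v a b x‖ := ST_norm_fourierInv_le _
  set g : ℝ × EuclideanSpace ℝ (Fin m) → ℂ := fun p => G (e p) with hg
  have hgm : Measurable g := hGm.comp e.continuous.measurable
  have hgi : Integrable g := (he.integrable_comp_emb hem).2 hGn.2.1
  have hnorm : ∀ s z, ‖z‖ ≤ ‖e (s, z)‖ := by
    intro s z
    have : ‖e (s, z)‖ ^ 2 = s ^ 2 + ‖z‖ ^ 2 := by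
      rw [← real_inner_self_eq_norm_sq, hin, real_inner_self_eq_norm_sq]; simp [sq]
    apply abs_le_of_sq_le_sq' _ (norm_nonneg _) |>.2
    rw [this]; nlinarith
  have hgs : ∀ s, ST_nice volume (fun z => g (s, z)) := by
    intro s
    apply ST_bcs.nice
    refine ⟨hgm.comp (by fun_prop), ⟨K, fun z => hK _⟩, R, fun z hz => ?_⟩
    exact hR _ (hz.trans_le (hnorm s z))
  set N : ℝ → ℝ≥0∞ := fun s => (∫⁻ z, ‖g (s, z)‖ₑ ^ (2 / (2 - γ))) ^ ((2 - γ) / 2) with hN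
  have hNm : Measurable N := by
    apply Measurable.pow_const
    apply Measurable.lintegral_prod_right' (f := fun p : ℝ × EuclideanSpace ℝ (Fin m) => ‖g p‖ₑ ^ (2 / (2 - γ)))
    exact hgm.enorm.pow_const _
  -- slice bound
  have hslice : ∀ s s', s ≠ s' → ∫⁻ z, ‖∫ z', k (e (s, z) - e (s', z')) * g (s', z')‖ₑ * ‖g (s, z)‖ₑ ≤
      ENNReal.ofReal (C₄ * (b - a)) * (N s * N s' * (ENNReal.ofReal |s - s'|) ^ (-γ)) := by
    intro s s' hss
    obtain ⟨μ, hμi, hμb, hμk⟩ := ST_slice_kernel m v e he hin hve a b (by linarith) hab.le hb (s - s')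
    have hd : 0 < |s - s'| := abs_pos.2 (sub_ne_zero.2 hss)
    have hB : ∀ z, ‖𝓕⁻ μ z‖ ≤ C₂ * (b - a) * |s - s'| ^ (-((m:ℝ)/2)) := by
      intro z
      rw [hμk]
      refine (hker a b ha hab.le hb _).trans ?_
      refine mul_le_mul_of_nonneg_left (Real.rpow_le_rpow_of_nonpos hd ?_ (by linarith)) (by positivity)
      have : |s - s'| ≤ ‖e (s - s', z)‖ := by
        have h3 : ‖e (s - s', z)‖ ^ 2 = (s - s') ^ 2 + ‖z‖ ^ 2 := by
          rw [← real_inner_self_eq_norm_sq, hin, real_inner_self_eq_norm_sq]; simp [sq]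
        apply abs_le_of_sq_le_sq' _ (norm_nonneg _) |>.2
        rw [h3, sq_abs]; nlinarith [sq_nonneg ‖z‖]
      linarith
    have hb2 := hbil μ (36 * (b - a)) (C₂ * (b - a) * |s - s'| ^ (-((m:ℝ)/2))) (by positivity)
      (by positivity) hμi hμb hB (fun z => g (s', z)) (fun z => g (s, z)) (hgs s') (hgs s)
    have e1 : C₁ * (36 * (b - a)) ^ γ * (C₂ * (b - a) * |s - s'| ^ (-((m:ℝ)/2))) ^ (1 - γ) =
        C₄ * (b - a) * |s - s'| ^ (-γ) := by
      rw [Real.mul_rpow (by norm_num) hη.le, Real.mul_rpow (by positivity) (by positivity),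
        Real.mul_rpow hC₂.le hη.le, ← Real.rpow_mul hd.le, neg_mul, hγm, hC₄]
      have : (b - a) ^ γ * (b - a) ^ (1 - γ) = b - a := by
        rw [← Real.rpow_add hη]; simp
      calc _ = C₁ * 36 ^ γ * C₂ ^ (1 - γ) * ((b - a) ^ γ * (b - a) ^ (1 - γ)) * |s - s'| ^ (-γ) := by ring
        _ = _ := by rw [this]
    rw [e1, ENNReal.ofReal_mul (by positivity), ← ENNReal.ofReal_rpow_of_pos hd] at hb2
    calc _ = ∫⁻ z, ‖∫ z', 𝓕⁻ μ (z - z') * g (s', z')‖ₑ * ‖g (s, z)‖ₑ := by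
          congr 1; ext z; congr 3; ext z'
          rw [hμk, ← map_sub]; rfl
      _ ≤ _ := hb2
      _ = _ := by simp only [hN]; ring
  have hmeas1 : StronglyMeasurable (fun x : EuclideanSpace ℝ (Fin (m+1)) => ∫ y, k (x - y) * G y) := by
    apply StronglyMeasurable.integral_prod_right
      (f := fun x y : EuclideanSpace ℝ (Fin (m+1)) => k (x - y) * G y)
    apply Measurable.stronglyMeasurable
    have := hkc.measurable
    simp only [Function.uncurry_def]
    fun_prop
  have hQ := ST_quad m v a b G hGn.2.1
  calc _ ≤ ∫⁻ x, ‖∫ y, k (x - y) * G y‖ₑ * ‖G x‖ₑ := hQ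
    _ = ∫⁻ p, ‖∫ y, k (e p - y) * G y‖ₑ * ‖g p‖ₑ := by
        rw [← he.lintegral_comp_emb hem]
    _ = ∫⁻ s, ∫⁻ z, ‖∫ y, k (e (s, z) - y) * G y‖ₑ * ‖g (s, z)‖ₑ := by
        rw [Measure.volume_eq_prod]
        apply lintegral_prod
        apply AEMeasurable.mul _ hgm.enorm.aemeasurable
        exact (hmeas1.measurable.comp e.continuous.measurable).enorm.aemeasurable
    _ ≤ ∫⁻ s, ∫⁻ z, ∫⁻ s', ‖∫ z', k (e (s, z) - e (s', z')) * g (s', z')‖ₑ * ‖g (s, z)‖ₑ := by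
        apply lintegral_mono; intro s
        apply lintegral_mono; intro z
        dsimp only
        rw [lintegral_mul_const' _ _ enorm_ne_top]
        gcongr
        have hI : Integrable (fun p => k (e (s, z) - e p) * g p) := by
          apply hgi.bdd_mul (c := ∫ x, ‖ST_am m v a b x‖)
          · apply Continuous.aestronglyMeasurable
            have := e.continuous
            fun_prop
          · exact Eventually.of_forall fun p => hkb _
        rw [← he.integral_comp hem, Measure.volume_eq_prod, integral_prod _ hI]
        exact enorm_integral_le_lintegral_enorm _
    _ = ∫⁻ s, ∫⁻ s', ∫⁻ z, ‖∫ z', k (e (s, z) - e (s', z')) * g (s', z')‖ₑ * ‖g (s, z)‖ₑ := by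
        congr 1; ext s
        apply lintegral_lintegral_swap
        apply Measurable.aemeasurable
        simp only [Function.uncurry_def]
        apply Measurable.mul _ ((hgm.comp (by fun_prop)).enorm)
        apply Measurable.enorm
        apply StronglyMeasurable.measurable
        apply StronglyMeasurable.integral_prod_right
          (f := fun (q : EuclideanSpace ℝ (Fin m) × ℝ) z' => k (e (s, q.1) - e (q.2, z')) * g (q.2, z'))
        apply Measurable.stronglyMeasurable
        have h1 := hkc.measurable
        have h2 := e.continuous.measurable
        simp only [Function.uncurry_def]
        fun_prop
    _ ≤ ∫⁻ s, ∫⁻ s', ENNReal.ofReal (C₄ * (b - a)) * (N s * N s' * (ENNReal.ofReal |s - s'|) ^ (-γ)) := by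
        apply lintegral_mono; intro s
        apply lintegral_mono_ae
        have : ∀ᵐ s' : ℝ, s' ≠ s := by
          rw [ae_iff]; simp
        filter_upwards [this] with s' hs'
        exact hslice s s' hs'.symm
    _ = ENNReal.ofReal (C₄ * (b - a)) * ∫⁻ s, ∫⁻ s', N s * N s' * (ENNReal.ofReal |s - s'|) ^ (-γ) := by
        rw [← lintegral_const_mul' _ _ ENNReal.ofReal_ne_top]
        congr 1; ext s
        rw [← lintegral_const_mul' _ _ ENNReal.ofReal_ne_top]
    _ ≤ ENNReal.ofReal (C₄ * (b - a)) * (C₃ * (∫⁻ s, N s ^ (2 / (2 - γ))) ^ (2 - γ)) := by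
        gcongr; exact hhls N hNm
    _ = ENNReal.ofReal (C₄ * (b - a)) * (C₃ * (∫⁻ x, ‖G x‖ₑ ^ (2 / (2 - γ))) ^ (2 - γ)) := by
        congr 3
        rw [← he.lintegral_comp_emb hem, Measure.volume_eq_prod, lintegral_prod]
        · congr 1; ext s
          simp only [hN]
          rw [← ENNReal.rpow_mul]
          have : (2 - γ) / 2 * (2 / (2 - γ)) = 1 := by field_simp
          rw [this, ENNReal.rpow_one]
        · exact (hgm.enorm.pow_const _).aemeasurable
    _ ≤ _ := by
        rw [← mul_assoc]
        gcongr
        rw [mul_right_comm C₄, ENNReal.ofReal_mul (p := C₄ * (b - a)) (by positivity)]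
        gcongr
        rw [← ENNReal.ofReal_toReal hC₃]
        apply ENNReal.ofReal_le_ofReal
        simp

theorem ST_restrict_sum (m : ℕ) (hm1 : 1 ≤ m) (γ : ℝ) (hγ : γ = m / (m + 2)) :
    ∃ C : ℝ, 0 < C ∧ ∀ a b : ℝ, 1 / 2 ≤ a → a < b → b ≤ 3 →
    ∀ G : EuclideanSpace ℝ (Fin (m + 1)) → ℂ, ST_bcs G →
    ∫⁻ ξ in ST_ann (m + 1) a b, ‖𝓕 G ξ‖ₑ ^ 2 ≤
      ENNReal.ofReal (C * (b - a)) * (∫⁻ x, ‖G x‖ₑ ^ (2 / (2 - γ))) ^ (2 - γ) := by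
  have h : ∀ j : Fin (m + 1), ‖EuclideanSpace.single j (1:ℝ)‖ = 1 := by intro j; simp
  choose C hC hr using fun j => ST_restrict m hm1 (EuclideanSpace.single j (1:ℝ)) (h j) γ hγ
  refine ⟨4 * ∑ j, C j, by
    have : 0 < ∑ j, C j := Finset.sum_pos (fun j _ => hC j) ⟨0, Finset.mem_univ _⟩
    positivity, fun a b ha hab hb G hG => ?_⟩
  have hη : 0 ≤ b - a := by linarith
  have hFm : Measurable (fun ξ => ‖𝓕 G ξ‖ₑ ^ 2) :=
    ((ST_fourier_continuous hG.nice.2.1).measurable.enorm.pow_const 2)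
  have hpt : ∀ ξ ∈ ST_ann (m + 1) a b, (1:ℝ≥0∞) ≤ 4 * ∑ j, ‖ST_am m (EuclideanSpace.single j (1:ℝ)) a b ξ‖ₑ := by
    intro ξ hξ
    have h1 : ∀ j, ‖ST_am m (EuclideanSpace.single j (1:ℝ)) a b ξ‖ₑ = ENNReal.ofReal (ξ j ^ 2) := by
      intro j
      unfold ST_am
      rw [Set.indicator_of_mem hξ, ← ofReal_norm, norm_real, Real.norm_of_nonneg (sq_nonneg _),
        EuclideanSpace.inner_single_left]
      simp
    simp only [h1]
    rw [← ENNReal.ofReal_sum_of_nonneg (fun _ _ => sq_nonneg _)]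
    have h2 : ∑ j, ξ j ^ 2 = ‖ξ‖ ^ 2 := by rw [EuclideanSpace.real_norm_sq_eq]
    rw [h2, show (4:ℝ≥0∞) = ENNReal.ofReal 4 by simp, ← ENNReal.ofReal_mul (by norm_num), ← ENNReal.ofReal_one]
    apply ENNReal.ofReal_le_ofReal
    nlinarith [hξ.1]
  calc _ ≤ ∫⁻ ξ in ST_ann (m + 1) a b, (4 * ∑ j, ‖ST_am m (EuclideanSpace.single j (1:ℝ)) a b ξ‖ₑ) * ‖𝓕 G ξ‖ₑ ^ 2 := by
        apply setLIntegral_mono' (ST_ann_meas _ a b)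
        intro ξ hξ
        calc _ = 1 * ‖𝓕 G ξ‖ₑ ^ 2 := (one_mul _).symm
          _ ≤ _ := by gcongr; exact hpt ξ hξ
    _ ≤ ∫⁻ ξ, (4 * ∑ j, ‖ST_am m (EuclideanSpace.single j (1:ℝ)) a b ξ‖ₑ) * ‖𝓕 G ξ‖ₑ ^ 2 :=
        setLIntegral_le_lintegral _ _
    _ = 4 * ∑ j, ∫⁻ ξ, ‖ST_am m (EuclideanSpace.single j (1:ℝ)) a b ξ‖ₑ * ‖𝓕 G ξ‖ₑ ^ 2 := by
        simp only [mul_assoc]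
        rw [lintegral_const_mul' _ _ (by norm_num)]
        congr 1
        simp only [Finset.sum_mul]
        apply lintegral_finsetSum'
        intro j _
        exact (ST_am_int m _ a b).aestronglyMeasurable.enorm.mul hFm.aemeasurable
    _ ≤ 4 * ∑ j, ENNReal.ofReal (C j * (b - a)) * (∫⁻ x, ‖G x‖ₑ ^ (2 / (2 - γ))) ^ (2 - γ) := by
        gcongr with j
        exact hr j a b ha hab hb G hG
    _ = _ := by
        rw [← Finset.sum_mul, ← ENNReal.ofReal_sum_of_nonneg (fun j _ => mul_nonneg (hC j).le hη),
          ← mul_assoc, show (4:ℝ≥0∞) = ENNReal.ofReal 4 by simp, ← ENNReal.ofReal_mul (by norm_num),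
          ← Finset.sum_mul, mul_assoc]

theorem ST_core_bdd (m : ℕ) (hm1 : 1 ≤ m) :
    ∃ C : ℝ, 0 < C ∧ ∀ a b : ℝ, 1 / 2 ≤ a → a < b → b ≤ 3 →
    ∀ F : EuclideanSpace ℝ (Fin (m + 1)) → ℂ, Measurable F → (∃ K, ∀ ξ, ‖F ξ‖ ≤ K) →
    (∀ ξ, ξ ∉ ST_ann (m + 1) a b → F ξ = 0) →
    ∀ w : EuclideanSpace ℝ (Fin (m + 1)) → ℝ, Measurable w → (∀ x, 0 ≤ w x) →
    (∃ K, ∀ x, w x ≤ K) → (∃ R, ∀ x, R < ‖x‖ → w x = 0) →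
    ∫⁻ x, ‖𝓕⁻ F x‖ₑ ^ 2 * ENNReal.ofReal (w x) ≤
      ENNReal.ofReal (C * (b - a)) * ((∫⁻ x, ENNReal.ofReal (w x) ^ (((m:ℝ) + 2) / 2)) ^ (1 / (((m:ℝ) + 2) / 2)) *
        ∫⁻ ξ, ‖F ξ‖ₑ ^ 2) := by
  set γ : ℝ := m / (m + 2) with hγ
  have hm0 : (0:ℝ) < m := by exact_mod_cast hm1
  have h0 : 0 < γ := by rw [hγ]; positivity
  have h1 : γ < 1 := by rw [hγ, div_lt_one (by positivity)]; linarith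
  have hr : 1 / (((m:ℝ) + 2) / 2) = 1 - γ := by rw [hγ]; field_simp; ring
  have hr' : (((m:ℝ) + 2) / 2) = 1 / (1 - γ) := by rw [← hr]; simp
  have h2g : 0 < 2 - γ := by linarith
  have h1g : 0 < 1 - γ := by linarith
  obtain ⟨C, hC, hres⟩ := ST_restrict_sum m hm1 γ hγ
  refine ⟨C, hC, fun a b ha hab hb F hFm ⟨KF, hKF⟩ hFs w hwm hw0 ⟨Kw, hKw⟩ ⟨R, hR⟩ => ?_⟩
  have hFb : ST_bcs F := ⟨hFm, ⟨KF, hKF⟩, b, fun ξ hξ => hFs ξ (fun h => absurd h.2 (not_le.2 hξ))⟩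
  have hFi := hFb.nice.2.1
  set H := 𝓕⁻ F with hH
  have hHc : Continuous H := ST_fourierInv_continuous hFi
  have hHb : ∀ x, ‖H x‖ ≤ ∫ ξ, ‖F ξ‖ := ST_norm_fourierInv_le _
  set G : EuclideanSpace ℝ (Fin (m + 1)) → ℂ := fun x => H x * (w x : ℂ) with hG
  have hGb : ST_bcs G := by
    refine ⟨hHc.measurable.mul (Complex.measurable_ofReal.comp hwm), ⟨(∫ ξ, ‖F ξ‖) * Kw, fun x => ?_⟩, R, fun x hx => ?_⟩
    · rw [hG]; simp only [norm_mul, norm_real, Real.norm_of_nonneg (hw0 x)]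
      exact mul_le_mul (hHb x) (hKw x) (hw0 x) (integral_nonneg fun _ => norm_nonneg _)
    · simp [hG, hR x hx]
  have hGi := hGb.nice.2.1
  set Y := ∫⁻ x, ‖H x‖ₑ ^ 2 * ENNReal.ofReal (w x) with hY
  have henG : ∀ x, ‖G x‖ₑ = ‖H x‖ₑ * ENNReal.ofReal (w x) := by
    intro x; simp only [hG, enorm_mul]
    congr 1
    rw [← ofReal_norm, norm_real, Real.norm_of_nonneg (hw0 x)]
  have hHGi : Integrable (fun x => H x * (starRingEnd ℂ) (G x)) := by
    apply Integrable.bdd_mul (c := ∫ ξ, ‖F ξ‖) _ hHc.aestronglyMeasurable (Eventually.of_forall hHb)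
    exact (Complex.conjCLE.toContinuousLinearMap.integrable_comp hGi)
  have hYe : Y = ∫⁻ x, ‖H x * (starRingEnd ℂ) (G x)‖ₑ := by
    rw [hY]; congr 1; ext x
    rw [enorm_mul, RCLike.enorm_conj, henG, sq, mul_assoc]
  have hYfin : Y ≠ ∞ := by
    rw [hYe]; exact hHGi.2.ne
  have hreal : ∀ x, H x * (starRingEnd ℂ) (G x) = ((‖H x * (starRingEnd ℂ) (G x)‖ : ℝ) : ℂ) := by
    intro x
    simp only [hG, map_mul, Complex.conj_ofReal]
    rw [← mul_assoc, Complex.mul_conj, norm_mul, norm_real, norm_real,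
      Real.norm_of_nonneg (hw0 x), Real.norm_of_nonneg (Complex.normSq_nonneg _), ofReal_mul]
  set W := (∫⁻ x, ENNReal.ofReal (w x) ^ (((m:ℝ) + 2) / 2)) ^ (1 / (((m:ℝ) + 2) / 2)) with hW
  set Φ := ∫⁻ ξ, ‖F ξ‖ₑ ^ 2 with hΦ
  have hFGm : Measurable (𝓕 G) := (ST_fourier_continuous hGi).measurable
  -- duality
  have hY1 : Y ≤ Φ ^ (1/2:ℝ) * (∫⁻ ξ in ST_ann (m + 1) a b, ‖𝓕 G ξ‖ₑ ^ 2) ^ (1/2:ℝ) := by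
    calc Y = ENNReal.ofReal (∫ x, ‖H x * (starRingEnd ℂ) (G x)‖) := by
          rw [hYe]; exact (ofReal_integral_norm_eq_lintegral_enorm hHGi).symm
      _ = ‖∫ x, H x * (starRingEnd ℂ) (G x)‖ₑ := by
          rw [integral_congr_ae (Eventually.of_forall hreal), integral_complex_ofReal, ← ofReal_norm,
            norm_real, Real.norm_of_nonneg (integral_nonneg (fun _ => norm_nonneg _))]
      _ = ‖∫ ξ, F ξ * (starRingEnd ℂ) (𝓕 G ξ)‖ₑ := by rw [ST_sesq_flip hFi hGi]
      _ ≤ ∫⁻ ξ, ‖F ξ * (starRingEnd ℂ) (𝓕 G ξ)‖ₑ := enorm_integral_le_lintegral_enorm _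
      _ = ∫⁻ ξ in ST_ann (m + 1) a b, ‖F ξ‖ₑ * ‖𝓕 G ξ‖ₑ := by
          rw [← lintegral_indicator (ST_ann_meas _ a b)]
          congr 1; ext ξ
          by_cases h : ξ ∈ ST_ann (m + 1) a b
          · simp [h, enorm_mul, RCLike.enorm_conj]
          · simp [h, hFs ξ h]
      _ ≤ (∫⁻ ξ in ST_ann (m + 1) a b, ‖F ξ‖ₑ ^ (2:ℝ)) ^ (1/2:ℝ) *
          (∫⁻ ξ in ST_ann (m + 1) a b, ‖𝓕 G ξ‖ₑ ^ (2:ℝ)) ^ (1/2:ℝ) :=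
          ENNReal.lintegral_mul_le_Lp_mul_Lq _ (by constructor <;> norm_num)
            hFm.enorm.aemeasurable hFGm.enorm.aemeasurable
      _ ≤ _ := by
          simp only [ENNReal.rpow_two]
          gcongr
          exact setLIntegral_le_lintegral _ _
  -- Hölder
  have hHol : (∫⁻ x, ‖G x‖ₑ ^ (2 / (2 - γ))) ^ (2 - γ) ≤ Y * W := by
    have hc : (2 - γ).HolderConjugate ((2 - γ) / (1 - γ)) := by
      rw [Real.holderConjugate_iff]
      refine ⟨by linarith, ?_⟩
      field_simp; ring
    have := ENNReal.lintegral_mul_le_Lp_mul_Lq (volume : Measure (EuclideanSpace ℝ (Fin (m + 1)))) hc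
      (f := fun x => (‖H x‖ₑ ^ 2 * ENNReal.ofReal (w x)) ^ (1 / (2 - γ)))
      (g := fun x => ENNReal.ofReal (w x) ^ (1 / (2 - γ)))
      (Measurable.pow_const (by have := hHc.measurable; fun_prop) _).aemeasurable
      ((hwm.ennreal_ofReal).pow_const _).aemeasurable
    simp only [Pi.mul_apply] at this
    have e1 : ∀ x, ‖G x‖ₑ ^ (2 / (2 - γ)) = (‖H x‖ₑ ^ 2 * ENNReal.ofReal (w x)) ^ (1 / (2 - γ)) *
        ENNReal.ofReal (w x) ^ (1 / (2 - γ)) := by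
      intro x
      rw [henG, ← ENNReal.mul_rpow_of_nonneg _ _ (by positivity)]
      rw [show ‖H x‖ₑ ^ 2 * ENNReal.ofReal (w x) * ENNReal.ofReal (w x) =
        (‖H x‖ₑ * ENNReal.ofReal (w x)) ^ (2:ℝ) by rw [ENNReal.rpow_two]; ring, ← ENNReal.rpow_mul]
      congr 1; ring
    have e2 : ∀ x, ((‖H x‖ₑ ^ 2 * ENNReal.ofReal (w x)) ^ (1 / (2 - γ))) ^ (2 - γ) =
        ‖H x‖ₑ ^ 2 * ENNReal.ofReal (w x) := by
      intro x; rw [← ENNReal.rpow_mul, one_div_mul_cancel h2g.ne', ENNReal.rpow_one]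
    have e3 : ∀ x, (ENNReal.ofReal (w x) ^ (1 / (2 - γ))) ^ ((2 - γ) / (1 - γ)) =
        ENNReal.ofReal (w x) ^ (((m:ℝ) + 2) / 2) := by
      intro x; rw [← ENNReal.rpow_mul, hr']; congr 1; field_simp
    simp only [← e1, e2, e3] at this
    refine (ENNReal.rpow_le_rpow this h2g.le).trans ?_
    rw [ENNReal.mul_rpow_of_nonneg _ _ h2g.le, ← ENNReal.rpow_mul, ← ENNReal.rpow_mul,
      one_div_mul_cancel h2g.ne', ENNReal.rpow_one, ← hY, hW, hr]
    apply le_of_eq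
    congr 2
    field_simp
  have hfin := hres a b ha hab hb G hGb
  set c := ENNReal.ofReal (C * (b - a)) with hc
  have hY2 : Y ≤ (Φ * (c * (Y * W))) ^ (1/2:ℝ) := by
    rw [ENNReal.mul_rpow_of_nonneg _ _ (by norm_num)]
    refine hY1.trans ?_
    gcongr
    exact hfin.trans (by gcongr)
  have hY3 : Y * Y ≤ (c * (W * Φ)) * Y := by
    calc Y * Y = Y ^ (2:ℝ) := by rw [ENNReal.rpow_two, sq]
      _ ≤ ((Φ * (c * (Y * W))) ^ (1/2:ℝ)) ^ (2:ℝ) := ENNReal.rpow_le_rpow hY2 (by norm_num)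
      _ = _ := by rw [← ENNReal.rpow_mul]; norm_num; ring
  by_cases hY0 : Y = 0
  · rw [hY0]; exact bot_le
  · exact (ENNReal.mul_le_mul_iff_left hY0 hYfin).1 hY3

theorem ST_core (m : ℕ) (hm1 : 1 ≤ m) :
    ∃ C : ℝ, 0 < C ∧ ∀ a b : ℝ, 1 / 2 ≤ a → a < b → b ≤ 3 →
    ∀ F : EuclideanSpace ℝ (Fin (m + 1)) → ℂ, Measurable F → (∃ K, ∀ ξ, ‖F ξ‖ ≤ K) →
    (∀ ξ, ξ ∉ ST_ann (m + 1) a b → F ξ = 0) →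
    ∀ w : EuclideanSpace ℝ (Fin (m + 1)) → ℝ≥0∞, Measurable w →
    ∫⁻ x, ‖𝓕⁻ F x‖ₑ ^ 2 * w x ≤
      ENNReal.ofReal (C * (b - a)) * ((∫⁻ x, w x ^ (((m:ℝ) + 2) / 2)) ^ (1 / (((m:ℝ) + 2) / 2)) *
        ∫⁻ ξ, ‖F ξ‖ₑ ^ 2) := by
  obtain ⟨C, hC, h⟩ := ST_core_bdd m hm1
  refine ⟨C, hC, fun a b ha hab hb F hFm hFK hFs w hw => ?_⟩
  have hFb : ST_bcs F := ⟨hFm, hFK, b, fun ξ hξ => hFs ξ (fun h => absurd h.2 (not_le.2 hξ))⟩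
  have hHc : Continuous (𝓕⁻ F) := ST_fourierInv_continuous hFb.nice.2.1
  set wk : ℕ → EuclideanSpace ℝ (Fin (m + 1)) → ℝ≥0∞ := fun k =>
    (Metric.closedBall 0 (k:ℝ)).indicator (fun x => min (w x) k) with hwk
  have hwkm : ∀ k, Measurable (wk k) := fun k =>
    (hw.min measurable_const).indicator measurableSet_closedBall
  have hwkle : ∀ k x, wk k x ≤ k := by
    intro k x
    simp only [hwk]
    by_cases hx : x ∈ Metric.closedBall (0:EuclideanSpace ℝ (Fin (m + 1))) k
    · rw [Set.indicator_of_mem hx]; exact min_le_right _ _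
    · rw [Set.indicator_of_notMem hx]; exact bot_le
  have hwkw : ∀ k x, wk k x ≤ w x := by
    intro k x
    simp only [hwk]
    by_cases hx : x ∈ Metric.closedBall (0:EuclideanSpace ℝ (Fin (m + 1))) k
    · rw [Set.indicator_of_mem hx]; exact min_le_left _ _
    · rw [Set.indicator_of_notMem hx]; exact bot_le
  have hmono : ∀ x, Monotone (fun k => wk k x) := by
    intro x k l hkl
    simp only [hwk]
    by_cases hx : x ∈ Metric.closedBall (0:EuclideanSpace ℝ (Fin (m + 1))) k
    · have hx' : x ∈ Metric.closedBall (0:EuclideanSpace ℝ (Fin (m + 1))) l :=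
        Metric.closedBall_subset_closedBall (by exact_mod_cast hkl) hx
      rw [Set.indicator_of_mem hx, Set.indicator_of_mem hx']
      exact min_le_min le_rfl (by exact_mod_cast hkl)
    · rw [Set.indicator_of_notMem hx]; exact bot_le
  have hsup : ∀ x, ⨆ k, wk k x = w x := by
    intro x
    apply le_antisymm (iSup_le fun k => hwkw k x)
    obtain ⟨k₀, hk₀⟩ := exists_nat_ge ‖x‖
    have : ∀ k : ℕ, min (w x) k ≤ ⨆ k, wk k x := by
      intro k
      refine le_trans ?_ (le_iSup (fun k => wk k x) (max k k₀))
      simp only [hwk]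
      rw [Set.indicator_of_mem]
      · exact min_le_min le_rfl (by exact_mod_cast le_max_left _ _)
      · simp only [mem_closedBall_zero_iff]
        refine hk₀.trans ?_
        exact_mod_cast le_max_right _ _
    have h2 : ⨆ k : ℕ, min (w x) (k:ℝ≥0∞) = w x := by
      rw [← inf_iSup_eq, ENNReal.iSup_natCast, inf_top_eq]
    rw [← h2]; exact iSup_le this
  calc _ = ∫⁻ x, ⨆ k, ‖𝓕⁻ F x‖ₑ ^ 2 * wk k x := by
        congr 1; ext x; rw [← ENNReal.mul_iSup, hsup]
    _ = ⨆ k, ∫⁻ x, ‖𝓕⁻ F x‖ₑ ^ 2 * wk k x := by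
        apply lintegral_iSup
        · intro k; exact (hHc.measurable.enorm.pow_const 2).mul (hwkm k)
        · intro k l hkl x
          dsimp only
          gcongr
          exact hmono x hkl
    _ ≤ _ := by
        apply iSup_le; intro k
        have hfin : ∀ x, wk k x ≠ ∞ := fun x => ((hwkle k x).trans_lt (ENNReal.natCast_lt_top k)).ne
        have := h a b ha hab hb F hFm hFK hFs (fun x => (wk k x).toReal) (hwkm k).ennreal_toReal
          (fun x => ENNReal.toReal_nonneg)
          ⟨k, fun x => by
            have := ENNReal.toReal_mono (ENNReal.natCast_ne_top k) (hwkle k x)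
            simpa using this⟩
          ⟨k, fun x hx => by
            simp only [hwk]
            rw [Set.indicator_of_notMem]
            · simp
            · simpa using hx⟩
        simp only [ENNReal.ofReal_toReal (hfin _)] at this
        refine this.trans ?_
        gcongr with x
        exact hwkw k x

def ST_phi (φ : ℝ → ℝ) : Prop := ContDiff ℝ (⊤ : ℕ∞) φ ∧ ∀ s, 1 / 2 < |s| → φ s = 0

def ST_q {n : ℕ} (q : EuclideanSpace ℝ (Fin n) → ℂ) : Prop :=
  ContDiff ℝ (⊤ : ℕ∞) q ∧ HasCompactSupport q

/-- the radial multiplier -/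
noncomputable def ST_M {n : ℕ} (φ : ℝ → ℝ) (q : EuclideanSpace ℝ (Fin n) → ℂ) (δ t : ℝ)
    (ξ : EuclideanSpace ℝ (Fin n)) : ℂ :=
  ((φ (δ⁻¹ * (1 - ‖ξ‖ ^ 2 / t ^ 2)) : ℝ) : ℂ) * q ξ

noncomputable def ST_L {n : ℕ} (φ : ℝ → ℝ) (q : EuclideanSpace ℝ (Fin n) → ℂ) (δ t : ℝ)
    (g : EuclideanSpace ℝ (Fin n) → ℂ) : EuclideanSpace ℝ (Fin n) → ℂ :=
  𝓕⁻ (fun ξ => ST_M φ q δ t ξ * 𝓕 g ξ)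

theorem ST_phi.bdd {φ : ℝ → ℝ} (h : ST_phi φ) : ∃ K, 0 < K ∧ ∀ s, ‖φ s‖ ≤ K := by
  have hc : HasCompactSupport φ := by
    apply HasCompactSupport.intro (K := Set.Icc (-(1/2)) (1/2)) isCompact_Icc
    intro x hx
    apply h.2
    by_contra hh
    exact hx (abs_le.1 (not_lt.1 hh))
  obtain ⟨K, hK⟩ := hc.exists_bound_of_continuous h.1.continuous
  exact ⟨|K| + 1, by positivity, fun s => (hK s).trans (by linarith [le_abs_self K])⟩

theorem ST_q.bdd {n : ℕ} {q : EuclideanSpace ℝ (Fin n) → ℂ} (h : ST_q q) :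
    ∃ K, 0 < K ∧ ∀ s, ‖q s‖ ≤ K := by
  obtain ⟨K, hK⟩ := h.2.exists_bound_of_continuous h.1.continuous
  exact ⟨|K| + 1, by positivity, fun s => (hK s).trans (by linarith [le_abs_self K])⟩

theorem ST_M_cont {n : ℕ} {φ : ℝ → ℝ} {q : EuclideanSpace ℝ (Fin n) → ℂ} (hφ : ST_phi φ) (hq : ST_q q)
    (δ t : ℝ) : Continuous (ST_M φ q δ t) := by
  unfold ST_M
  have h1 := hφ.1.continuous
  have h2 := hq.1.continuous
  fun_prop

theorem ST_M_meas {n : ℕ} {φ : ℝ → ℝ} {q : EuclideanSpace ℝ (Fin n) → ℂ} (hφ : ST_phi φ) (hq : ST_q q)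
    (δ : ℝ) : Measurable (fun p : ℝ × EuclideanSpace ℝ (Fin n) => ST_M φ q δ p.1 p.2) := by
  unfold ST_M
  have h1 := hφ.1.continuous.measurable
  have h2 := hq.1.continuous.measurable
  fun_prop

theorem ST_M_compact {n : ℕ} {φ : ℝ → ℝ} {q : EuclideanSpace ℝ (Fin n) → ℂ} (hq : ST_q q)
    (δ t : ℝ) : HasCompactSupport (ST_M φ q δ t) := by
  unfold ST_M
  exact hq.2.mul_left

theorem ST_M_int {n : ℕ} {φ : ℝ → ℝ} {q : EuclideanSpace ℝ (Fin n) → ℂ} (hφ : ST_phi φ) (hq : ST_q q)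
    (δ t : ℝ) : Integrable (ST_M φ q δ t) :=
  (ST_M_cont hφ hq δ t).integrable_of_hasCompactSupport (ST_M_compact hq δ t)

theorem ST_L_int {n : ℕ} {φ : ℝ → ℝ} {q : EuclideanSpace ℝ (Fin n) → ℂ} (hφ : ST_phi φ) (hq : ST_q q)
    (δ t : ℝ) {g : EuclideanSpace ℝ (Fin n) → ℂ} (hg : Integrable g) :
    Integrable (fun ξ => ST_M φ q δ t ξ * 𝓕 g ξ) :=
  ST_mult_integrable (ST_M_int hφ hq δ t) hg

theorem ST_L_cont {n : ℕ} {φ : ℝ → ℝ} {q : EuclideanSpace ℝ (Fin n) → ℂ} (hφ : ST_phi φ) (hq : ST_q q)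
    (δ t : ℝ) {g : EuclideanSpace ℝ (Fin n) → ℂ} (hg : Integrable g) : Continuous (ST_L φ q δ t g) :=
  ST_fourierInv_continuous (ST_L_int hφ hq δ t hg)

theorem ST_L_meas {n : ℕ} {φ : ℝ → ℝ} {q : EuclideanSpace ℝ (Fin n) → ℂ} (hφ : ST_phi φ) (hq : ST_q q)
    (δ : ℝ) {g : EuclideanSpace ℝ (Fin n) → ℂ} (hg : Integrable g) :
    Measurable (fun p : ℝ × EuclideanSpace ℝ (Fin n) => ST_L φ q δ p.1 g p.2) := by
  have h1 := ST_M_meas hφ hq δ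
  have h2 := (ST_fourier_continuous hg).measurable
  have h0 : Measurable (fun p : (ℝ × EuclideanSpace ℝ (Fin n)) × EuclideanSpace ℝ (Fin n) =>
    (p.1.1, p.2)) := by fun_prop
  have h3 := h1.comp h0
  simp only [Function.comp_def] at h3
  have h4 : Measurable (fun p : (ℝ × EuclideanSpace ℝ (Fin n)) × EuclideanSpace ℝ (Fin n) =>
      Complex.exp (((2 * Real.pi * ⟪p.2, p.1.2⟫ : ℝ) : ℂ) * Complex.I)) := by
    apply Continuous.measurable
    fun_prop
  have h5 : Measurable (fun p : (ℝ × EuclideanSpace ℝ (Fin n)) × EuclideanSpace ℝ (Fin n) =>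
      Complex.exp (((2 * Real.pi * ⟪p.2, p.1.2⟫ : ℝ) : ℂ) * Complex.I) *
        (ST_M φ q δ p.1.1 p.2 * 𝓕 g p.2)) := h4.mul (h3.mul (h2.comp measurable_snd))
  have h6 := (StronglyMeasurable.integral_prod_right' (ν := volume) h5.stronglyMeasurable).measurable
  have e : (fun p : ℝ × EuclideanSpace ℝ (Fin n) => ST_L φ q δ p.1 g p.2) = fun p =>
      ∫ ξ, Complex.exp (((2 * Real.pi * ⟪ξ, p.2⟫ : ℝ) : ℂ) * Complex.I) *
        (ST_M φ q δ p.1 ξ * 𝓕 g ξ) := by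
    ext p
    unfold ST_L
    rw [Real.fourierInv_eq']
    rfl
  rw [e]
  exact h6

theorem ST_M_supp {n : ℕ} {φ : ℝ → ℝ} {q : EuclideanSpace ℝ (Fin n) → ℂ} (hφ : ST_phi φ)
    {δ t : ℝ} (hδ : 0 < δ) (ht : 0 < t) {ξ : EuclideanSpace ℝ (Fin n)}
    (h : ST_M φ q δ t ξ ≠ 0) : |‖ξ‖ ^ 2 - t ^ 2| ≤ t ^ 2 * δ / 2 := by
  by_contra hh
  push Not at hh
  apply h
  unfold ST_M
  rw [hφ.2]
  · simp
  · have e : δ⁻¹ * (1 - ‖ξ‖ ^ 2 / t ^ 2) = -((‖ξ‖ ^ 2 - t ^ 2) / (δ * t ^ 2)) := by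
      field_simp; ring
    rw [e, abs_neg, abs_div, abs_of_pos (by positivity : 0 < δ * t ^ 2), lt_div_iff₀ (by positivity)]
    linarith

theorem ST_base (m : ℕ) (hm1 : 1 ≤ m) (φ : ℝ → ℝ) (hφ : ST_phi φ)
    (q : EuclideanSpace ℝ (Fin (m + 1)) → ℂ) (hq : ST_q q) :
    ∃ C : ℝ, 0 < C ∧ ∀ δ : ℝ, 0 < δ → δ ≤ 1 → ∀ g, ST_nice volume g →
    ∀ w : EuclideanSpace ℝ (Fin (m + 1)) → ℝ≥0∞, Measurable w →
    ∫⁻ t in Set.Icc (1:ℝ) 2, ∫⁻ x, ‖ST_L φ q δ t g x‖ₑ ^ 2 * w x ≤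
      ENNReal.ofReal (C * δ ^ 2) *
        ((∫⁻ x, w x ^ (((m:ℝ) + 2) / 2)) ^ (1 / (((m:ℝ) + 2) / 2)) * ∫⁻ x, ‖g x‖ₑ ^ 2) := by
  obtain ⟨C, hC, hcore⟩ := ST_core m hm1
  obtain ⟨K₁, hK₁, hφb⟩ := hφ.bdd
  obtain ⟨K₂, hK₂, hqb⟩ := hq.bdd
  set K := K₁ * K₂ with hK
  have hMb : ∀ δ t ξ, ‖ST_M φ q δ t ξ‖ ≤ K := by
    intro δ t ξ
    unfold ST_M
    rw [norm_mul, norm_real]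
    exact mul_le_mul (hφb _) (hqb _) (norm_nonneg _) hK₁.le
  refine ⟨12 * C * K ^ 2, by positivity, fun δ hδ hδ1 g hg w hw => ?_⟩
  set W := (∫⁻ x, w x ^ (((m:ℝ) + 2) / 2)) ^ (1 / (((m:ℝ) + 2) / 2)) with hW
  have hgF := ST_fourier_continuous hg.2.1
  -- fixed t
  have h1 : ∀ t ∈ Set.Icc (1:ℝ) 2, ∫⁻ x, ‖ST_L φ q δ t g x‖ₑ ^ 2 * w x ≤
      ENNReal.ofReal (6 * C * δ) * W * ∫⁻ ξ, ‖ST_M φ q δ t ξ * 𝓕 g ξ‖ₑ ^ 2 := by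
    intro t ⟨ht1, ht2⟩
    set a := t * Real.sqrt (1 - 3 * δ / 4) with ha
    set b := t * Real.sqrt (1 + 3 * δ / 4) with hb
    have ht0 : 0 < t := by linarith
    have ha2 : a ^ 2 = t ^ 2 * (1 - 3 * δ / 4) := by
      rw [ha, mul_pow, Real.sq_sqrt (by linarith)]
    have hb2 : b ^ 2 = t ^ 2 * (1 + 3 * δ / 4) := by
      rw [hb, mul_pow, Real.sq_sqrt (by linarith)]
    have ha0 : 0 ≤ a := by positivity
    have hb0 : 0 ≤ b := by positivity
    have haa : 1 / 2 ≤ a := by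
      apply abs_le_of_sq_le_sq' _ ha0 |>.2
      rw [ha2]; nlinarith
    have hbb : b ≤ 3 := by
      apply abs_le_of_sq_le_sq' _ (by norm_num) |>.2
      rw [hb2]; nlinarith
    have hab : a < b := by
      apply abs_lt_of_sq_lt_sq' _ hb0 |>.2
      rw [ha2, hb2]; gcongr; linarith
    have hba : b - a ≤ 6 * δ := by
      have : (b - a) * (b + a) = t ^ 2 * (3 * δ / 2) := by
        linear_combination hb2 - ha2
      have ht4 : t ^ 2 ≤ 4 := by nlinarith
      have h4 : t ^ 2 * (3 * δ / 2) ≤ 6 * δ := by nlinarith [mul_le_mul_of_nonneg_right ht4 hδ.le]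
      nlinarith
    have := hcore a b haa hab hbb (fun ξ => ST_M φ q δ t ξ * 𝓕 g ξ)
      ((ST_M_cont hφ hq δ t).mul hgF).measurable
      ⟨K * ∫ x, ‖g x‖, fun ξ => by
        rw [norm_mul]
        exact mul_le_mul (hMb _ _ _) (ST_norm_fourier_le _ _) (norm_nonneg _) (by positivity)⟩
      (by
        intro ξ hξ
        by_contra hne
        apply hξ
        have h5 := ST_M_supp hφ hδ ht0 (left_ne_zero_of_mul hne)
        rw [abs_le] at h5
        constructor
        · apply abs_lt_of_sq_lt_sq' _ (norm_nonneg _) |>.2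
          rw [ha2]; nlinarith [mul_pos (pow_pos ht0 2) hδ]
        · apply abs_le_of_sq_le_sq' _ hb0 |>.2
          rw [hb2]; nlinarith [mul_pos (pow_pos ht0 2) hδ]) w hw
    refine this.trans ?_
    rw [mul_assoc (ENNReal.ofReal (6 * C * δ))]
    gcongr ?_ * _
    apply ENNReal.ofReal_le_ofReal
    nlinarith
  -- measure of t-set
  have h2 : ∀ ξ : EuclideanSpace ℝ (Fin (m + 1)),
      ∫⁻ t in Set.Icc (1:ℝ) 2, ‖ST_M φ q δ t ξ‖ₑ ^ 2 ≤ ENNReal.ofReal (K ^ 2 * (2 * δ)) := by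
    intro ξ
    set S : Set ℝ := {t | t ∈ Set.Icc (1:ℝ) 2 ∧ |‖ξ‖ ^ 2 - t ^ 2| ≤ t ^ 2 * δ / 2} with hS
    have hSm : MeasurableSet S := by
      apply measurableSet_Icc.inter
      exact measurableSet_le (f := fun t : ℝ => |‖ξ‖ ^ 2 - t ^ 2|) (g := fun t => t ^ 2 * δ / 2)
        (by fun_prop) (by fun_prop)
    have hvol : volume S ≤ ENNReal.ofReal (2 * δ) := by
      refine (Real.volume_le_diam S).trans ?_
      apply Metric.ediam_le
      intro s hs t ht
      rw [edist_dist]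
      apply ENNReal.ofReal_le_ofReal
      obtain ⟨⟨hs1, hs2⟩, hs3⟩ := hs
      obtain ⟨⟨ht1, ht2⟩, ht3⟩ := ht
      rw [abs_le] at hs3 ht3
      have hs5 : s ^ 2 ≤ 4 := by nlinarith
      have ht5 : t ^ 2 ≤ 4 := by nlinarith
      have hs4 : s ^ 2 * δ / 2 ≤ 2 * δ := by nlinarith [mul_le_mul_of_nonneg_right hs5 hδ.le]
      have ht4 : t ^ 2 * δ / 2 ≤ 2 * δ := by nlinarith [mul_le_mul_of_nonneg_right ht5 hδ.le]
      rw [Real.dist_eq, abs_le]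
      constructor
      · by_contra hh
        push Not at hh
        nlinarith
      · by_contra hh
        push Not at hh
        nlinarith
    calc _ ≤ ∫⁻ t in Set.Icc (1:ℝ) 2, S.indicator (fun _ => ENNReal.ofReal (K ^ 2)) t := by
          apply setLIntegral_mono' measurableSet_Icc
          intro t ht
          by_cases h : ST_M φ q δ t ξ = 0
          · simp [h]
          · rw [Set.indicator_of_mem (show t ∈ S from ⟨ht, ST_M_supp hφ hδ (by linarith [ht.1]) h⟩),
              ← ofReal_norm, ← ENNReal.ofReal_pow (norm_nonneg _)]
            apply ENNReal.ofReal_le_ofReal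
            exact pow_le_pow_left₀ (norm_nonneg _) (hMb _ _ _) 2
      _ ≤ ∫⁻ t, S.indicator (fun _ => ENNReal.ofReal (K ^ 2)) t := setLIntegral_le_lintegral _ _
      _ = ENNReal.ofReal (K ^ 2) * volume S := by
          rw [lintegral_indicator hSm, setLIntegral_const]
      _ ≤ _ := by
          rw [ENNReal.ofReal_mul (by positivity)]; gcongr
  have hMm := ST_M_meas hφ hq δ
  calc _ ≤ ∫⁻ t in Set.Icc (1:ℝ) 2, ENNReal.ofReal (6 * C * δ) * W * ∫⁻ ξ, ‖ST_M φ q δ t ξ * 𝓕 g ξ‖ₑ ^ 2 :=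
        setLIntegral_mono' measurableSet_Icc h1
    _ = ENNReal.ofReal (6 * C * δ) * W * ∫⁻ t in Set.Icc (1:ℝ) 2, ∫⁻ ξ, ‖ST_M φ q δ t ξ * 𝓕 g ξ‖ₑ ^ 2 := by
        apply lintegral_const_mul
        apply Measurable.lintegral_prod_right'
          (f := fun p : ℝ × EuclideanSpace ℝ (Fin (m + 1)) => ‖ST_M φ q δ p.1 p.2 * 𝓕 g p.2‖ₑ ^ 2)
        exact (hMm.mul (hgF.measurable.comp measurable_snd)).enorm.pow_const 2
    _ = ENNReal.ofReal (6 * C * δ) * W * ∫⁻ ξ, ∫⁻ t in Set.Icc (1:ℝ) 2, ‖ST_M φ q δ t ξ * 𝓕 g ξ‖ₑ ^ 2 := by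
        congr 1
        apply lintegral_lintegral_swap
        exact ((hMm.mul (hgF.measurable.comp measurable_snd)).enorm.pow_const 2).aemeasurable
    _ ≤ ENNReal.ofReal (6 * C * δ) * W * ∫⁻ ξ, ENNReal.ofReal (K ^ 2 * (2 * δ)) * ‖𝓕 g ξ‖ₑ ^ 2 := by
        gcongr with ξ
        simp only [enorm_mul, mul_pow]
        rw [lintegral_mul_const' _ _ (by simp)]
        gcongr
        exact h2 ξ
    _ = ENNReal.ofReal (6 * C * δ) * W * (ENNReal.ofReal (K ^ 2 * (2 * δ)) * ∫⁻ x, ‖g x‖ₑ ^ 2) := by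
        rw [lintegral_const_mul' _ _ ENNReal.ofReal_ne_top, ST_plancherel hg.2.1 (ST_nice_memLp hg)]
    _ = _ := by
        rw [show 12 * C * K ^ 2 * δ ^ 2 = (6 * C * δ) * (K ^ 2 * (2 * δ)) by ring,
          ENNReal.ofReal_mul (p := 6 * C * δ) (by positivity)]
        ring

theorem ST_phi.deriv {φ : ℝ → ℝ} (h : ST_phi φ) : ST_phi (_root_.deriv φ) := by
  refine ⟨ContDiff.deriv' (by simpa using h.1), fun s hs => ?_⟩
  have : φ =ᶠ[𝓝 s] fun _ => 0 := by
    have : {s : ℝ | 1 / 2 < |s|} ∈ 𝓝 s := (isOpen_lt continuous_const continuous_abs).mem_nhds hs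
    filter_upwards [this] with u hu using h.2 u hu
  rw [this.deriv_eq]; simp

theorem ST_q.mul_inner {n : ℕ} {q : EuclideanSpace ℝ (Fin n) → ℂ} (h : ST_q q)
    (v : EuclideanSpace ℝ (Fin n)) : ST_q (fun ξ => ((⟪ξ, v⟫ : ℝ) : ℂ) * q ξ) := by
  refine ⟨?_, h.2.mul_left⟩
  have h1 : ContDiff ℝ (⊤ : ℕ∞) (fun ξ : EuclideanSpace ℝ (Fin n) => ((⟪ξ, v⟫ : ℝ) : ℂ)) :=
    Complex.ofRealCLM.contDiff.comp (contDiff_id.inner ℝ contDiff_const)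
  exact h1.mul h.1

theorem ST_q.fderiv {n : ℕ} {q : EuclideanSpace ℝ (Fin n) → ℂ} (h : ST_q q)
    (v : EuclideanSpace ℝ (Fin n)) : ST_q (fun ξ => _root_.fderiv ℝ q ξ v) := by
  refine ⟨(h.1.fderiv_right (m := (⊤ : ℕ∞)) (by simp)).clm_apply contDiff_const, ?_⟩
  exact h.2.fderiv_apply (𝕜 := ℝ) v

theorem ST_M_contDiff {n : ℕ} {φ : ℝ → ℝ} {q : EuclideanSpace ℝ (Fin n) → ℂ} (hφ : ST_phi φ) (hq : ST_q q)
    (δ t : ℝ) : ContDiff ℝ (⊤ : ℕ∞) (ST_M φ q δ t) := by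
  unfold ST_M
  refine (Complex.ofRealCLM.contDiff.comp (hφ.1.comp ?_)).mul hq.1
  exact contDiff_const.mul (contDiff_const.sub ((contDiff_norm_sq ℝ).div_const _))

theorem ST_M_fderiv {n : ℕ} {φ : ℝ → ℝ} {q : EuclideanSpace ℝ (Fin n) → ℂ} (hφ : ST_phi φ) (hq : ST_q q)
    (δ t : ℝ) (v ξ : EuclideanSpace ℝ (Fin n)) :
    fderiv ℝ (ST_M φ q δ t) ξ v = -((2 / (δ * t ^ 2) : ℝ) : ℂ) *
      ST_M (deriv φ) (fun ξ => ((⟪ξ, v⟫ : ℝ) : ℂ) * q ξ) δ t ξ +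
      ST_M φ (fun ξ => fderiv ℝ q ξ v) δ t ξ := by
  have h1 : HasFDerivAt (fun ξ : EuclideanSpace ℝ (Fin n) => ‖ξ‖ ^ 2) (2 • innerSL ℝ ξ) ξ :=
    (hasStrictFDerivAt_norm_sq ξ).hasFDerivAt
  have h2 := (((h1.mul_const (t ^ 2)⁻¹).const_sub 1).const_mul δ⁻¹)
  have h3 : HasDerivAt φ (deriv φ (δ⁻¹ * (1 - ‖ξ‖ ^ 2 / t ^ 2))) (δ⁻¹ * (1 - ‖ξ‖ ^ 2 / t ^ 2)) :=
    ((hφ.1.differentiable (by simp)) _).hasDerivAt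
  simp only [← div_eq_mul_inv] at h2
  have h4 := h3.comp_hasFDerivAt ξ h2
  have h5 := (Complex.ofRealCLM.hasFDerivAt (x := φ (δ⁻¹ * (1 - ‖ξ‖ ^ 2 / t ^ 2)))).comp ξ h4
  have h6 := ((hq.1.differentiable (by simp)) ξ).hasFDerivAt
  have h7 := h5.mul h6
  have h8 : fderiv ℝ (ST_M φ q δ t) ξ = _ := h7.fderiv
  rw [h8]
  simp [ST_M, real_inner_comm]
  ring

theorem ST_M_fourier {n : ℕ} {φ : ℝ → ℝ} {q : EuclideanSpace ℝ (Fin n) → ℂ} (hφ : ST_phi φ) (hq : ST_q q)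
    (δ t : ℝ) (v z : EuclideanSpace ℝ (Fin n)) :
    (2 * Real.pi * Complex.I) * ((⟪v, z⟫ : ℝ) : ℂ) * 𝓕⁻ (ST_M φ q δ t) z =
      - 𝓕⁻ (fun ξ => fderiv ℝ (ST_M φ q δ t) ξ v) z := by
  have hd := ST_M_contDiff hφ hq δ t
  have hc := ST_M_compact (φ := φ) hq δ t
  have hi : Integrable (fderiv ℝ (ST_M φ q δ t)) :=
    (hd.continuous_fderiv (by simp)).integrable_of_hasCompactSupport (hc.fderiv (𝕜 := ℝ))
  have h1 := Real.fourier_fderiv (ST_M_int hφ hq δ t) (hd.differentiable (by simp)) hi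
  have h2 := congrArg (fun F => F (-z) v) h1
  have h3 := Real.fourier_continuousLinearMap_apply (a := v) (v := -z) hi
  rw [Real.fourierInv_eq_fourier_neg, Real.fourierInv_eq_fourier_neg, ← h3, h1]
  have e : ((innerSL ℝ) z) v = ⟪v, z⟫ := by rw [real_inner_comm]; rfl
  simp [VectorFourier.fourierSMulRight_apply, e]
  try ring

theorem ST_L_comm {n : ℕ} {φ : ℝ → ℝ} {q : EuclideanSpace ℝ (Fin n) → ℂ} (hφ : ST_phi φ) (hq : ST_q q)
    {δ t : ℝ} (hδ : δ ≠ 0) (v b x : EuclideanSpace ℝ (Fin n)) {g : EuclideanSpace ℝ (Fin n) → ℂ}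
    (hg : Integrable g) (hg' : Integrable (fun y => ((δ * ⟪v, y - b⟫ : ℝ) : ℂ) * g y)) :
    ((δ * ⟪v, x - b⟫ : ℝ) : ℂ) * ST_L φ q δ t g x =
      ST_L φ q δ t (fun y => ((δ * ⟪v, y - b⟫ : ℝ) : ℂ) * g y) x +
      (2 * Real.pi * Complex.I)⁻¹ * (((2 / t ^ 2 : ℝ) : ℂ) *
        ST_L (deriv φ) (fun ξ => ((⟪ξ, v⟫ : ℝ) : ℂ) * q ξ) δ t g x -
        δ * ST_L φ (fun ξ => fderiv ℝ q ξ v) δ t g x) := by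
  have hI := ST_M_int hφ hq δ t
  have hI1 := ST_M_int hφ.deriv (hq.mul_inner v) δ t
  have hI2 := ST_M_int hφ (hq.fderiv v) δ t
  have hpi : (2 * Real.pi * Complex.I : ℂ) ≠ 0 := by simp [Real.pi_ne_zero]
  have hk : ∀ (m : EuclideanSpace ℝ (Fin n) → ℂ) (hm : Integrable m) (g : EuclideanSpace ℝ (Fin n) → ℂ)
      (hg : Integrable g), Integrable (fun y => 𝓕⁻ m (x - y) * g y) := by
    intro m hm g hg
    refine hg.bdd_mul (c := ∫ ξ, ‖m ξ‖) ?_ ?_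
    · exact ((ST_fourierInv_continuous hm).comp (continuous_const.sub continuous_id)).aestronglyMeasurable
    · exact Eventually.of_forall fun y => ST_norm_fourierInv_le _ _
  have hkern : ∀ z, ((δ * ⟪v, z⟫ : ℝ) : ℂ) * 𝓕⁻ (ST_M φ q δ t) z =
      (2 * Real.pi * Complex.I)⁻¹ * (((2 / t ^ 2 : ℝ) : ℂ) *
        𝓕⁻ (ST_M (deriv φ) (fun ξ => ((⟪ξ, v⟫ : ℝ) : ℂ) * q ξ) δ t) z -
        δ * 𝓕⁻ (ST_M φ (fun ξ => fderiv ℝ q ξ v) δ t) z) := by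
    intro z
    have h := ST_M_fourier hφ hq δ t v z
    have h2 : 𝓕⁻ (fun ξ => fderiv ℝ (ST_M φ q δ t) ξ v) z = -((2 / (δ * t ^ 2) : ℝ) : ℂ) *
        𝓕⁻ (ST_M (deriv φ) (fun ξ => ((⟪ξ, v⟫ : ℝ) : ℂ) * q ξ) δ t) z +
        𝓕⁻ (ST_M φ (fun ξ => fderiv ℝ q ξ v) δ t) z := by
      simp only [ST_M_fderiv hφ hq]
      simp only [Real.fourierInv_eq]
      rw [← integral_const_mul, ← integral_add]
      · congr 1; ext ξ
        simp only [smul_add, Circle.smul_def, smul_eq_mul]; ring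
      · apply Integrable.const_mul
        exact (Real.fourierIntegral_convergent_iff (-z)).2 hI1 |>.congr (by simp)
      · exact (Real.fourierIntegral_convergent_iff (-z)).2 hI2 |>.congr (by simp)
    rw [h2] at h
    apply mul_left_cancel₀ hpi
    rw [mul_inv_cancel_left₀ hpi]
    have e : ((2 / t ^ 2 : ℝ) : ℂ) = δ * ((2 / (δ * t ^ 2) : ℝ) : ℂ) := by
      rw [← Complex.ofReal_mul]
      congr 1
      field_simp
    rw [e, Complex.ofReal_mul]
    linear_combination (δ : ℂ) * h
  unfold ST_L
  rw [ST_conv _ _ hI hg, ST_conv _ _ hI hg', ST_conv _ _ hI1 hg, ST_conv _ _ hI2 hg]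
  rw [← integral_const_mul, ← integral_const_mul, ← integral_const_mul, ← integral_sub, 
    ← integral_const_mul, ← integral_add]
  · congr 1; ext y
    have h := hkern (x - y)
    have e : ((δ * ⟪v, x - b⟫ : ℝ) : ℂ) = ((δ * ⟪v, x - y⟫ : ℝ) : ℂ) + ((δ * ⟪v, y - b⟫ : ℝ) : ℂ) := by
      rw [← Complex.ofReal_add, ← mul_add, ← inner_add_right]; simp
    rw [e]
    linear_combination g y * h
  · exact hk _ hI _ hg'
  · exact (((hk _ hI1 _ hg).const_mul _).sub ((hk _ hI2 _ hg).const_mul _)).const_mul _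
  · exact (hk _ hI1 _ hg).const_mul _
  · exact (hk _ hI2 _ hg).const_mul _

theorem ST_three (z a b c : ℂ) (h : ‖z‖ ≤ ‖a‖ + ‖b‖ + ‖c‖) :
    ‖z‖ₑ ^ 2 ≤ 3 * (‖a‖ₑ ^ 2 + ‖b‖ₑ ^ 2 + ‖c‖ₑ ^ 2) := by
  have e : ∀ z : ℂ, ‖z‖ₑ ^ 2 = ENNReal.ofReal (‖z‖ ^ 2) := fun z => by
    rw [← ofReal_norm, ENNReal.ofReal_pow (norm_nonneg _)]
  rw [e, e, e, e, ← ENNReal.ofReal_add (by positivity) (by positivity),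
    ← ENNReal.ofReal_add (by positivity) (by positivity), show (3:ℝ≥0∞) = ENNReal.ofReal 3 by simp,
    ← ENNReal.ofReal_mul (by norm_num)]
  apply ENNReal.ofReal_le_ofReal
  have := pow_le_pow_left₀ (norm_nonneg z) h 2
  nlinarith [sq_nonneg (‖a‖ - ‖b‖), sq_nonneg (‖a‖ - ‖c‖), sq_nonneg (‖b‖ - ‖c‖)]

theorem ST_mom (m : ℕ) (hm1 : 1 ≤ m) (v : EuclideanSpace ℝ (Fin (m + 1))) (hv : ‖v‖ ≤ 1) (K : ℕ) :
    ∀ (φ : ℝ → ℝ) (_ : ST_phi φ)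
    (q : EuclideanSpace ℝ (Fin (m + 1)) → ℂ) (_ : ST_q q),
    ∃ C : ℝ, 0 < C ∧ ∀ δ : ℝ, 0 < δ → δ ≤ 1 → ∀ b g, ST_nice volume g →
    (∀ y, g y ≠ 0 → ‖y - b‖ ≤ δ⁻¹) →
    ∀ w : EuclideanSpace ℝ (Fin (m + 1)) → ℝ≥0∞, Measurable w →
    ∫⁻ t in Set.Icc (1:ℝ) 2, ∫⁻ x, ‖δ * ⟪v, x - b⟫‖ₑ ^ (2 * K) * ‖ST_L φ q δ t g x‖ₑ ^ 2 * w x ≤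
      ENNReal.ofReal (C * δ ^ 2) *
        ((∫⁻ x, w x ^ (((m:ℝ) + 2) / 2)) ^ (1 / (((m:ℝ) + 2) / 2)) * ∫⁻ x, ‖g x‖ₑ ^ 2) := by
  induction K with
  | zero =>
    intro φ hφ q hq
    obtain ⟨C, hC, h⟩ := ST_base m hm1 φ hφ q hq
    refine ⟨C, hC, fun δ hδ hδ1 b g hg _ w hw => ?_⟩
    simpa using h δ hδ hδ1 g hg w hw
  | succ K ih =>
    intro φ hφ q hq
    obtain ⟨C₁, hC₁, h₁⟩ := ih φ hφ q hq
    obtain ⟨C₂, hC₂, h₂⟩ := ih _ hφ.deriv _ (hq.mul_inner v)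
    obtain ⟨C₃, hC₃, h₃⟩ := ih φ hφ _ (hq.fderiv v)
    refine ⟨3 * (C₁ + C₂ + C₃), by positivity, fun δ hδ hδ1 b g hg hgs w hw => ?_⟩
    set g' : EuclideanSpace ℝ (Fin (m + 1)) → ℂ := fun y => ((δ * ⟪v, y - b⟫ : ℝ) : ℂ) * g y with hg'
    have hg'le : ∀ y, ‖g' y‖ ≤ ‖g y‖ := by
      intro y
      by_cases h0 : g y = 0
      · simp [hg', h0]
      · have h1 := hgs y h0
        rw [hg']
        simp only [norm_mul, Complex.norm_real]
        have h2 : ‖⟪v, y - b⟫‖ ≤ δ⁻¹ := (norm_inner_le_norm _ _).trans (by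
          nlinarith [norm_nonneg v, norm_nonneg (y - b)])
        have h3 : ‖δ‖ * ‖⟪v, y - b⟫‖ ≤ 1 := by
          rw [Real.norm_of_nonneg hδ.le]
          calc δ * ‖⟪v, y - b⟫‖ ≤ δ * δ⁻¹ := by gcongr
            _ = 1 := mul_inv_cancel₀ hδ.ne'
        nlinarith [norm_nonneg (g y)]
    have hg'm : Measurable g' := by
      have := hg.1
      rw [hg']
      fun_prop
    have hg'n : ST_nice volume g' := by
      refine ⟨hg'm, hg.2.1.mono hg'm.aestronglyMeasurable (Eventually.of_forall hg'le), ?_⟩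
      obtain ⟨K, hK⟩ := hg.2.2
      exact ⟨K, fun x => (hg'le x).trans (hK x)⟩
    have hg's : ∀ y, g' y ≠ 0 → ‖y - b‖ ≤ δ⁻¹ := fun y hy => hgs y (right_ne_zero_of_mul hy)
    set W := (∫⁻ x, w x ^ (((m:ℝ) + 2) / 2)) ^ (1 / (((m:ℝ) + 2) / 2)) with hW
    have hwt : Measurable (fun p : ℝ × EuclideanSpace ℝ (Fin (m + 1)) =>
        ‖δ * ⟪v, p.2 - b⟫‖ₑ ^ (2 * K)) := by
      apply Measurable.pow_const
      apply Measurable.enorm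
      fun_prop
    have hmeas : ∀ (φ : ℝ → ℝ) (_ : ST_phi φ) (q : EuclideanSpace ℝ (Fin (m + 1)) → ℂ) (_ : ST_q q)
        (g : EuclideanSpace ℝ (Fin (m + 1)) → ℂ) (_ : Integrable g),
        Measurable (fun p : ℝ × EuclideanSpace ℝ (Fin (m + 1)) =>
        ‖δ * ⟪v, p.2 - b⟫‖ₑ ^ (2 * K) * ‖ST_L φ q δ p.1 g p.2‖ₑ ^ 2 * w p.2) := by
      intro φ hφ q hq g hg
      exact (hwt.mul ((ST_L_meas hφ hq δ hg).enorm.pow_const 2)).mul (hw.comp measurable_snd)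
    have hM1 := hmeas φ hφ q hq g' hg'n.2.1
    have hM2 := hmeas _ hφ.deriv _ (hq.mul_inner v) g hg.2.1
    have hM3 := hmeas φ hφ _ (hq.fderiv v) g hg.2.1
    have hpt : ∀ t ∈ Set.Icc (1:ℝ) 2, ∀ x,
        ‖δ * ⟪v, x - b⟫‖ₑ ^ (2 * (K + 1)) * ‖ST_L φ q δ t g x‖ₑ ^ 2 * w x ≤
        3 * (‖δ * ⟪v, x - b⟫‖ₑ ^ (2 * K) * ‖ST_L φ q δ t g' x‖ₑ ^ 2 * w x +
          ‖δ * ⟪v, x - b⟫‖ₑ ^ (2 * K) * ‖ST_L (deriv φ) (fun ξ => ((⟪ξ, v⟫ : ℝ) : ℂ) * q ξ) δ t g x‖ₑ ^ 2 * w x +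
          ‖δ * ⟪v, x - b⟫‖ₑ ^ (2 * K) * ‖ST_L φ (fun ξ => fderiv ℝ q ξ v) δ t g x‖ₑ ^ 2 * w x) := by
      intro t ht x
      have hc := ST_L_comm hφ hq (t := t) hδ.ne' v b x hg.2.1 hg'n.2.1
      have hpi : ‖(2 * Real.pi * Complex.I : ℂ)⁻¹‖ ≤ 1 / 2 := by
        rw [norm_inv]
        simp only [norm_mul, Complex.norm_I, Complex.norm_real, Complex.norm_ofNat, mul_one]
        rw [Real.norm_of_nonneg Real.pi_pos.le, inv_le_comm₀ (by positivity) (by norm_num)]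
        linarith [Real.pi_gt_three]
      have ht2 : ‖((2 / t ^ 2 : ℝ) : ℂ)‖ ≤ 2 := by
        rw [Complex.norm_real, Real.norm_of_nonneg (by positivity), div_le_iff₀ (by nlinarith [ht.1])]
        nlinarith [ht.1]
      have hδn : ‖(δ : ℂ)‖ ≤ 1 := by
        rw [Complex.norm_real, Real.norm_of_nonneg hδ.le]; exact hδ1
      have h3 := ST_three (((δ * ⟪v, x - b⟫ : ℝ) : ℂ) * ST_L φ q δ t g x) (ST_L φ q δ t g' x)
        (ST_L (deriv φ) (fun ξ => ((⟪ξ, v⟫ : ℝ) : ℂ) * q ξ) δ t g x)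
        (ST_L φ (fun ξ => fderiv ℝ q ξ v) δ t g x) (by
          rw [hc, add_assoc]
          refine (norm_add_le _ _).trans (add_le_add le_rfl ?_)
          rw [norm_mul]
          refine (mul_le_mul hpi (norm_sub_le _ _) (norm_nonneg _) (by norm_num)).trans ?_
          rw [norm_mul, norm_mul]
          have a1 := mul_le_mul_of_nonneg_right ht2 (norm_nonneg (ST_L (deriv φ) (fun ξ => ((⟪ξ, v⟫ : ℝ) : ℂ) * q ξ) δ t g x))
          have a2 := mul_le_mul_of_nonneg_right hδn (norm_nonneg (ST_L φ (fun ξ => fderiv ℝ q ξ v) δ t g x))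
          have a3 := norm_nonneg (ST_L φ (fun ξ => fderiv ℝ q ξ v) δ t g x)
          linarith)
      have e : ‖δ * ⟪v, x - b⟫‖ₑ ^ (2 * (K + 1)) * ‖ST_L φ q δ t g x‖ₑ ^ 2 * w x =
          ‖δ * ⟪v, x - b⟫‖ₑ ^ (2 * K) * w x * ‖((δ * ⟪v, x - b⟫ : ℝ) : ℂ) * ST_L φ q δ t g x‖ₑ ^ 2 := by
        rw [enorm_mul (((δ * ⟪v, x - b⟫ : ℝ) : ℂ)), ← ofReal_norm (((δ * ⟪v, x - b⟫ : ℝ) : ℂ)), Complex.norm_real, ofReal_norm]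
        ring
      rw [e]
      refine (mul_le_mul_right h3 _).trans (le_of_eq ?_)
      ring
    have hIntg : ∀ {F : ℝ × EuclideanSpace ℝ (Fin (m + 1)) → ℝ≥0∞}, Measurable F →
        Measurable (fun t => ∫⁻ x, F (t, x)) := fun hF => hF.lintegral_prod_right'
    have hsl : ∀ {F : ℝ × EuclideanSpace ℝ (Fin (m + 1)) → ℝ≥0∞} (t : ℝ), Measurable F →
        Measurable (fun x => F (t, x)) := fun t hF => hF.comp measurable_prodMk_left
    calc _ ≤ ∫⁻ t in Set.Icc (1:ℝ) 2, 3 * ((∫⁻ x, ‖δ * ⟪v, x - b⟫‖ₑ ^ (2 * K) * ‖ST_L φ q δ t g' x‖ₑ ^ 2 * w x) +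
          (∫⁻ x, ‖δ * ⟪v, x - b⟫‖ₑ ^ (2 * K) * ‖ST_L (deriv φ) (fun ξ => ((⟪ξ, v⟫ : ℝ) : ℂ) * q ξ) δ t g x‖ₑ ^ 2 * w x) +
          ∫⁻ x, ‖δ * ⟪v, x - b⟫‖ₑ ^ (2 * K) * ‖ST_L φ (fun ξ => fderiv ℝ q ξ v) δ t g x‖ₑ ^ 2 * w x) := by
          apply setLIntegral_mono' measurableSet_Icc
          intro t ht
          refine (lintegral_mono (hpt t ht)).trans (le_of_eq ?_)
          rw [lintegral_const_mul' _ _ (by simp), lintegral_add_right _ (hsl t hM3), lintegral_add_right _ (hsl t hM2)]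
      _ = 3 * ((∫⁻ t in Set.Icc (1:ℝ) 2, ∫⁻ x, ‖δ * ⟪v, x - b⟫‖ₑ ^ (2 * K) * ‖ST_L φ q δ t g' x‖ₑ ^ 2 * w x) +
          (∫⁻ t in Set.Icc (1:ℝ) 2, ∫⁻ x, ‖δ * ⟪v, x - b⟫‖ₑ ^ (2 * K) * ‖ST_L (deriv φ) (fun ξ => ((⟪ξ, v⟫ : ℝ) : ℂ) * q ξ) δ t g x‖ₑ ^ 2 * w x) +
          ∫⁻ t in Set.Icc (1:ℝ) 2, ∫⁻ x, ‖δ * ⟪v, x - b⟫‖ₑ ^ (2 * K) * ‖ST_L φ (fun ξ => fderiv ℝ q ξ v) δ t g x‖ₑ ^ 2 * w x) := by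
          rw [lintegral_const_mul' _ _ (by simp), lintegral_add_right _ (hIntg hM3), lintegral_add_right _ (hIntg hM2)]
      _ ≤ 3 * (ENNReal.ofReal (C₁ * δ ^ 2) * (W * ∫⁻ x, ‖g x‖ₑ ^ 2) + ENNReal.ofReal (C₂ * δ ^ 2) * (W * ∫⁻ x, ‖g x‖ₑ ^ 2) +
            ENNReal.ofReal (C₃ * δ ^ 2) * (W * ∫⁻ x, ‖g x‖ₑ ^ 2)) := by
          refine mul_le_mul_right (add_le_add (add_le_add ?_ ?_) ?_) 3
          · refine (h₁ δ hδ hδ1 b g' hg'n hg's w hw).trans ?_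
            refine mul_le_mul_right (mul_le_mul_right (lintegral_mono fun x => ?_) _) _
            exact pow_le_pow_left₀ bot_le (enorm_le_iff_norm_le.2 (hg'le x)) 2
          · exact h₂ δ hδ hδ1 b g hg hgs w hw
          · exact h₃ δ hδ hδ1 b g hg hgs w hw
      _ = _ := by
          rw [← add_mul, ← add_mul, ← ENNReal.ofReal_add (by positivity) (by positivity),
            ← ENNReal.ofReal_add (by positivity) (by positivity), ← mul_assoc,
            show (3:ℝ≥0∞) = ENNReal.ofReal 3 by simp, ← ENNReal.ofReal_mul (by norm_num)]
          congr 2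
          ring

theorem ST_poly (n K : ℕ) : ∃ C : ℝ, 0 < C ∧ ∀ (y : EuclideanSpace ℝ (Fin n)),
    (1 + ‖y‖) ^ (2 * (K + 1)) ≤ C * (1 + ∑ i, |y i| ^ (2 * (K + 1))) := by
  refine ⟨2 ^ (2 * K + 1) * (1 + (n : ℝ) ^ (2 * K + 1)), by positivity, fun y => ?_⟩
  have h1 : ‖y‖ ≤ ∑ i, |y i| := by
    rw [EuclideanSpace.norm_eq]
    apply Real.sqrt_le_iff.2
    refine ⟨by positivity, ?_⟩
    simp only [Real.norm_eq_abs]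
    exact Finset.sum_sq_le_sq_sum_of_nonneg (fun i _ => abs_nonneg _)
  have h2 : (1 + ‖y‖) ^ (2 * (K + 1)) ≤ 2 ^ (2 * K + 1) * (1 ^ (2 * (K + 1)) + ‖y‖ ^ (2 * (K + 1))) :=
    add_pow_le (by norm_num) (norm_nonneg _) _
  have h3 : (∑ i, |y i|) ^ (2 * K + 1 + 1) ≤ (n : ℝ) ^ (2 * K + 1) * ∑ i, |y i| ^ (2 * K + 1 + 1) := by
    rcases Nat.eq_zero_or_pos n with rfl | hn
    · simp
    have := pow_sum_div_card_le_sum_pow (s := Finset.univ) (f := fun i => |y i|) 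
      (fun i _ => abs_nonneg _) (2 * K + 1)
    rw [div_le_iff₀ (by simp; positivity)] at this
    simpa [mul_comm] using this
  have h4 := (pow_le_pow_left₀ (norm_nonneg y) h1 (2 * K + 1 + 1)).trans h3
  have h5 : 0 ≤ ∑ i, |y i| ^ (2 * (K + 1)) := by positivity
  have h6 : (0:ℝ) ≤ (n : ℝ) ^ (2 * K + 1) := by positivity
  have e : 2 * K + 1 + 1 = 2 * (K + 1) := by ring
  rw [e] at h4
  refine h2.trans ?_
  rw [mul_assoc]
  gcongr
  rw [one_pow]
  nlinarith

theorem ST_mom2 (m : ℕ) (hm1 : 1 ≤ m) (K : ℕ) (φ : ℝ → ℝ) (hφ : ST_phi φ)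
    (q : EuclideanSpace ℝ (Fin (m + 1)) → ℂ) (hq : ST_q q) :
    ∃ C : ℝ, 0 < C ∧ ∀ δ : ℝ, 0 < δ → δ ≤ 1 → ∀ b g, ST_nice volume g →
    (∀ y, g y ≠ 0 → ‖y - b‖ ≤ δ⁻¹) →
    ∀ w : EuclideanSpace ℝ (Fin (m + 1)) → ℝ≥0∞, Measurable w →
    ∫⁻ t in Set.Icc (1:ℝ) 2, ∫⁻ x, ENNReal.ofReal ((1 + δ * ‖x - b‖) ^ (2 * (K + 1))) *
        ‖ST_L φ q δ t g x‖ₑ ^ 2 * w x ≤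
      ENNReal.ofReal (C * δ ^ 2) *
        ((∫⁻ x, w x ^ (((m:ℝ) + 2) / 2)) ^ (1 / (((m:ℝ) + 2) / 2)) * ∫⁻ x, ‖g x‖ₑ ^ 2) := by
  obtain ⟨C₀, hC₀, h₀⟩ := ST_base m hm1 φ hφ q hq
  choose C hC hmom using fun i : Fin (m + 1) =>
    ST_mom m hm1 (EuclideanSpace.single i 1) (by simp) (K + 1) φ hφ q hq
  obtain ⟨C', hC', hp⟩ := ST_poly (m + 1) K
  have hCs : 0 ≤ ∑ i, C i := Finset.sum_nonneg fun i _ => (hC i).le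
  refine ⟨C' * (C₀ + ∑ i, C i), by positivity, fun δ hδ hδ1 b g hg hgs w hw => ?_⟩
  set W := (∫⁻ x, w x ^ (((m:ℝ) + 2) / 2)) ^ (1 / (((m:ℝ) + 2) / 2)) with hW
  have hLm : Measurable (fun p : ℝ × EuclideanSpace ℝ (Fin (m + 1)) => ‖ST_L φ q δ p.1 g p.2‖ₑ ^ 2 * w p.2) :=
    ((ST_L_meas hφ hq δ hg.2.1).enorm.pow_const 2).mul (hw.comp measurable_snd)
  have hMi : ∀ i : Fin (m + 1), Measurable (fun p : ℝ × EuclideanSpace ℝ (Fin (m + 1)) =>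
      ‖δ * ⟪EuclideanSpace.single i (1:ℝ), p.2 - b⟫‖ₑ ^ (2 * (K + 1)) * ‖ST_L φ q δ p.1 g p.2‖ₑ ^ 2 * w p.2) := by
    intro i
    have hwt : Measurable (fun p : ℝ × EuclideanSpace ℝ (Fin (m + 1)) =>
        ‖δ * ⟪EuclideanSpace.single i (1:ℝ), p.2 - b⟫‖ₑ ^ (2 * (K + 1))) := by
      apply Measurable.pow_const
      apply Measurable.enorm
      fun_prop
    simp only [mul_assoc]
    exact hwt.mul hLm
  have hpt : ∀ t x, ENNReal.ofReal ((1 + δ * ‖x - b‖) ^ (2 * (K + 1))) * ‖ST_L φ q δ t g x‖ₑ ^ 2 * w x ≤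
      ENNReal.ofReal C' * (‖ST_L φ q δ t g x‖ₑ ^ 2 * w x + ∑ i, 
        ‖δ * ⟪EuclideanSpace.single i (1:ℝ), x - b⟫‖ₑ ^ (2 * (K + 1)) * ‖ST_L φ q δ t g x‖ₑ ^ 2 * w x) := by
    intro t x
    have h1 := hp (δ • (x - b))
    rw [norm_smul, Real.norm_of_nonneg hδ.le] at h1
    have h2 : ENNReal.ofReal ((1 + δ * ‖x - b‖) ^ (2 * (K + 1))) ≤ ENNReal.ofReal C' * (1 + ∑ i : Fin (m + 1), 
        ‖δ * ⟪EuclideanSpace.single i (1:ℝ), x - b⟫‖ₑ ^ (2 * (K + 1))) := by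
      refine (ENNReal.ofReal_le_ofReal h1).trans (le_of_eq ?_)
      rw [ENNReal.ofReal_mul hC'.le, ENNReal.ofReal_add (by norm_num) (by positivity),
        ENNReal.ofReal_sum_of_nonneg (by intros; positivity)]
      simp only [ENNReal.ofReal_one]
      congr 2
      apply Finset.sum_congr rfl
      intro i _
      rw [← ofReal_norm, ENNReal.ofReal_pow (abs_nonneg _), EuclideanSpace.inner_single_left]
      simp [Real.norm_eq_abs]
    rw [mul_assoc]
    refine (mul_le_mul_left h2 _).trans (le_of_eq ?_)
    simp only [mul_assoc]
    rw [← Finset.sum_mul]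
    ring
  have hIntg : ∀ {F : ℝ × EuclideanSpace ℝ (Fin (m + 1)) → ℝ≥0∞}, Measurable F →
      Measurable (fun t => ∫⁻ x, F (t, x)) := fun hF => hF.lintegral_prod_right'
  have hsl : ∀ {F : ℝ × EuclideanSpace ℝ (Fin (m + 1)) → ℝ≥0∞} (t : ℝ), Measurable F →
      Measurable (fun x => F (t, x)) := fun t hF => hF.comp measurable_prodMk_left
  calc _ ≤ ∫⁻ t in Set.Icc (1:ℝ) 2, ENNReal.ofReal C' * ((∫⁻ x, ‖ST_L φ q δ t g x‖ₑ ^ 2 * w x) + ∑ i, 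
        ∫⁻ x, ‖δ * ⟪EuclideanSpace.single i (1:ℝ), x - b⟫‖ₑ ^ (2 * (K + 1)) * ‖ST_L φ q δ t g x‖ₑ ^ 2 * w x) := by
        apply lintegral_mono
        intro t
        refine (lintegral_mono (hpt t)).trans (le_of_eq ?_)
        rw [lintegral_const_mul' _ _ (by simp), lintegral_add_left (hsl t hLm), lintegral_finsetSum]
        exact fun i _ => hsl t (hMi i)
    _ = ENNReal.ofReal C' * ((∫⁻ t in Set.Icc (1:ℝ) 2, ∫⁻ x, ‖ST_L φ q δ t g x‖ₑ ^ 2 * w x) + ∑ i, 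
        ∫⁻ t in Set.Icc (1:ℝ) 2, ∫⁻ x, ‖δ * ⟪EuclideanSpace.single i (1:ℝ), x - b⟫‖ₑ ^ (2 * (K + 1)) * ‖ST_L φ q δ t g x‖ₑ ^ 2 * w x) := by
        rw [lintegral_const_mul' _ _ (by simp), lintegral_add_left (hIntg hLm), lintegral_finsetSum]
        exact fun i _ => hIntg (hMi i)
    _ ≤ ENNReal.ofReal C' * (ENNReal.ofReal (C₀ * δ ^ 2) * (W * ∫⁻ x, ‖g x‖ₑ ^ 2) + ∑ i, 
        ENNReal.ofReal (C i * δ ^ 2) * (W * ∫⁻ x, ‖g x‖ₑ ^ 2)) := by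
        refine mul_le_mul_right (add_le_add (h₀ δ hδ hδ1 g hg w hw) (Finset.sum_le_sum fun i _ => ?_)) _
        exact hmom i δ hδ hδ1 b g hg hgs w hw
    _ = _ := by
        rw [← Finset.sum_mul, ← ENNReal.ofReal_sum_of_nonneg (by intro i _; have := hC i; positivity), ← add_mul,
          ← ENNReal.ofReal_add (by positivity) (Finset.sum_nonneg fun i _ => by have := (hC i).le; positivity), ← mul_assoc, ← ENNReal.ofReal_mul hC'.le,
          ← Finset.sum_mul]
        congr 2
        ring

theorem ST_cs {X : Type*} [MeasurableSpace X] (μ : Measure X) (f g : X → ℝ≥0∞)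
    (hf : AEMeasurable f μ) (hg : AEMeasurable g μ) :
    (∫⁻ x, f x * g x ∂μ) ^ 2 ≤ (∫⁻ x, f x ^ 2 ∂μ) * ∫⁻ x, g x ^ 2 ∂μ := by
  have h := ENNReal.lintegral_mul_le_Lp_mul_Lq μ Real.HolderConjugate.two_two hf hg
  have h2 := pow_le_pow_left₀ bot_le h 2
  refine h2.trans (le_of_eq ?_)
  rw [mul_pow, ← ENNReal.rpow_natCast, ← ENNReal.rpow_mul, ← ENNReal.rpow_natCast, ← ENNReal.rpow_mul]
  norm_num

/-- two-point maximal function -/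
noncomputable def ST_U (n : ℕ) (r : ℝ) (w : EuclideanSpace ℝ (Fin n) → ℝ≥0∞)
    (u y : EuclideanSpace ℝ (Fin n)) : ℝ≥0∞ :=
  ⨆ (c : EuclideanSpace ℝ (Fin n)) (ρ : ℝ) (_ : 0 < ρ) (_ : y ∈ Metric.ball c ρ)
    (_ : y + u ∈ Metric.ball c ρ),
    ((∫⁻ z in Metric.ball c ρ, w z ^ r) / volume (Metric.ball c ρ)) ^ (1 / r)

theorem ST_U_le {n : ℕ} {r : ℝ} {w : EuclideanSpace ℝ (Fin n) → ℝ≥0∞}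
    {u y c : EuclideanSpace ℝ (Fin n)} {ρ : ℝ} (hρ : 0 < ρ) (h1 : y ∈ Metric.ball c ρ)
    (h2 : y + u ∈ Metric.ball c ρ) :
    ((∫⁻ z in Metric.ball c ρ, w z ^ r) / volume (Metric.ball c ρ)) ^ (1 / r) ≤ ST_U n r w u y := by
  unfold ST_U
  refine le_iSup_of_le c (le_iSup_of_le ρ (le_iSup_of_le hρ (le_iSup_of_le h1 (le_iSup_of_le h2 le_rfl))))

theorem ST_U_meas (n : ℕ) (r : ℝ) (w : EuclideanSpace ℝ (Fin n) → ℝ≥0∞)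
    (u : EuclideanSpace ℝ (Fin n)) : Measurable (ST_U n r w u) := by
  apply measurable_of_Ioi
  intro a
  apply IsOpen.measurableSet
  rw [isOpen_iff_mem_nhds]
  intro y hy
  have hy' : a < ST_U n r w u y := hy
  unfold ST_U at hy'
  simp only [lt_iSup_iff] at hy'
  obtain ⟨c, ρ, hρ, h1, h2, h3⟩ := hy'
  have o1 : {y | y ∈ Metric.ball c ρ} ∈ 𝓝 y := Metric.isOpen_ball.mem_nhds h1
  have o2 : {y | y + u ∈ Metric.ball c ρ} ∈ 𝓝 y :=
    (Metric.isOpen_ball.preimage (continuous_id.add continuous_const)).mem_nhds h2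
  filter_upwards [o1, o2] with z hz1 hz2
  exact lt_of_lt_of_le h3 (ST_U_le hρ hz1 hz2)

theorem ST_vol_two {n : ℕ} (b : EuclideanSpace ℝ (Fin n)) (R : ℝ) (k : ℕ) :
    volume (Metric.ball b (2 ^ k * R)) = 2 ^ (k * n) * volume (Metric.ball (0 : EuclideanSpace ℝ (Fin n)) R) := by
  rw [Measure.addHaar_ball_mul_of_pos _ b (by positivity) R, Measure.addHaar_ball_center]
  congr 1
  rw [finrank_euclideanSpace_fin, ← pow_mul, ENNReal.ofReal_pow (by norm_num)]
  simp

theorem ST_vol_delta {n : ℕ} (b : EuclideanSpace ℝ (Fin n)) {R : ℝ} (hR : 0 < R) :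
    volume (Metric.ball b R) = ENNReal.ofReal (R ^ n) * volume (Metric.ball (0 : EuclideanSpace ℝ (Fin n)) 1) := by
  have := Measure.addHaar_ball_mul_of_pos volume b hR 1
  rw [mul_one] at this
  rw [this, finrank_euclideanSpace_fin]

/-- decaying weight -/
noncomputable def ST_A {n : ℕ} (δ : ℝ) (b x : EuclideanSpace ℝ (Fin n)) : ℝ≥0∞ :=
  ENNReal.ofReal (1 + δ * ‖x - b‖)

theorem ST_A_ge {n : ℕ} {δ : ℝ} (hδ : 0 < δ) (b x : EuclideanSpace ℝ (Fin n)) : 1 ≤ ST_A δ b x := by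
  unfold ST_A
  rw [ENNReal.one_le_ofReal]
  have := norm_nonneg (x - b)
  nlinarith [mul_nonneg hδ.le this]

theorem ST_A_fin {n : ℕ} (δ : ℝ) (b x : EuclideanSpace ℝ (Fin n)) : ST_A δ b x ≠ ∞ := ENNReal.ofReal_ne_top

theorem ST_A_symm {n : ℕ} (δ : ℝ) (b x : EuclideanSpace ℝ (Fin n)) : ST_A δ b x = ST_A δ x b := by
  unfold ST_A; rw [norm_sub_rev]

theorem ST_A_meas {n : ℕ} (δ : ℝ) :
    Measurable (fun p : EuclideanSpace ℝ (Fin n) × EuclideanSpace ℝ (Fin n) => ST_A δ p.1 p.2) := by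
  unfold ST_A
  apply ENNReal.measurable_ofReal.comp
  fun_prop

theorem ST_dyadic {n : ℕ} {δ : ℝ} (hδ : 0 < δ) (b : EuclideanSpace ℝ (Fin n))
    (H : EuclideanSpace ℝ (Fin n) → ℝ≥0∞) (hH : Measurable H) (B : ℝ≥0∞)
    (hB : ∀ k : ℕ, ∫⁻ x in Metric.ball b (2 ^ k * δ⁻¹), H x ≤
      B * (2 ^ (k * n) * volume (Metric.ball (0 : EuclideanSpace ℝ (Fin n)) δ⁻¹))) :
    ∫⁻ x, H x * (ST_A δ b x)⁻¹ ^ (n + 1) ≤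
      2 ^ (n + 2) * B * volume (Metric.ball (0 : EuclideanSpace ℝ (Fin n)) δ⁻¹) := by
  have hpt : ∀ x, H x * (ST_A δ b x)⁻¹ ^ (n + 1) ≤ ∑' k : ℕ, (2 ^ (n + 1) * (2⁻¹) ^ (k * (n + 1))) *
      (Metric.ball b (2 ^ k * δ⁻¹)).indicator H x := by
    intro x
    -- choose minimal k
    have hex : ∃ k : ℕ, δ * ‖x - b‖ < 2 ^ k := pow_unbounded_of_one_lt _ (by norm_num)
    classical
    set k := Nat.find hex with hk
    have hk1 : δ * ‖x - b‖ < 2 ^ k := Nat.find_spec hex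
    have hmem : x ∈ Metric.ball b (2 ^ k * δ⁻¹) := by
      rw [mem_ball_iff_norm, ← div_eq_mul_inv, lt_div_iff₀ hδ, mul_comm]; exact hk1
    refine le_trans ?_ (ENNReal.le_tsum k)
    rw [Set.indicator_of_mem hmem, mul_comm]
    gcongr
    have hA : 2 ^ k ≤ 2 * ST_A δ b x := by
      rcases Nat.eq_zero_or_pos k with h0 | h0
      · rw [h0, pow_zero]
        calc (1:ℝ≥0∞) ≤ ST_A δ b x := ST_A_ge hδ b x
          _ ≤ 2 * ST_A δ b x := by
            rw [two_mul]; exact le_add_self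
      · obtain ⟨j, hj⟩ : ∃ j, k = j + 1 := ⟨k - 1, by omega⟩
        have h2 : ¬ (δ * ‖x - b‖ < 2 ^ j) := Nat.find_min hex (by omega)
        push Not at h2
        rw [hj, pow_succ, mul_comm]
        gcongr
        unfold ST_A
        rw [show (2:ℝ≥0∞) ^ j = ENNReal.ofReal (2 ^ j) by rw [ENNReal.ofReal_pow (by norm_num)]; simp]
        apply ENNReal.ofReal_le_ofReal
        linarith
    have h3 : (ST_A δ b x)⁻¹ ≤ 2 * (2⁻¹) ^ k := by
      rw [ENNReal.inv_le_iff_inv_le, ENNReal.mul_inv (by simp) (by simp), ENNReal.inv_pow, inv_inv]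
      calc (2:ℝ≥0∞)⁻¹ * 2 ^ k ≤ 2⁻¹ * (2 * ST_A δ b x) := by gcongr
        _ = ST_A δ b x := by rw [← mul_assoc, ENNReal.inv_mul_cancel (by simp) (by simp), one_mul]
    calc (ST_A δ b x)⁻¹ ^ (n + 1) ≤ (2 * (2⁻¹) ^ k) ^ (n + 1) := pow_le_pow_left₀ bot_le h3 _
      _ = _ := by rw [mul_pow, ← pow_mul]
  calc _ ≤ ∫⁻ x, ∑' k : ℕ, (2 ^ (n + 1) * (2⁻¹) ^ (k * (n + 1))) *
      (Metric.ball b (2 ^ k * δ⁻¹)).indicator H x := lintegral_mono hpt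
    _ = ∑' k : ℕ, (2 ^ (n + 1) * (2⁻¹) ^ (k * (n + 1))) * ∫⁻ x in Metric.ball b (2 ^ k * δ⁻¹), H x := by
        rw [lintegral_tsum (fun k => ((hH.indicator measurableSet_ball).const_mul _).aemeasurable)]
        congr 1; ext k
        rw [lintegral_const_mul _ (hH.indicator measurableSet_ball), lintegral_indicator measurableSet_ball]
    _ ≤ ∑' k : ℕ, (2 ^ (n + 1) * (2⁻¹) ^ (k * (n + 1))) *
        (B * (2 ^ (k * n) * volume (Metric.ball (0 : EuclideanSpace ℝ (Fin n)) δ⁻¹))) := by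
        gcongr with k; exact hB k
    _ = ∑' k : ℕ, (2 ^ (n + 1) * B * volume (Metric.ball (0 : EuclideanSpace ℝ (Fin n)) δ⁻¹)) * 2⁻¹ ^ k := by
        congr 1; ext k
        have : (2⁻¹ : ℝ≥0∞) ^ (k * (n + 1)) * 2 ^ (k * n) = 2⁻¹ ^ k := by
          rw [mul_add, mul_one, pow_add, mul_comm (_ ^ (k * n)), mul_assoc, ← mul_pow,
            ENNReal.inv_mul_cancel (by simp) (by simp), one_pow, mul_one]
        rw [← this]; ring
    _ = _ := by
        rw [ENNReal.tsum_mul_left, ENNReal.tsum_geometric, ENNReal.one_sub_inv_two, inv_inv]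
        ring

theorem ST_W_le {n : ℕ} {δ r : ℝ} (hδ : 0 < δ) (hδ1 : δ ≤ 1) (hr : 1 ≤ r)
    (w : EuclideanSpace ℝ (Fin n) → ℝ≥0∞) (hw : Measurable w)
    (u b y : EuclideanSpace ℝ (Fin n)) (hu : ‖u‖ ≤ 1) (hy : y ∈ Metric.ball b δ⁻¹) :
    (∫⁻ x, (w x * (ST_A δ b x)⁻¹ ^ (n + 1)) ^ r) ^ (1 / r) ≤
      (2 ^ (2 * n + 2) * volume (Metric.ball (0 : EuclideanSpace ℝ (Fin n)) δ⁻¹)) ^ (1 / r) * ST_U n r w u y := by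
  have hr0 : 0 < r := by linarith
  set V := volume (Metric.ball (0 : EuclideanSpace ℝ (Fin n)) δ⁻¹) with hV
  have hR : 1 ≤ δ⁻¹ := (one_le_inv₀ hδ).2 hδ1
  have hk : ∀ k : ℕ, ∫⁻ x in Metric.ball b (2 ^ k * δ⁻¹), w x ^ r ≤
      (2 ^ n * ST_U n r w u y ^ r) * (2 ^ (k * n) * V) := by
    intro k
    have h2k : (1:ℝ) ≤ 2 ^ k := one_le_pow₀ (by norm_num)
    have hρ : (0:ℝ) < 2 ^ (k + 1) * δ⁻¹ := by positivity
    have hsub : Metric.ball b (2 ^ k * δ⁻¹) ⊆ Metric.ball b (2 ^ (k + 1) * δ⁻¹) := by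
      apply Metric.ball_subset_ball
      rw [pow_succ]; nlinarith [mul_pos (lt_of_lt_of_le one_pos h2k) (lt_of_lt_of_le one_pos hR)]
    rw [mem_ball_iff_norm] at hy
    have h1 : y ∈ Metric.ball b (2 ^ (k + 1) * δ⁻¹) := by
      rw [mem_ball_iff_norm, pow_succ]; nlinarith
    have h2 : y + u ∈ Metric.ball b (2 ^ (k + 1) * δ⁻¹) := by
      rw [mem_ball_iff_norm, pow_succ, show y + u - b = (y - b) + u by abel]
      have := norm_add_le (y - b) u
      nlinarith
    have h3 := ST_U_le (r := r) (w := w) hρ h1 h2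
    have hv0 : volume (Metric.ball b (2 ^ (k + 1) * δ⁻¹)) ≠ 0 := (Metric.measure_ball_pos _ _ hρ).ne'
    have hv1 : volume (Metric.ball b (2 ^ (k + 1) * δ⁻¹)) ≠ ∞ := measure_ball_lt_top.ne
    have h4 := ENNReal.rpow_le_rpow h3 hr0.le
    rw [← ENNReal.rpow_mul, one_div, inv_mul_cancel₀ hr0.ne', ENNReal.rpow_one,
      ENNReal.div_le_iff hv0 hv1, ST_vol_two] at h4
    refine (lintegral_mono_set hsub).trans (h4.trans (le_of_eq ?_))
    rw [add_mul, pow_add]; ring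
  have h := ST_dyadic hδ b (fun x => w x ^ r) (hw.pow_const r) _ hk
  have h5 : ∫⁻ x, (w x * (ST_A δ b x)⁻¹ ^ (n + 1)) ^ r ≤ (2 ^ (2 * n + 2) * V) * ST_U n r w u y ^ r := by
    refine (lintegral_mono fun x => ?_).trans (h.trans (le_of_eq ?_))
    · rw [ENNReal.mul_rpow_of_nonneg _ _ hr0.le]
      gcongr
      have h6 : (ST_A δ b x)⁻¹ ^ (n + 1) ≤ 1 := pow_le_one₀ bot_le (ENNReal.inv_le_one.2 (ST_A_ge hδ b x))
      calc _ ≤ ((ST_A δ b x)⁻¹ ^ (n + 1)) ^ (1:ℝ) := ENNReal.rpow_le_rpow_of_exponent_ge h6 hr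
        _ = _ := ENNReal.rpow_one _
    · ring
  calc _ ≤ ((2 ^ (2 * n + 2) * V) * ST_U n r w u y ^ r) ^ (1 / r) := ENNReal.rpow_le_rpow h5 (by positivity)
    _ = _ := by
      rw [ENNReal.mul_rpow_of_nonneg _ _ (by positivity), ← ENNReal.rpow_mul, mul_one_div_cancel hr0.ne',
        ENNReal.rpow_one]

/-- the truncation of `g` to a ball -/
noncomputable def ST_g {n : ℕ} (R : ℝ) (g : EuclideanSpace ℝ (Fin n) → ℂ) (b : EuclideanSpace ℝ (Fin n)) :
    EuclideanSpace ℝ (Fin n) → ℂ := (Metric.ball b R).indicator g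

theorem ST_g_joint {n : ℕ} (R : ℝ) {g : EuclideanSpace ℝ (Fin n) → ℂ} (hg : Measurable g) :
    Measurable (fun p : EuclideanSpace ℝ (Fin n) × EuclideanSpace ℝ (Fin n) => ST_g R g p.1 p.2) := by
  have hs : MeasurableSet {p : EuclideanSpace ℝ (Fin n) × EuclideanSpace ℝ (Fin n) | dist p.2 p.1 < R} :=
    measurableSet_lt (f := fun p : EuclideanSpace ℝ (Fin n) × EuclideanSpace ℝ (Fin n) => dist p.2 p.1)
      (g := fun _ => R) (by fun_prop) (by fun_prop)
  exact (hg.comp measurable_snd).indicator hs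

theorem ST_g_nice {n : ℕ} (R : ℝ) {g : EuclideanSpace ℝ (Fin n) → ℂ} (hg : ST_nice volume g)
    (b : EuclideanSpace ℝ (Fin n)) : ST_nice volume (ST_g R g b) :=
  ST_nice_indicator hg measurableSet_ball

theorem ST_kernel_meas {n : ℕ} {φ : ℝ → ℝ} {q : EuclideanSpace ℝ (Fin n) → ℂ} (hφ : ST_phi φ) (hq : ST_q q)
    (δ : ℝ) : Measurable (fun p : ℝ × EuclideanSpace ℝ (Fin n) => 𝓕⁻ (ST_M φ q δ p.1) p.2) := by
  have h1 := ST_M_meas hφ hq δ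
  have h0 : Measurable (fun p : (ℝ × EuclideanSpace ℝ (Fin n)) × EuclideanSpace ℝ (Fin n) =>
    (p.1.1, p.2)) := by fun_prop
  have h3 := h1.comp h0
  simp only [Function.comp_def] at h3
  have h4 : Measurable (fun p : (ℝ × EuclideanSpace ℝ (Fin n)) × EuclideanSpace ℝ (Fin n) =>
      Complex.exp (((2 * Real.pi * ⟪p.2, p.1.2⟫ : ℝ) : ℂ) * Complex.I)) := by
    apply Continuous.measurable
    fun_prop
  have h6 := (StronglyMeasurable.integral_prod_right' (ν := volume) (h4.mul h3).stronglyMeasurable).measurable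
  have e : (fun p : ℝ × EuclideanSpace ℝ (Fin n) => 𝓕⁻ (ST_M φ q δ p.1) p.2) = fun p =>
      ∫ ξ, Complex.exp (((2 * Real.pi * ⟪ξ, p.2⟫ : ℝ) : ℂ) * Complex.I) * ST_M φ q δ p.1 ξ := by
    ext p
    rw [Real.fourierInv_eq']
    rfl
  rw [e]
  exact h6

theorem ST_Lg_meas {n : ℕ} {φ : ℝ → ℝ} {q : EuclideanSpace ℝ (Fin n) → ℂ} (hφ : ST_phi φ) (hq : ST_q q)
    (δ R : ℝ) {g : EuclideanSpace ℝ (Fin n) → ℂ} (hg : ST_nice volume g) :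
    Measurable (fun p : (ℝ × EuclideanSpace ℝ (Fin n)) × EuclideanSpace ℝ (Fin n) =>
      ST_L φ q δ p.1.1 (ST_g R g p.2) p.1.2) := by
  have h1 := ST_kernel_meas hφ hq δ
  have h0 : Measurable (fun p : ((ℝ × EuclideanSpace ℝ (Fin n)) × EuclideanSpace ℝ (Fin n)) × EuclideanSpace ℝ (Fin n) =>
    (p.1.1.1, p.1.1.2 - p.2)) := by fun_prop
  have h3 := h1.comp h0
  simp only [Function.comp_def] at h3
  have h2 := ST_g_joint R hg.1
  have h0' : Measurable (fun p : ((ℝ × EuclideanSpace ℝ (Fin n)) × EuclideanSpace ℝ (Fin n)) × EuclideanSpace ℝ (Fin n) =>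
    (p.1.2, p.2)) := by fun_prop
  have h4 := h2.comp h0'
  simp only [Function.comp_def] at h4
  have h6 := (StronglyMeasurable.integral_prod_right' (ν := volume) (h3.mul h4).stronglyMeasurable).measurable
  have e : (fun p : (ℝ × EuclideanSpace ℝ (Fin n)) × EuclideanSpace ℝ (Fin n) =>
      ST_L φ q δ p.1.1 (ST_g R g p.2) p.1.2) = fun p =>
      ∫ y, 𝓕⁻ (ST_M φ q δ p.1.1) (p.1.2 - y) * ST_g R g p.2 y := by
    ext p
    exact ST_conv _ _ (ST_M_int hφ hq δ _) (ST_g_nice R hg _).2.1 _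
  rw [e]
  exact h6

theorem ST_repro {n : ℕ} {φ : ℝ → ℝ} {q : EuclideanSpace ℝ (Fin n) → ℂ} (hφ : ST_phi φ) (hq : ST_q q)
    (δ t R : ℝ) {g : EuclideanSpace ℝ (Fin n) → ℂ} (hg : ST_nice volume g) (x : EuclideanSpace ℝ (Fin n)) :
    volume (Metric.ball (0 : EuclideanSpace ℝ (Fin n)) R) * ‖ST_L φ q δ t g x‖ₑ ≤
      ∫⁻ b, ‖ST_L φ q δ t (ST_g R g b) x‖ₑ := by
  set k := 𝓕⁻ (ST_M φ q δ t) with hk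
  have hI := ST_M_int hφ hq δ t
  have hkc : Continuous k := ST_fourierInv_continuous hI
  have hkb : ∀ z, ‖k z‖ ≤ ∫ ξ, ‖ST_M φ q δ t ξ‖ := ST_norm_fourierInv_le _
  have hkg : Integrable (fun y => k (x - y) * g y) := by
    refine hg.2.1.bdd_mul (c := ∫ ξ, ‖ST_M φ q δ t ξ‖) ?_ ?_
    · exact (hkc.comp (continuous_const.sub continuous_id)).aestronglyMeasurable
    · exact Eventually.of_forall fun y => hkb _
  have hL : ∀ b, ST_L φ q δ t (ST_g R g b) x = ∫ y, (Metric.ball y R).indicator (fun _ => k (x - y) * g y) b := by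
    intro b
    refine (ST_conv _ _ hI (ST_g_nice R hg b).2.1 x).trans ?_
    congr 1; ext y
    unfold ST_g
    by_cases h : y ∈ Metric.ball b R
    · rw [Set.indicator_of_mem h, Set.indicator_of_mem (Metric.mem_ball_comm.1 h)]
    · rw [Set.indicator_of_notMem h, Set.indicator_of_notMem (fun h' => h (Metric.mem_ball_comm.1 h')), mul_zero]
  have hmeas : Measurable (fun p : EuclideanSpace ℝ (Fin n) × EuclideanSpace ℝ (Fin n) =>
      (Metric.ball p.2 R).indicator (fun _ => k (x - p.2) * g p.2) p.1) := by
    have hs : MeasurableSet {p : EuclideanSpace ℝ (Fin n) × EuclideanSpace ℝ (Fin n) | dist p.1 p.2 < R} :=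
      measurableSet_lt (f := fun p : EuclideanSpace ℝ (Fin n) × EuclideanSpace ℝ (Fin n) => dist p.1 p.2)
        (g := fun _ => R) (by fun_prop) (by fun_prop)
    have h1 : Measurable (fun p : EuclideanSpace ℝ (Fin n) × EuclideanSpace ℝ (Fin n) => k (x - p.2) * g p.2) :=
      (hkc.measurable.comp (measurable_const.sub measurable_snd)).mul (hg.1.comp measurable_snd)
    exact h1.indicator hs
  have hvol : ∀ y : EuclideanSpace ℝ (Fin n), volume (Metric.ball y R) = volume (Metric.ball (0 : EuclideanSpace ℝ (Fin n)) R) :=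
    fun y => Measure.addHaar_ball_center _ _ _
  have hIntg : Integrable (fun p : EuclideanSpace ℝ (Fin n) × EuclideanSpace ℝ (Fin n) =>
      (Metric.ball p.2 R).indicator (fun _ => k (x - p.2) * g p.2) p.1) (volume.prod volume) := by
    rw [integrable_prod_iff' hmeas.aestronglyMeasurable]
    constructor
    · refine Eventually.of_forall fun y => ?_
      dsimp only
      rw [integrable_indicator_iff measurableSet_ball]
      exact integrableOn_const measure_ball_lt_top.ne
    · have : (fun y => ∫ b, ‖(Metric.ball y R).indicator (fun _ => k (x - y) * g y) b‖) =
          fun y => (volume (Metric.ball (0 : EuclideanSpace ℝ (Fin n)) R)).toReal * ‖k (x - y) * g y‖ := by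
        ext y
        simp only [norm_indicator_eq_indicator_norm]
        rw [integral_indicator measurableSet_ball, setIntegral_const, measureReal_def, hvol, smul_eq_mul]
      dsimp only
      rw [this]
      exact hkg.norm.const_mul _
  have hswap : ∫ b, ST_L φ q δ t (ST_g R g b) x =
      ((volume (Metric.ball (0 : EuclideanSpace ℝ (Fin n)) R)).toReal : ℂ) * ST_L φ q δ t g x := by
    simp only [hL]
    rw [integral_integral_swap hIntg]
    have : ST_L φ q δ t g x = ∫ y, k (x - y) * g y := ST_conv _ _ hI hg.2.1 x
    rw [this, ← integral_const_mul]
    congr 1; ext y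
    rw [integral_indicator measurableSet_ball, setIntegral_const, measureReal_def, hvol, Complex.real_smul]
  have h := enorm_integral_le_lintegral_enorm (μ := volume) (fun b => ST_L φ q δ t (ST_g R g b) x)
  rw [hswap, enorm_mul] at h
  convert h using 2
  rw [← ofReal_norm, Complex.norm_real, Real.norm_of_nonneg ENNReal.toReal_nonneg,
    ENNReal.ofReal_toReal measure_ball_lt_top.ne]

theorem ST_swap3 {X Y Z : Type*} [MeasurableSpace X] [MeasurableSpace Y] [MeasurableSpace Z]
    (μ : Measure X) (ν : Measure Y) (τ : Measure Z) [SFinite μ] [SFinite ν] [SFinite τ]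
    (G : X × Y → Z → ℝ≥0∞) (hGm : Measurable (Function.uncurry G)) :
    ∫⁻ t, ∫⁻ x, ∫⁻ b, G (t, x) b ∂τ ∂ν ∂μ = ∫⁻ b, ∫⁻ t, ∫⁻ x, G (t, x) b ∂ν ∂μ ∂τ := by
  have h1 : Measurable (fun p : X × Y => ∫⁻ b, G p b ∂τ) := hGm.lintegral_prod_right'
  rw [lintegral_lintegral (f := fun t x => ∫⁻ b, G (t, x) b ∂τ) h1.aemeasurable]
  rw [lintegral_lintegral_swap (f := fun (p : X × Y) (b : Z) => G (p.1, p.2) b) (by exact hGm.aemeasurable)]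
  congr 1; ext b
  have h2 : Measurable (fun p : X × Y => G p b) := hGm.comp measurable_prodMk_right
  rw [lintegral_lintegral (f := fun t x => G (t, x) b) h2.aemeasurable]

theorem ST_A_meas_l {n : ℕ} (δ : ℝ) (x : EuclideanSpace ℝ (Fin n)) : Measurable (fun b => ST_A δ b x) := by
  unfold ST_A
  apply ENNReal.measurable_ofReal.comp
  fun_prop

theorem ST_A_meas_r {n : ℕ} (δ : ℝ) (b : EuclideanSpace ℝ (Fin n)) : Measurable (fun x => ST_A δ b x) := by
  unfold ST_A
  apply ENNReal.measurable_ofReal.comp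
  fun_prop

theorem ST_Lg_meas_b {n : ℕ} {φ : ℝ → ℝ} {q : EuclideanSpace ℝ (Fin n) → ℂ} (hφ : ST_phi φ) (hq : ST_q q)
    (δ R : ℝ) {g : EuclideanSpace ℝ (Fin n) → ℂ} (hg : ST_nice volume g) (t : ℝ) (x : EuclideanSpace ℝ (Fin n)) :
    Measurable (fun b => ST_L φ q δ t (ST_g R g b) x) := by
  have h0 : Measurable (fun b : EuclideanSpace ℝ (Fin n) => ((t, x), b)) := by fun_prop
  have h := (ST_Lg_meas hφ hq δ R hg).comp h0
  simp only [Function.comp_def] at h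
  exact h

set_option maxHeartbeats 1000000 in
theorem ST_L_cs {n : ℕ} {φ : ℝ → ℝ} {q : EuclideanSpace ℝ (Fin n) → ℂ} (hφ : ST_phi φ) (hq : ST_q q)
    {δ : ℝ} (hδ : 0 < δ) (t : ℝ) {g : EuclideanSpace ℝ (Fin n) → ℂ} (hg : ST_nice volume g) (x : EuclideanSpace ℝ (Fin n)) :
    ‖ST_L φ q δ t g x‖ₑ ^ 2 ≤ 2 ^ (n + 2) * (volume (Metric.ball (0 : EuclideanSpace ℝ (Fin n)) δ⁻¹))⁻¹ *
      ∫⁻ b, (ST_A δ b x ^ (n + 1) * ‖ST_L φ q δ t (ST_g δ⁻¹ g b) x‖ₑ) ^ 2 := by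
  set V := volume (Metric.ball (0 : EuclideanSpace ℝ (Fin n)) δ⁻¹) with hV
  have hV0 : V ≠ 0 := (Metric.measure_ball_pos _ _ (by positivity)).ne'
  have hV1 : V ≠ ∞ := measure_ball_lt_top.ne
  have h1 := ST_repro hφ hq δ t δ⁻¹ hg x
  rw [← hV] at h1
  have hAm : Measurable (fun b => ST_A δ b x) := ST_A_meas_l δ x
  have hLm : Measurable (fun b => ST_L φ q δ t (ST_g δ⁻¹ g b) x) :=
    ST_Lg_meas_b hφ hq δ δ⁻¹ hg t x
  have hA0 : ∀ b, ST_A δ b x ≠ 0 := fun b => (lt_of_lt_of_le one_pos (ST_A_ge hδ b x)).ne'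
  have h2 : ∫⁻ b, ‖ST_L φ q δ t (ST_g δ⁻¹ g b) x‖ₑ =
      ∫⁻ b, (ST_A δ b x)⁻¹ ^ (n + 1) * (ST_A δ b x ^ (n + 1) * ‖ST_L φ q δ t (ST_g δ⁻¹ g b) x‖ₑ) := by
    congr 1; ext b
    rw [← mul_assoc, ← mul_pow, ENNReal.inv_mul_cancel (hA0 b) (ST_A_fin _ _ _), one_pow, one_mul]
  have h3 := ST_cs volume (fun b => (ST_A δ b x)⁻¹ ^ (n + 1))
    (fun b => ST_A δ b x ^ (n + 1) * ‖ST_L φ q δ t (ST_g δ⁻¹ g b) x‖ₑ)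
    (hAm.inv.pow_const _).aemeasurable ((hAm.pow_const _).mul hLm.enorm).aemeasurable
  have h4 : ∫⁻ b, ((ST_A δ b x)⁻¹ ^ (n + 1)) ^ 2 ≤ 2 ^ (n + 2) * V := by
    have h5 := ST_dyadic hδ x (fun _ => (1:ℝ≥0∞)) measurable_const 1 (by
      intro k
      rw [one_mul, setLIntegral_const, one_mul, ST_vol_two])
    rw [mul_one] at h5
    refine (lintegral_mono fun b => ?_).trans h5
    rw [ST_A_symm, one_mul]
    have h6 : (ST_A δ x b)⁻¹ ^ (n + 1) ≤ 1 := pow_le_one₀ bot_le (ENNReal.inv_le_one.2 (ST_A_ge hδ x b))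
    exact pow_le_of_le_one bot_le h6 (by norm_num)
  have h7 : V ^ 2 * ‖ST_L φ q δ t g x‖ₑ ^ 2 ≤ 2 ^ (n + 2) * V *
      ∫⁻ b, (ST_A δ b x ^ (n + 1) * ‖ST_L φ q δ t (ST_g δ⁻¹ g b) x‖ₑ) ^ 2 := by
    rw [← mul_pow]
    refine (pow_le_pow_left₀ bot_le h1 2).trans ?_
    rw [h2]
    refine h3.trans ?_
    gcongr
  calc ‖ST_L φ q δ t g x‖ₑ ^ 2 = (V⁻¹ * V) * (V⁻¹ * V) * ‖ST_L φ q δ t g x‖ₑ ^ 2 := by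
        rw [ENNReal.inv_mul_cancel hV0 hV1, one_mul, one_mul]
    _ = V⁻¹ * V⁻¹ * (V ^ 2 * ‖ST_L φ q δ t g x‖ₑ ^ 2) := by ring
    _ ≤ V⁻¹ * V⁻¹ * (2 ^ (n + 2) * V *
      ∫⁻ b, (ST_A δ b x ^ (n + 1) * ‖ST_L φ q δ t (ST_g δ⁻¹ g b) x‖ₑ) ^ 2) := by gcongr
    _ = (V⁻¹ * V) * (2 ^ (n + 2) * V⁻¹ *
      ∫⁻ b, (ST_A δ b x ^ (n + 1) * ‖ST_L φ q δ t (ST_g δ⁻¹ g b) x‖ₑ) ^ 2) := by ring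
    _ = _ := by rw [ENNReal.inv_mul_cancel hV0 hV1, one_mul]

set_option maxHeartbeats 1000000 in
theorem ST_local_aux (n : ℕ) (r : ℝ) (hr1 : 1 ≤ r) (N : ℕ) (hN : 3 * (n + 1) ≤ N) (C : ℝ) (hC : 0 < C) (φ : ℝ → ℝ) (hφ : ST_phi φ)
    (q : EuclideanSpace ℝ (Fin n) → ℂ) (hq : ST_q q)
    (hmom : ∀ δ : ℝ, 0 < δ → δ ≤ 1 → ∀ b g, ST_nice volume g →
      (∀ y, g y ≠ 0 → ‖y - b‖ ≤ δ⁻¹) →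
      ∀ w : EuclideanSpace ℝ (Fin n) → ℝ≥0∞, Measurable w →
      ∫⁻ t in Set.Icc (1:ℝ) 2, ∫⁻ x, ENNReal.ofReal ((1 + δ * ‖x - b‖) ^ N) *
        ‖ST_L φ q δ t g x‖ₑ ^ 2 * w x ≤
      ENNReal.ofReal (C * δ ^ 2) *
        ((∫⁻ x, w x ^ r) ^ (1 / r) * ∫⁻ x, ‖g x‖ₑ ^ 2))
    (v₁ : ℝ) (hv₁ : v₁ = (volume (Metric.ball (0 : EuclideanSpace ℝ (Fin n)) 1)).toReal)
    (δ : ℝ) (hδ : 0 < δ) (hδ1 : δ ≤ 1) (g : EuclideanSpace ℝ (Fin n) → ℂ) (hg : ST_nice volume g)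
    (w : EuclideanSpace ℝ (Fin n) → ℝ≥0∞) (hw : Measurable w) (u : EuclideanSpace ℝ (Fin n)) (hu : ‖u‖ ≤ 1) :
    ∫⁻ t in Set.Icc (1:ℝ) 2, ∫⁻ x, ‖ST_L φ q δ t g x‖ₑ ^ 2 * w x ≤
      ENNReal.ofReal ((2 ^ (n + 2) * C * (2 ^ (2 * n + 2) * v₁) ^ (1 / r)) * (δ ^ 2 * δ ^ (-(n:ℝ) / r))) *
        ∫⁻ y, ‖g y‖ₑ ^ 2 * ST_U n r w u y := by
  set V := volume (Metric.ball (0 : EuclideanSpace ℝ (Fin n)) δ⁻¹) with hV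
  have hV0 : V ≠ 0 := (Metric.measure_ball_pos _ _ (by positivity)).ne'
  have hV1 : V ≠ ∞ := measure_ball_lt_top.ne
  set w' : EuclideanSpace ℝ (Fin n) → EuclideanSpace ℝ (Fin n) → ℝ≥0∞ :=
    fun b x => w x * (ST_A δ b x)⁻¹ ^ (n + 1) with hw'
  have hw'm : ∀ b, Measurable (w' b) := fun b => hw.mul
    ((ST_A_meas_r δ b).inv.pow_const _)
  set G : (ℝ × EuclideanSpace ℝ (Fin n)) → EuclideanSpace ℝ (Fin n) → ℝ≥0∞ := fun p b =>
    ENNReal.ofReal ((1 + δ * ‖p.2 - b‖) ^ N) *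
        ‖ST_L φ q δ p.1 (ST_g δ⁻¹ g b) p.2‖ₑ ^ 2 * w' b p.2 with hG
  have hGm : Measurable (Function.uncurry G) := by
    have h0 : Measurable (fun p : (ℝ × EuclideanSpace ℝ (Fin n)) × EuclideanSpace ℝ (Fin n) =>
      (p.2, p.1.2)) := by fun_prop
    have h1 := (ST_A_meas δ).comp h0
    simp only [Function.comp_def] at h1
    have h2 : Measurable (fun p : (ℝ × EuclideanSpace ℝ (Fin n)) × EuclideanSpace ℝ (Fin n) =>
      ENNReal.ofReal ((1 + δ * ‖p.1.2 - p.2‖) ^ N)) := by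
      apply ENNReal.measurable_ofReal.comp
      fun_prop
    have h3 : Measurable (fun p : (ℝ × EuclideanSpace ℝ (Fin n)) × EuclideanSpace ℝ (Fin n) => w p.1.2) :=
      hw.comp (measurable_snd.comp measurable_fst)
    exact (h2.mul ((ST_Lg_meas hφ hq δ δ⁻¹ hg).enorm.pow_const 2)).mul (h3.mul (h1.inv.pow_const _))
  have hA0 : ∀ b x : EuclideanSpace ℝ (Fin n), ST_A δ b x ≠ 0 :=
    fun b x => (lt_of_lt_of_le one_pos (ST_A_ge hδ b x)).ne'
  have hpt : ∀ t x, ‖ST_L φ q δ t g x‖ₑ ^ 2 * w x ≤ 2 ^ (n + 2) * V⁻¹ * ∫⁻ b, G (t, x) b := by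
    intro t x
    refine (mul_le_mul_left (ST_L_cs hφ hq hδ t hg x) _).trans ?_
    rw [mul_assoc]
    refine mul_le_mul_right ?_ _
    have hAm : Measurable (fun b => ST_A δ b x) := ST_A_meas_l δ x
    have hLm : Measurable (fun b => ST_L φ q δ t (ST_g δ⁻¹ g b) x) :=
      ST_Lg_meas_b hφ hq δ δ⁻¹ hg t x
    rw [← lintegral_mul_const _ (by exact ((hAm.pow_const _).mul hLm.enorm).pow_const 2)]
    apply lintegral_mono
    intro b
    rw [hG, hw']
    dsimp only
    rw [ENNReal.ofReal_pow (by positivity)]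
    have e : ENNReal.ofReal (1 + δ * ‖x - b‖) = ST_A δ b x := rfl
    rw [e]
    have e2 : (ST_A δ b x ^ (n + 1) * ‖ST_L φ q δ t (ST_g δ⁻¹ g b) x‖ₑ) ^ 2 * w x =
        ST_A δ b x ^ (3 * (n + 1)) * ‖ST_L φ q δ t (ST_g δ⁻¹ g b) x‖ₑ ^ 2 * (w x * (ST_A δ b x)⁻¹ ^ (n + 1)) := by
      have : ST_A δ b x ^ (n + 1) * (ST_A δ b x)⁻¹ ^ (n + 1) = 1 := by
        rw [← mul_pow, ENNReal.mul_inv_cancel (hA0 b x) (ST_A_fin _ _ _), one_pow]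
      calc _ = (ST_A δ b x ^ (n + 1)) ^ 2 * ‖ST_L φ q δ t (ST_g δ⁻¹ g b) x‖ₑ ^ 2 * w x * 1 := by ring
        _ = _ := by rw [← this]; ring
    rw [e2]
    gcongr
    exact ST_A_ge hδ b x
  have hWb : ∀ b, (∫⁻ x, w' b x ^ r) ^ (1 / r) * ∫⁻ y, ‖ST_g δ⁻¹ g b y‖ₑ ^ 2 ≤
      (2 ^ (2 * n + 2) * V) ^ (1 / r) * ∫⁻ y, ‖ST_g δ⁻¹ g b y‖ₑ ^ 2 * ST_U n r w u y := by
    intro b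
    have hgb : Measurable (fun y => ‖ST_g δ⁻¹ g b y‖ₑ ^ 2) := (ST_g_nice δ⁻¹ hg b).1.enorm.pow_const 2
    rw [← lintegral_const_mul _ hgb, ← lintegral_const_mul _ (by exact hgb.mul (ST_U_meas n r w u))]
    apply lintegral_mono
    intro y
    dsimp only
    by_cases hy : y ∈ Metric.ball b δ⁻¹
    · have := ST_W_le hδ hδ1 hr1 w hw u b y hu hy
      refine (mul_le_mul_left this _).trans (le_of_eq ?_)
      ring
    · have : ST_g δ⁻¹ g b y = 0 := Set.indicator_of_notMem hy _
      simp [this]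
  have hb : ∀ b, ∫⁻ t in Set.Icc (1:ℝ) 2, ∫⁻ x, G (t, x) b ≤ ENNReal.ofReal (C * δ ^ 2) * 
      ((2 ^ (2 * n + 2) * V) ^ (1 / r) * ∫⁻ y, ‖ST_g δ⁻¹ g b y‖ₑ ^ 2 * ST_U n r w u y) := by
    intro b
    refine (hmom δ hδ hδ1 b (ST_g δ⁻¹ g b) (ST_g_nice δ⁻¹ hg b) ?_ (w' b) (hw'm b)).trans ?_
    · intro y hy
      have : y ∈ Metric.ball b δ⁻¹ := Set.mem_of_indicator_ne_zero hy
      rw [mem_ball_iff_norm] at this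
      exact this.le
    · exact mul_le_mul_right (hWb b) _
  have hswap : ∫⁻ t in Set.Icc (1:ℝ) 2, ∫⁻ x, ∫⁻ b, G (t, x) b = ∫⁻ b, ∫⁻ t in Set.Icc (1:ℝ) 2, ∫⁻ x, G (t, x) b := ST_swap3 (volume.restrict (Set.Icc (1:ℝ) 2)) volume volume G hGm
  have hfin : ∫⁻ b, ∫⁻ y, ‖ST_g δ⁻¹ g b y‖ₑ ^ 2 * ST_U n r w u y = V * ∫⁻ y, ‖g y‖ₑ ^ 2 * ST_U n r w u y := by
    rw [lintegral_lintegral_swap]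
    · rw [← lintegral_const_mul _ (by exact (hg.1.enorm.pow_const 2).mul (ST_U_meas n r w u))]
      congr 1; ext y
      have : ∀ b, ‖ST_g δ⁻¹ g b y‖ₑ ^ 2 * ST_U n r w u y =
          (Metric.ball y δ⁻¹).indicator (fun _ => ‖g y‖ₑ ^ 2 * ST_U n r w u y) b := by
        intro b
        unfold ST_g
        by_cases h : y ∈ Metric.ball b δ⁻¹
        · rw [Set.indicator_of_mem h, Set.indicator_of_mem (Metric.mem_ball_comm.1 h)]
        · rw [Set.indicator_of_notMem h, Set.indicator_of_notMem (fun h' => h (Metric.mem_ball_comm.1 h'))]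
          simp
      simp only [this]
      rw [lintegral_indicator measurableSet_ball, setLIntegral_const, Measure.addHaar_ball_center, mul_comm]
    · exact (((ST_g_joint δ⁻¹ hg.1).enorm.pow_const 2).mul ((ST_U_meas n r w u).comp measurable_snd)).aemeasurable
  have hVpow : (2 ^ (2 * n + 2) * V) ^ (1 / r) = ENNReal.ofReal ((2 ^ (2 * n + 2) * v₁) ^ (1 / r) * δ ^ (-(n:ℝ) / r)) := by
    have hv : volume (Metric.ball (0 : EuclideanSpace ℝ (Fin n)) 1) = ENNReal.ofReal v₁ := hv₁ ▸
      (ENNReal.ofReal_toReal measure_ball_lt_top.ne).symm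
    have hv0 : 0 ≤ v₁ := hv₁ ▸ ENNReal.toReal_nonneg
    rw [hV, ST_vol_delta _ (by positivity), hv, ← ENNReal.ofReal_mul (by positivity),
      show (2:ℝ≥0∞) ^ (2 * n + 2) = ENNReal.ofReal (2 ^ (2 * n + 2)) by
        rw [ENNReal.ofReal_pow (by norm_num)]; simp,
      ← ENNReal.ofReal_mul (by positivity), ENNReal.ofReal_rpow_of_nonneg (by positivity) (by positivity)]
    congr 1
    rw [show (2:ℝ) ^ (2 * n + 2) * (δ⁻¹ ^ n * v₁) = (2 ^ (2 * n + 2) * v₁) * δ⁻¹ ^ n by ring,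
      Real.mul_rpow (by positivity) (by positivity)]
    congr 1
    rw [← Real.rpow_natCast, ← Real.rpow_mul (by positivity), Real.inv_rpow hδ.le, ← Real.rpow_neg hδ.le]
    congr 1; ring
  calc _ ≤ ∫⁻ t in Set.Icc (1:ℝ) 2, ∫⁻ x, 2 ^ (n + 2) * V⁻¹ * ∫⁻ b, G (t, x) b :=
        lintegral_mono fun t => lintegral_mono fun x => hpt t x
    _ = 2 ^ (n + 2) * V⁻¹ * ∫⁻ t in Set.Icc (1:ℝ) 2, ∫⁻ x, ∫⁻ b, G (t, x) b := by
        have hc : (2 ^ (n + 2) * V⁻¹ : ℝ≥0∞) ≠ ∞ := ENNReal.mul_ne_top (by simp) (by simpa using hV0)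
        rw [← lintegral_const_mul' _ _ hc]
        congr 1; ext t
        rw [← lintegral_const_mul' _ _ hc]
    _ ≤ 2 ^ (n + 2) * V⁻¹ * ∫⁻ b, ENNReal.ofReal (C * δ ^ 2) * 
      ((2 ^ (2 * n + 2) * V) ^ (1 / r) * ∫⁻ y, ‖ST_g δ⁻¹ g b y‖ₑ ^ 2 * ST_U n r w u y) := by
        rw [hswap]
        exact mul_le_mul_right (lintegral_mono hb) _
    _ = 2 ^ (n + 2) * V⁻¹ * (ENNReal.ofReal (C * δ ^ 2) * 
      ((2 ^ (2 * n + 2) * V) ^ (1 / r) * (V * ∫⁻ y, ‖g y‖ₑ ^ 2 * ST_U n r w u y))) := by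
        rw [lintegral_const_mul' _ _ (by simp), lintegral_const_mul' _ _ (by rw [hVpow]; simp), hfin]
    _ = (V⁻¹ * V) * (2 ^ (n + 2) * ENNReal.ofReal (C * δ ^ 2) * (2 ^ (2 * n + 2) * V) ^ (1 / r)) *
        ∫⁻ y, ‖g y‖ₑ ^ 2 * ST_U n r w u y := by ring
    _ ≤ _ := by
        rw [ENNReal.inv_mul_cancel hV0 hV1, one_mul]
        refine mul_le_mul_left ?_ _
        rw [hVpow, show (2:ℝ≥0∞) ^ (n + 2) = ENNReal.ofReal (2 ^ (n + 2)) by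
          rw [ENNReal.ofReal_pow (by norm_num)]; simp, ← ENNReal.ofReal_mul (by positivity),
          ← ENNReal.ofReal_mul (by positivity)]
        apply ENNReal.ofReal_le_ofReal
        apply le_of_eq
        ring

theorem ST_local (m : ℕ) (hm1 : 1 ≤ m) (φ : ℝ → ℝ) (hφ : ST_phi φ)
    (q : EuclideanSpace ℝ (Fin (m + 1)) → ℂ) (hq : ST_q q) :
    ∃ C : ℝ, 0 < C ∧ ∀ δ : ℝ, 0 < δ → δ ≤ 1 → ∀ g, ST_nice volume g →
    ∀ w : EuclideanSpace ℝ (Fin (m + 1)) → ℝ≥0∞, Measurable w → ∀ u, ‖u‖ ≤ 1 →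
    ∫⁻ t in Set.Icc (1:ℝ) 2, ∫⁻ x, ‖ST_L φ q δ t g x‖ₑ ^ 2 * w x ≤
      ENNReal.ofReal (C * δ ^ (2 / ((m : ℝ) + 2))) *
        ∫⁻ y, ‖g y‖ₑ ^ 2 * ST_U (m + 1) (((m:ℝ) + 2) / 2) w u y := by
  obtain ⟨C, hC, hmom⟩ := ST_mom2 m hm1 (2 * (m + 1) + 1) φ hφ q hq
  have hr1 : 1 ≤ ((m:ℝ) + 2) / 2 := by
    have : (0:ℝ) ≤ m := by positivity
    linarith
  set v₁ := (volume (Metric.ball (0 : EuclideanSpace ℝ (Fin (m + 1))) 1)).toReal with hv₁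
  have hv0 : 0 < v₁ := ENNReal.toReal_pos (Metric.measure_ball_pos _ _ one_pos).ne' measure_ball_lt_top.ne
  refine ⟨2 ^ (m + 1 + 2) * C * (2 ^ (2 * (m + 1) + 2) * v₁) ^ (1 / (((m:ℝ) + 2) / 2)), by positivity,
    fun δ hδ hδ1 g hg w hw u hu => ?_⟩
  have := ST_local_aux (m + 1) (((m:ℝ) + 2) / 2) hr1 _ (by omega) C hC φ hφ q hq hmom v₁ hv₁ δ hδ hδ1 g hg w hw u hu
  have e : δ ^ (2 / ((m:ℝ) + 2)) = δ ^ 2 * δ ^ (-((m + 1 : ℕ):ℝ) / (((m:ℝ) + 2) / 2)) := by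
    rw [← Real.rpow_natCast, ← Real.rpow_add hδ]
    congr 1
    push_cast; field_simp; ring
  rw [e]
  exact this

/-- average along a segment -/
noncomputable def ST_av {n : ℕ} (u : EuclideanSpace ℝ (Fin n)) (f : EuclideanSpace ℝ (Fin n) → ℂ)
    (y : EuclideanSpace ℝ (Fin n)) : ℂ := ∫ s in (0:ℝ)..1, f (y + s • u)

noncomputable def ST_D {n : ℕ} (u : EuclideanSpace ℝ (Fin n)) (f : EuclideanSpace ℝ (Fin n) → ℂ)
    (y : EuclideanSpace ℝ (Fin n)) : ℂ := ST_av u f (y + u) - ST_av u f y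

theorem ST_av_cont {n : ℕ} (u : EuclideanSpace ℝ (Fin n)) {f : EuclideanSpace ℝ (Fin n) → ℂ}
    (hf : Continuous f) : Continuous (ST_av u f) := by
  unfold ST_av
  apply intervalIntegral.continuous_parametric_intervalIntegral_of_continuous'
  fun_prop

theorem ST_D_cont {n : ℕ} (u : EuclideanSpace ℝ (Fin n)) {f : EuclideanSpace ℝ (Fin n) → ℂ}
    (hf : Continuous f) : Continuous (ST_D u f) := by
  unfold ST_D
  have := ST_av_cont u hf
  fun_prop

theorem ST_av_two {n : ℕ} (u : EuclideanSpace ℝ (Fin n)) {f : EuclideanSpace ℝ (Fin n) → ℂ}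
    (hf : Continuous f) (y : EuclideanSpace ℝ (Fin n)) :
    ST_av ((2:ℝ) • u) f y = (1 / 2) * (ST_av u f y + ST_av u f (y + u)) := by
  have hc : ∀ y, Continuous (fun s : ℝ => f (y + s • u)) := fun y => by fun_prop
  have h1 : ST_av ((2:ℝ) • u) f y = ∫ s in (0:ℝ)..1, (fun s : ℝ => f (y + s • u)) (2 * s) := by
    unfold ST_av
    congr 1; ext s
    simp [smul_smul, mul_comm]
  have h2 : ST_av u f (y + u) = ∫ s in (0:ℝ)..1, (fun s : ℝ => f (y + s • u)) (s + 1) := by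
    unfold ST_av
    congr 1; ext s
    simp only [add_smul, one_smul]
    congr 1; abel
  have h4 := intervalIntegral.integral_comp_mul_left (a := 0) (b := 1) (c := (2:ℝ)) (fun s : ℝ => f (y + s • u)) (by norm_num)
  have h5 := intervalIntegral.integral_comp_add_right (a := 0) (b := 1) (fun s : ℝ => f (y + s • u)) 1
  rw [h1, h2, h4, h5]
  unfold ST_av
  have h3 := intervalIntegral.integral_add_adjacent_intervals (μ := volume)
    ((hc y).intervalIntegrable 0 1) ((hc y).intervalIntegrable 1 2)
  norm_num at h3 ⊢
  rw [← h3]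

theorem ST_para (a b : ℂ) : ‖(1 / 2) * (a + b)‖ₑ ^ 2 + 4⁻¹ * ‖b - a‖ₑ ^ 2 = 2⁻¹ * (‖a‖ₑ ^ 2 + ‖b‖ₑ ^ 2) := by
  have e : ∀ z : ℂ, ‖z‖ₑ ^ 2 = ENNReal.ofReal (‖z‖ ^ 2) := fun z => by
    rw [← ofReal_norm, ENNReal.ofReal_pow (norm_nonneg _)]
  rw [e, e, e, e, show (4⁻¹ : ℝ≥0∞) = ENNReal.ofReal 4⁻¹ by rw [ENNReal.ofReal_inv_of_pos (by norm_num)]; simp,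
    show (2⁻¹ : ℝ≥0∞) = ENNReal.ofReal 2⁻¹ by rw [ENNReal.ofReal_inv_of_pos (by norm_num)]; simp,
    ← ENNReal.ofReal_add (by positivity) (by positivity), ← ENNReal.ofReal_mul (by norm_num),
    ← ENNReal.ofReal_mul (by norm_num), ← ENNReal.ofReal_add (by positivity) (by positivity)]
  congr 1
  have h := parallelogram_law_with_norm ℝ a b
  rw [norm_mul, norm_sub_rev b a]
  norm_num
  nlinarith

theorem ST_U_mono {n : ℕ} {r : ℝ} {w : EuclideanSpace ℝ (Fin n) → ℝ≥0∞}
    {u y u' y' : EuclideanSpace ℝ (Fin n)}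
    (h : ∀ c ρ, y ∈ Metric.ball c ρ → y + u ∈ Metric.ball c ρ → y' ∈ Metric.ball c ρ ∧ y' + u' ∈ Metric.ball c ρ) :
    ST_U n r w u y ≤ ST_U n r w u' y' := by
  conv_lhs => unfold ST_U
  refine iSup_le fun c => iSup_le fun ρ => iSup_le fun hρ => iSup_le fun h1 => iSup_le fun h2 => ?_
  exact ST_U_le hρ (h c ρ h1 h2).1 (h c ρ h1 h2).2

theorem ST_ball_seg {n : ℕ} {c y u : EuclideanSpace ℝ (Fin n)} {ρ : ℝ} (h1 : y ∈ Metric.ball c ρ)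
    (h2 : y + u ∈ Metric.ball c ρ) {s : ℝ} (hs : s ∈ Set.Icc (0:ℝ) 1) : y + s • u ∈ Metric.ball c ρ := by
  have := (convex_ball c ρ).add_smul_mem h1 h2 hs
  exact this

theorem ST_tele_step {n : ℕ} (r : ℝ) (w : EuclideanSpace ℝ (Fin n) → ℝ≥0∞)
    (u : EuclideanSpace ℝ (Fin n)) {f : EuclideanSpace ℝ (Fin n) → ℂ} (hf : Continuous f) :
    (∫⁻ y, ‖ST_av ((2:ℝ) • u) f y‖ₑ ^ 2 * ST_U n r w ((2:ℝ) • u) y) +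
      4⁻¹ * ∫⁻ y, ‖ST_D u f y‖ₑ ^ 2 * ST_U n r w ((2:ℝ) • u) y ≤
    ∫⁻ y, ‖ST_av u f y‖ₑ ^ 2 * ST_U n r w u y := by
  have hU := ST_U_meas n r w u
  have hU2 := ST_U_meas n r w ((2:ℝ) • u)
  have ha := (ST_av_cont u hf).measurable
  have ha2 := (ST_av_cont ((2:ℝ) • u) hf).measurable
  have hD := (ST_D_cont u hf).measurable
  have hm1 : Measurable (fun y => ‖ST_av u f y‖ₑ ^ 2 * ST_U n r w u y) := (ha.enorm.pow_const 2).mul hU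
  have hm2 : Measurable (fun y => 4⁻¹ * (‖ST_D u f y‖ₑ ^ 2 * ST_U n r w ((2:ℝ) • u) y)) :=
    ((hD.enorm.pow_const 2).mul hU2).const_mul _
  rw [← lintegral_const_mul' _ _ (by simp), ← lintegral_add_right _ hm2]
  calc _ ≤ ∫⁻ y, 2⁻¹ * ((‖ST_av u f y‖ₑ ^ 2 * ST_U n r w u y) + (‖ST_av u f (y + u)‖ₑ ^ 2 * ST_U n r w u (y + u))) := by
        apply lintegral_mono
        intro y
        dsimp only
        have h1 : ST_U n r w ((2:ℝ) • u) y ≤ ST_U n r w u y := by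
          apply ST_U_mono
          intro c ρ h1 h2
          refine ⟨h1, ?_⟩
          have := ST_ball_seg h1 h2 (s := 1 / 2) (by norm_num)
          simpa [smul_smul] using this
        have h2 : ST_U n r w ((2:ℝ) • u) y ≤ ST_U n r w u (y + u) := by
          apply ST_U_mono
          intro c ρ h1 h2
          constructor
          · have := ST_ball_seg h1 h2 (s := 1 / 2) (by norm_num)
            simpa [smul_smul] using this
          · rwa [two_smul, ← add_assoc] at h2
        have h3 := ST_para (ST_av u f y) (ST_av u f (y + u))
        rw [← mul_assoc, ← add_mul, ST_av_two u hf]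
        have e : ST_D u f y = ST_av u f (y + u) - ST_av u f y := rfl
        rw [e, h3, mul_assoc, add_mul]
        gcongr
    _ = 2⁻¹ * ((∫⁻ y, ‖ST_av u f y‖ₑ ^ 2 * ST_U n r w u y) + ∫⁻ y, ‖ST_av u f (y + u)‖ₑ ^ 2 * ST_U n r w u (y + u)) := by
        rw [lintegral_const_mul' _ _ (by simp), lintegral_add_left hm1]
    _ = _ := by
        rw [lintegral_add_right_eq_self (fun y => ‖ST_av u f y‖ₑ ^ 2 * ST_U n r w u y) u, ← two_mul, ← mul_assoc,
          ENNReal.inv_mul_cancel (by simp) (by simp), one_mul]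

theorem ST_tele_top {n : ℕ} (r : ℝ) (w : EuclideanSpace ℝ (Fin n) → ℝ≥0∞)
    (u : EuclideanSpace ℝ (Fin n)) {f : EuclideanSpace ℝ (Fin n) → ℂ} (hf : Continuous f) :
    ∫⁻ y, ‖ST_av u f y‖ₑ ^ 2 * ST_U n r w u y ≤ ∫⁻ y, ‖f y‖ₑ ^ 2 * ST_U n r w 0 y := by
  have hU := ST_U_meas n r w 0
  have hm : Measurable (fun y => ‖f y‖ₑ ^ 2 * ST_U n r w 0 y) := (hf.measurable.enorm.pow_const 2).mul hU
  have h1 : ∀ y, ‖ST_av u f y‖ₑ ^ 2 * ST_U n r w u y ≤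
      ∫⁻ s in Set.Ioc (0:ℝ) 1, ‖f (y + s • u)‖ₑ ^ 2 * ST_U n r w 0 (y + s • u) := by
    intro y
    have hc : Continuous (fun s : ℝ => f (y + s • u)) := by fun_prop
    have h2 : ‖ST_av u f y‖ₑ ≤ ∫⁻ s in Set.Ioc (0:ℝ) 1, 1 * ‖f (y + s • u)‖ₑ := by
      unfold ST_av
      rw [intervalIntegral.integral_of_le (by norm_num)]
      simp only [one_mul]
      exact enorm_integral_le_lintegral_enorm _
    have h3 := ST_cs (volume.restrict (Set.Ioc (0:ℝ) 1)) (fun _ => 1) (fun s => ‖f (y + s • u)‖ₑ)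
      aemeasurable_const hc.measurable.enorm.aemeasurable
    have h4 := (pow_le_pow_left₀ bot_le h2 2).trans h3
    simp only [one_pow, lintegral_const, Measure.restrict_apply_univ, Real.volume_Ioc, sub_zero,
      ENNReal.ofReal_one, one_mul] at h4
    refine (mul_le_mul_left h4 _).trans ?_
    rw [← lintegral_mul_const _ (hc.measurable.enorm.pow_const 2)]
    apply setLIntegral_mono' measurableSet_Ioc
    intro s hs
    gcongr
    apply ST_U_mono
    intro c ρ h1 h2
    have := ST_ball_seg h1 h2 (s := s) ⟨hs.1.le, hs.2⟩
    exact ⟨this, by simpa using this⟩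
  refine (lintegral_mono h1).trans ?_
  rw [lintegral_lintegral_swap]
  · calc _ = ∫⁻ s in Set.Ioc (0:ℝ) 1, ∫⁻ y, ‖f y‖ₑ ^ 2 * ST_U n r w 0 y := by
          congr 1; ext s
          exact lintegral_add_right_eq_self (fun y => ‖f y‖ₑ ^ 2 * ST_U n r w 0 y) (s • u)
      _ = _ := by simp
      _ ≤ _ := le_rfl
  · have h0 : Measurable (fun p : EuclideanSpace ℝ (Fin n) × ℝ => p.1 + p.2 • u) := by fun_prop
    exact (hm.comp h0).aemeasurable

theorem ST_tele_nat {n : ℕ} (r : ℝ) (w : EuclideanSpace ℝ (Fin n) → ℝ≥0∞)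
    (u : EuclideanSpace ℝ (Fin n)) {f : EuclideanSpace ℝ (Fin n) → ℂ} (hf : Continuous f) (K : ℕ) :
    (∫⁻ y, ‖ST_av ((2:ℝ) ^ K • u) f y‖ₑ ^ 2 * ST_U n r w ((2:ℝ) ^ K • u) y) +
    4⁻¹ * ∑ k ∈ Finset.range K, ∫⁻ y, ‖ST_D ((2:ℝ) ^ k • u) f y‖ₑ ^ 2 * ST_U n r w ((2:ℝ) • ((2:ℝ) ^ k • u)) y ≤
      ∫⁻ y, ‖f y‖ₑ ^ 2 * ST_U n r w 0 y := by
  induction K with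
  | zero => simpa using ST_tele_top r w u hf
  | succ K ih =>
    refine le_trans ?_ ih
    have h := ST_tele_step r w ((2:ℝ) ^ K • u) hf
    rw [Finset.sum_range_succ, mul_add, add_comm (4⁻¹ * _) (4⁻¹ * _), ← add_assoc]
    gcongr
    have e : (2:ℝ) ^ (K + 1) • u = (2:ℝ) • ((2:ℝ) ^ K • u) := by rw [smul_smul, pow_succ, mul_comm]
    rw [e]
    exact h

theorem ST_tele {n : ℕ} (r : ℝ) (w : EuclideanSpace ℝ (Fin n) → ℝ≥0∞)
    (u : EuclideanSpace ℝ (Fin n)) {f : EuclideanSpace ℝ (Fin n) → ℂ} (hf : Continuous f) :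
    ∑' k : ℤ, ∫⁻ y, ‖ST_D ((2:ℝ) ^ k • u) f y‖ₑ ^ 2 * ST_U n r w ((2:ℝ) • ((2:ℝ) ^ k • u)) y ≤
      4 * ∫⁻ y, ‖f y‖ₑ ^ 2 * ST_U n r w 0 y := by
  rw [ENNReal.tsum_eq_iSup_sum]
  refine iSup_le fun s => ?_
  obtain ⟨K, hK⟩ : ∃ K : ℕ, ∀ k ∈ s, -(K:ℤ) ≤ k ∧ k < K := by
    refine ⟨∑ k ∈ s, (k.natAbs + 1), fun k hk => ?_⟩
    have := Finset.single_le_sum (f := fun k : ℤ => k.natAbs + 1) (fun _ _ => Nat.zero_le _) hk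
    have h9 : k.natAbs + 1 ≤ ∑ k ∈ s, (k.natAbs + 1) := this
    omega
  set F : ℤ → ℝ≥0∞ := fun k => ∫⁻ y, ‖ST_D ((2:ℝ) ^ k • u) f y‖ₑ ^ 2 * ST_U n r w ((2:ℝ) • ((2:ℝ) ^ k • u)) y with hF
  have h1 : ∑ k ∈ s, F k ≤ ∑ k ∈ Finset.range (2 * K), F ((k:ℤ) - K) := by
    have hinj : Set.InjOn (fun k : ℕ => (k:ℤ) - K) (Finset.range (2 * K)) := by
      intro a _ b _ h
      simp only at h
      omega
    rw [← Finset.sum_image (g := fun k : ℕ => (k:ℤ) - K) hinj]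
    apply Finset.sum_le_sum_of_subset
    intro k hk
    rw [Finset.mem_image]
    have := hK k hk
    refine ⟨(k + K).toNat, ?_, ?_⟩
    · rw [Finset.mem_range]; omega
    · omega
  refine h1.trans ?_
  have h2 := ST_tele_nat r w ((2:ℝ) ^ (-(K:ℤ)) • u) hf (2 * K)
  have e : ∀ k : ℕ, (2:ℝ) ^ k • ((2:ℝ) ^ (-(K:ℤ)) • u) = (2:ℝ) ^ ((k:ℤ) - K) • u := by
    intro k
    rw [smul_smul, ← zpow_natCast, ← zpow_add₀ (by norm_num)]
    rfl
  simp only [e] at h2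
  have h3 := le_trans le_add_self h2
  calc _ = 4 * (4⁻¹ * ∑ k ∈ Finset.range (2 * K), F ((k:ℤ) - K)) := by
        rw [← mul_assoc, ENNReal.mul_inv_cancel (by simp) (by simp), one_mul]
    _ ≤ _ := by gcongr

noncomputable def ST_ee (θ : ℝ) : ℂ := cexp (((2 * Real.pi * θ : ℝ) : ℂ) * I)

theorem ST_ee_add (a b : ℝ) : ST_ee (a + b) = ST_ee a * ST_ee b := by
  unfold ST_ee
  rw [← Complex.exp_add]; congr 1; push_cast; ring

theorem ST_ee_zero : ST_ee 0 = 1 := by simp [ST_ee]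

theorem ST_ee_norm (a : ℝ) : ‖ST_ee a‖ = 1 := by
  unfold ST_ee
  exact Complex.norm_exp_ofReal_mul_I _

theorem ST_ee_cont : Continuous ST_ee := by unfold ST_ee; fun_prop

theorem ST_fourier_e {n : ℕ} (f : EuclideanSpace ℝ (Fin n) → ℂ) (ξ : EuclideanSpace ℝ (Fin n)) :
    𝓕 f ξ = ∫ y, ST_ee (-⟪y, ξ⟫) * f y := by
  rw [Real.fourier_eq']
  congr 1; ext y
  unfold ST_ee
  rw [smul_eq_mul]
  congr 3; push_cast; ring

theorem ST_fourierInv_e {n : ℕ} (f : EuclideanSpace ℝ (Fin n) → ℂ) (x : EuclideanSpace ℝ (Fin n)) :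
    𝓕⁻ f x = ∫ ξ, ST_ee (⟪ξ, x⟫) * f ξ := by
  rw [Real.fourierInv_eq']
  congr 1

theorem ST_F_trans {n : ℕ} (f : EuclideanSpace ℝ (Fin n) → ℂ) (v ξ : EuclideanSpace ℝ (Fin n)) :
    ∫ y, ST_ee (-⟪y, ξ⟫) * f (y + v) = ST_ee ⟪v, ξ⟫ * 𝓕 f ξ := by
  rw [ST_fourier_e, ← integral_const_mul,
    ← integral_add_right_eq_self (fun y => ST_ee ⟪v, ξ⟫ * (ST_ee (-⟪y, ξ⟫) * f y)) v]
  congr 1; ext y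
  rw [← mul_assoc, ← ST_ee_add, inner_add_left]
  congr 2; ring

noncomputable def ST_AA (θ : ℝ) : ℂ := ∫ s in (0:ℝ)..1, ST_ee (s * θ)

theorem ST_av_prod {n : ℕ} (u : EuclideanSpace ℝ (Fin n)) {f : EuclideanSpace ℝ (Fin n) → ℂ}
    (hf : Continuous f) (hi : Integrable f) :
    Integrable (fun p : ℝ × EuclideanSpace ℝ (Fin n) => f (p.2 + p.1 • u))
      ((volume.restrict (Set.Ioc (0:ℝ) 1)).prod volume) := by
  have hc : Continuous (fun p : ℝ × EuclideanSpace ℝ (Fin n) => f (p.2 + p.1 • u)) := by fun_prop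
  rw [integrable_prod_iff hc.aestronglyMeasurable]
  constructor
  · exact ae_of_all _ fun s => hi.comp_add_right (s • u)
  · have : (fun s : ℝ => ∫ y, ‖f (y + s • u)‖) = fun _ => ∫ y, ‖f y‖ := by
      ext s
      exact integral_add_right_eq_self (fun y => ‖f y‖) (s • u)
    simp only [this]
    exact integrable_const _

theorem ST_av_int {n : ℕ} (u : EuclideanSpace ℝ (Fin n)) {f : EuclideanSpace ℝ (Fin n) → ℂ}
    (hf : Continuous f) (hi : Integrable f) : Integrable (ST_av u f) := by
  have := (ST_av_prod u hf hi).integral_prod_right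
  unfold ST_av
  simp only [intervalIntegral.integral_of_le zero_le_one]
  exact this

theorem ST_av_fourier {n : ℕ} (u : EuclideanSpace ℝ (Fin n)) {f : EuclideanSpace ℝ (Fin n) → ℂ}
    (hf : Continuous f) (hi : Integrable f) (ξ : EuclideanSpace ℝ (Fin n)) :
    𝓕 (ST_av u f) ξ = ST_AA ⟪u, ξ⟫ * 𝓕 f ξ := by
  rw [ST_fourier_e]
  unfold ST_av ST_AA
  simp only [intervalIntegral.integral_of_le zero_le_one]
  simp only [← integral_const_mul]
  have hce := ST_ee_cont
  have hI : Integrable (fun p : ℝ × EuclideanSpace ℝ (Fin n) => ST_ee (-⟪p.2, ξ⟫) * f (p.2 + p.1 • u))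
      ((volume.restrict (Set.Ioc (0:ℝ) 1)).prod volume) := by
    refine (ST_av_prod u hf hi).bdd_mul (c := 1) ?_ ?_
    · apply Continuous.aestronglyMeasurable; fun_prop
    · exact ae_of_all _ fun p => (ST_ee_norm _).le
  rw [← integral_integral_swap hI, ← integral_mul_const]
  congr 1; ext s
  rw [ST_F_trans, inner_smul_left]; simp

theorem ST_D_fourier {n : ℕ} (u : EuclideanSpace ℝ (Fin n)) {f : EuclideanSpace ℝ (Fin n) → ℂ}
    (hf : Continuous f) (hi : Integrable f) (ξ : EuclideanSpace ℝ (Fin n)) :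
    𝓕 (ST_D u f) ξ = (ST_ee ⟪u, ξ⟫ - 1) * ST_AA ⟪u, ξ⟫ * 𝓕 f ξ := by
  have hav := ST_av_int u hf hi
  have hce := ST_ee_cont
  have key : ∀ g : EuclideanSpace ℝ (Fin n) → ℂ, Integrable g → Integrable (fun y => ST_ee (-⟪y, ξ⟫) * g y) := by
    intro g hg
    refine hg.bdd_mul (c := 1) ?_ ?_
    · apply Continuous.aestronglyMeasurable; fun_prop
    · exact ae_of_all _ fun p => (ST_ee_norm _).le
  rw [ST_fourier_e]
  unfold ST_D
  simp only [mul_sub]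
  rw [integral_sub (key _ (hav.comp_add_right u)) (key _ hav), ST_F_trans, ← ST_fourier_e, ST_av_fourier u hf hi]
  ring

theorem ST_D_nice {n : ℕ} (u : EuclideanSpace ℝ (Fin n)) {f : EuclideanSpace ℝ (Fin n) → ℂ}
    (hf : Continuous f) (hn : ST_nice volume f) : ST_nice volume (ST_D u f) := by
  obtain ⟨_, hi, K, hK⟩ := hn
  refine ⟨(ST_D_cont u hf).measurable, ?_, 2 * K, ?_⟩
  · have hav := ST_av_int u hf hi
    exact (hav.comp_add_right u).sub hav
  · have h : ∀ y, ‖ST_av u f y‖ ≤ K := by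
      intro y
      have := intervalIntegral.norm_integral_le_of_norm_le_const (a := (0:ℝ)) (b := 1) (C := K)
        (f := fun s : ℝ => f (y + s • u)) (fun s _ => hK _)
      rw [sub_zero, abs_one, mul_one] at this
      exact this
    intro y
    unfold ST_D
    have := norm_sub_le (ST_av u f (y + u)) (ST_av u f y)
    linarith [h y, h (y + u)]

/-- symbol of the difference operator -/
noncomputable def ST_Mu (θ : ℝ) : ℂ := (ST_ee θ - 1) * ST_AA θ

noncomputable def ST_rho (θ : ℝ) : ℝ := 2 - 2 * Real.cos (2 * Real.pi * θ)

theorem ST_AA_eq (θ : ℝ) : ST_AA θ * (2 * Real.pi * θ * I) = ST_ee θ - 1 := by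
  have h : ∀ s ∈ Set.uIcc (0:ℝ) 1, HasDerivAt (fun s : ℝ => ST_ee (s * θ)) (ST_ee (s * θ) * (2 * Real.pi * θ * I)) s := by
    intro s _
    unfold ST_ee
    have h1 : HasDerivAt (fun s : ℝ => ((2 * Real.pi * (s * θ) : ℝ) : ℂ) * I) (2 * Real.pi * θ * I) s := by
      have h2 : HasDerivAt (fun s : ℝ => 2 * Real.pi * (s * θ)) (2 * Real.pi * θ) s := by
        have := ((hasDerivAt_id s).mul_const θ).const_mul (2 * Real.pi)
        simpa using this
      have := (h2.ofReal_comp).mul_const I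
      simpa using this
    exact h1.cexp
  have hce := ST_ee_cont
  have := intervalIntegral.integral_eq_sub_of_hasDerivAt h
    (by apply Continuous.intervalIntegrable; fun_prop)
  rw [intervalIntegral.integral_mul_const] at this
  unfold ST_AA
  rw [this, one_mul, zero_mul, ST_ee_zero]

theorem ST_ee_sq (θ : ℝ) : (ST_ee θ - 1) ^ 2 = - (ST_rho θ : ℂ) * ST_ee θ := by
  have h1 : ST_ee θ = (Real.cos (2 * Real.pi * θ) : ℂ) + (Real.sin (2 * Real.pi * θ) : ℂ) * I := by
    unfold ST_ee
    rw [Complex.exp_mul_I]; push_cast; rfl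
  have h2 : ((Real.sin (2 * Real.pi * θ) : ℂ))^2 + ((Real.cos (2 * Real.pi * θ) : ℂ))^2 = 1 := by
    exact_mod_cast Real.sin_sq_add_cos_sq (2 * Real.pi * θ)
  rw [h1]
  unfold ST_rho
  push_cast at h2 ⊢
  have h3 := I_sq
  linear_combination (-1 : ℂ) * h2 + (Complex.sin (2 * Real.pi * θ))^2 * h3

/-- the key algebraic identity -/
theorem ST_Mu_eq (θ : ℝ) : ST_Mu θ * (-(2 * Real.pi * θ * I) * ST_ee (-θ)) = ST_rho θ := by
  have h1 := ST_AA_eq θ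
  have h2 := ST_ee_sq θ
  have h3 : ST_ee θ * ST_ee (-θ) = 1 := by rw [← ST_ee_add]; simp [ST_ee_zero]
  unfold ST_Mu
  linear_combination (-(ST_ee θ - 1) * ST_ee (-θ)) * h1 - ST_ee (-θ) * h2 + (ST_rho θ : ℂ) * h3

theorem ST_rho_nonneg (θ : ℝ) : 0 ≤ ST_rho θ := by
  unfold ST_rho; linarith [Real.cos_le_one (2 * Real.pi * θ)]

theorem ST_rho_pos {θ : ℝ} (h0 : θ ≠ 0) (h1 : |θ| < 1) : 0 < ST_rho θ := by
  refine lt_of_le_of_ne (ST_rho_nonneg θ) fun h => h0 ?_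
  have hp := Real.pi_pos
  rw [abs_lt] at h1
  have : Real.cos (2 * Real.pi * θ) = 1 := by unfold ST_rho at h; linarith
  rw [Real.cos_eq_one_iff_of_lt_of_lt (by nlinarith) (by nlinarith)] at this
  simpa [hp.ne'] using this

noncomputable def ST_u (n : ℕ) (j : Fin n) : EuclideanSpace ℝ (Fin n) := (1 / 8 : ℝ) • EuclideanSpace.single j 1

theorem ST_u_inner (n : ℕ) (j : Fin n) (ξ : EuclideanSpace ℝ (Fin n)) : ⟪ST_u n j, ξ⟫ = ξ j / 8 := by
  unfold ST_u
  rw [inner_smul_left, EuclideanSpace.inner_single_left]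
  simp; ring

theorem ST_u_norm (n : ℕ) (j : Fin n) : ‖ST_u n j‖ = 1 / 8 := by
  unfold ST_u
  rw [norm_smul]; simp

theorem ST_qs (n : ℕ) : ∃ q : Fin n → EuclideanSpace ℝ (Fin n) → ℂ, (∀ j, ST_q (q j)) ∧
    ∀ ξ : EuclideanSpace ℝ (Fin n), 1 / 2 ≤ ‖ξ‖ ^ 2 → ‖ξ‖ ^ 2 ≤ 6 →
      ∑ j, q j ξ * ST_Mu ⟪ST_u n j, ξ⟫ = 1 := by
  let b : ContDiffBump (13 / 4 : ℝ) := ⟨11 / 4, 3, by norm_num, by norm_num⟩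
  let χ : EuclideanSpace ℝ (Fin n) → ℝ := fun ξ => b (‖ξ‖ ^ 2)
  let G : EuclideanSpace ℝ (Fin n) → ℝ := fun ξ => ∑ j, ST_rho (ξ j / 8) ^ 2
  have hχ : ContDiff ℝ (⊤:ℕ∞) χ := b.contDiff.comp (contDiff_norm_sq ℝ)
  have hco : ∀ j : Fin n, ContDiff ℝ (⊤:ℕ∞) (fun ξ : EuclideanSpace ℝ (Fin n) => ξ j / 8) := by
    intro j; fun_prop
  have hrho : ContDiff ℝ (⊤:ℕ∞) ST_rho := by
    unfold ST_rho
    exact contDiff_const.sub (contDiff_const.mul (Real.contDiff_cos.comp (contDiff_const.mul contDiff_id)))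
  have hee : ContDiff ℝ (⊤:ℕ∞) ST_ee := by
    unfold ST_ee
    apply ContDiff.cexp
    refine ContDiff.mul ?_ contDiff_const
    exact ofRealCLM.contDiff.comp (contDiff_const.mul contDiff_id)
  have hr : ∀ j : Fin n, ContDiff ℝ (⊤:ℕ∞) (fun ξ : EuclideanSpace ℝ (Fin n) => ST_rho (ξ j / 8)) :=
    fun j => hrho.comp (hco j)
  have hG : ContDiff ℝ (⊤:ℕ∞) G := ContDiff.sum fun j _ => (hr j).pow 2
  have hG0 : ∀ ξ, 0 ≤ G ξ := fun ξ => Finset.sum_nonneg fun j _ => sq_nonneg _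
  have hsupp : ∀ ξ, χ ξ ≠ 0 → 1 / 4 < ‖ξ‖ ^ 2 ∧ ‖ξ‖ ^ 2 < 25 / 4 := by
    intro ξ h
    have h1 : ‖ξ‖ ^ 2 ∈ Metric.ball (13 / 4 : ℝ) 3 := by
      have := b.support_eq
      rw [← this]; exact h
    rw [Metric.mem_ball, Real.dist_eq, abs_lt] at h1
    constructor <;> linarith [h1.1, h1.2]
  have hGpos : ∀ ξ, χ ξ ≠ 0 → 0 < G ξ := by
    intro ξ h
    obtain ⟨h1, h2⟩ := hsupp ξ h
    have hs := EuclideanSpace.real_norm_sq_eq ξ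
    obtain ⟨j, hj⟩ : ∃ j, ξ j ≠ 0 := by
      by_contra hcon
      push Not at hcon
      rw [hs] at h1
      simp [hcon] at h1
      linarith
    have h3 : ξ j ^ 2 ≤ ‖ξ‖ ^ 2 := by
      rw [hs]
      exact Finset.single_le_sum (f := fun j => ξ j ^ 2) (fun _ _ => sq_nonneg _) (Finset.mem_univ j)
    have h4 : 0 < ST_rho (ξ j / 8) := by
      apply ST_rho_pos
      · simpa using hj
      · rw [abs_lt]; constructor <;> nlinarith
    refine lt_of_lt_of_le (by positivity : 0 < ST_rho (ξ j / 8) ^ 2) ?_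
    exact Finset.single_le_sum (f := fun j => ST_rho (ξ j / 8) ^ 2) (fun _ _ => sq_nonneg _) (Finset.mem_univ j)
  have hden : ∀ ξ, 0 < G ξ + (1 - χ ξ) := by
    intro ξ
    have h1 : χ ξ ≤ 1 := b.le_one
    by_cases h : χ ξ = 0
    · rw [h]; linarith [hG0 ξ]
    · linarith [hGpos ξ h]
  refine ⟨fun j ξ => ((χ ξ * ST_rho (ξ j / 8) / (G ξ + (1 - χ ξ)) : ℝ) : ℂ) *
    (-(2 * Real.pi * (ξ j / 8 : ℝ) * I) * ST_ee (-(ξ j / 8))), ?_, ?_⟩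
  · intro j
    constructor
    · refine ContDiff.mul (ofRealCLM.contDiff.comp (ContDiff.div (hχ.mul (hr j)) (hG.add (contDiff_const.sub hχ)) fun ξ => (hden ξ).ne')) ?_
      refine ContDiff.mul ?_ (hee.comp (hco j).neg)
      refine ContDiff.neg (ContDiff.mul (contDiff_const.mul ?_) contDiff_const)
      exact ofRealCLM.contDiff.comp (hco j)
    · apply HasCompactSupport.intro (isCompact_closedBall (0 : EuclideanSpace ℝ (Fin n)) 3)
      intro ξ hξ
      have : χ ξ = 0 := by
        by_contra h
        apply hξ
        rw [mem_closedBall_zero_iff]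
        have := (hsupp ξ h).2
        nlinarith [norm_nonneg ξ]
      simp [this]
  · intro ξ h1 h2
    have hχ1 : χ ξ = 1 := by
      apply b.one_of_mem_closedBall
      rw [Metric.mem_closedBall, Real.dist_eq, abs_le]
      change -(11 / 4) ≤ _ ∧ _ ≤ (11 / 4 : ℝ)
      constructor <;> linarith
    have hGp := hGpos ξ (by rw [hχ1]; norm_num)
    simp only [ST_u_inner, hχ1]
    have e : ∀ j : Fin n, ((1 * ST_rho (ξ j / 8) / (G ξ + (1 - 1)) : ℝ) : ℂ) *
      (-(2 * Real.pi * (ξ j / 8 : ℝ) * I) * ST_ee (-(ξ j / 8))) * ST_Mu (ξ j / 8) =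
      ((ST_rho (ξ j / 8) ^ 2 / G ξ : ℝ) : ℂ) := by
      intro j
      rw [mul_assoc, mul_comm (_ * ST_ee _), ST_Mu_eq, ← ofReal_mul]
      congr 1
      rw [sub_self, add_zero]; ring
    rw [Finset.sum_congr rfl fun j _ => e j, ← ofReal_sum, ← Finset.sum_div]
    change ((G ξ / G ξ : ℝ) : ℂ) = 1
    rw [div_self hGp.ne']; simp

noncomputable def ST_S {n : ℕ} (φ : ℝ → ℝ) (δ t : ℝ) (f : EuclideanSpace ℝ (Fin n) → ℂ) :
    EuclideanSpace ℝ (Fin n) → ℂ :=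
  𝓕⁻ (fun ξ => ((φ (δ⁻¹ * (1 - ‖ξ‖ ^ 2 / t ^ 2)) : ℝ) : ℂ) * 𝓕 f ξ)

theorem ST_S_decomp {n : ℕ} {φ : ℝ → ℝ} (hφ : ST_phi φ) {q : Fin n → EuclideanSpace ℝ (Fin n) → ℂ}
    (hq : ∀ j, ST_q (q j))
    (hq2 : ∀ ξ : EuclideanSpace ℝ (Fin n), 1 / 2 ≤ ‖ξ‖ ^ 2 → ‖ξ‖ ^ 2 ≤ 6 →
      ∑ j, q j ξ * ST_Mu ⟪ST_u n j, ξ⟫ = 1) {δ t : ℝ} (hδ : 0 < δ) (hδ1 : δ ≤ 1) (ht : 1 ≤ t) (ht2 : t ≤ 2)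
    {f : EuclideanSpace ℝ (Fin n) → ℂ} (hf : Continuous f) (hn : ST_nice volume f)
    (x : EuclideanSpace ℝ (Fin n)) :
    ST_S φ δ t f x = ∑ j, ST_L φ (q j) δ t (ST_D (ST_u n j) f) x := by
  have hIntg : ∀ j, Integrable (fun ξ => ST_ee ⟪ξ, x⟫ * (ST_M φ (q j) δ t ξ * 𝓕 (ST_D (ST_u n j) f) ξ)) := by
    intro j
    have hce := ST_ee_cont
    have h1 := ST_L_int hφ (hq j) δ t (ST_D_nice (ST_u n j) hf hn).2.1
    refine h1.bdd_mul (c := 1) ?_ ?_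
    · apply Continuous.aestronglyMeasurable; fun_prop
    · exact ae_of_all _ fun p => (ST_ee_norm _).le
  unfold ST_S ST_L
  simp only [ST_fourierInv_e]
  rw [← integral_finsetSum _ (fun j _ => hIntg j)]
  congr 1; ext ξ
  rw [← Finset.mul_sum]
  congr 1
  simp only [ST_D_fourier _ hf hn.2.1]
  by_cases h : φ (δ⁻¹ * (1 - ‖ξ‖ ^ 2 / t ^ 2)) = 0
  · simp [ST_M, h]
  · have h1 : |δ⁻¹ * (1 - ‖ξ‖ ^ 2 / t ^ 2)| ≤ 1 / 2 := by
      by_contra hcon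
      exact h (hφ.2 _ (not_le.1 hcon))
    have h2 : |1 - ‖ξ‖ ^ 2 / t ^ 2| ≤ 1 / 2 := by
      rw [abs_mul, abs_of_pos (by positivity : 0 < δ⁻¹)] at h1
      have h3 : (1:ℝ) ≤ δ⁻¹ := (one_le_inv₀ hδ).2 hδ1
      nlinarith [abs_nonneg (1 - ‖ξ‖ ^ 2 / t ^ 2)]
    have ht0 : 0 < t ^ 2 := by positivity
    obtain ⟨h3, h4⟩ := abs_le.1 h2
    have h5 : ‖ξ‖ ^ 2 ≤ 3 / 2 * t ^ 2 := by rw [← div_le_iff₀ ht0]; linarith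
    have h6 : 1 / 2 * t ^ 2 ≤ ‖ξ‖ ^ 2 := by rw [← le_div_iff₀ ht0]; linarith
    have h7 := hq2 ξ (by nlinarith) (by nlinarith)
    calc _ = (φ (δ⁻¹ * (1 - ‖ξ‖ ^ 2 / t ^ 2)) : ℂ) * 𝓕 f ξ * ∑ j, q j ξ * ST_Mu ⟪ST_u n j, ξ⟫ := by rw [h7, mul_one]
      _ = _ := by
        rw [Finset.mul_sum]
        apply Finset.sum_congr rfl
        intro j _
        unfold ST_M ST_Mu
        ring

theorem ST_sum_sq {n : ℕ} (z : Fin n → ℂ) : ‖∑ j, z j‖ₑ ^ 2 ≤ n * ∑ j, ‖z j‖ₑ ^ 2 := by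
  have e : ∀ z : ℂ, ‖z‖ₑ ^ 2 = ENNReal.ofReal (‖z‖ ^ 2) := fun z => by
    rw [← ofReal_norm, ENNReal.ofReal_pow (norm_nonneg _)]
  simp only [e]
  rw [← ENNReal.ofReal_sum_of_nonneg (fun j _ => sq_nonneg _), ← ENNReal.ofReal_natCast,
    ← ENNReal.ofReal_mul (by positivity)]
  apply ENNReal.ofReal_le_ofReal
  have h1 := norm_sum_le Finset.univ z
  have h2 := sq_sum_le_card_mul_sum_sq (s := Finset.univ) (f := fun j => ‖z j‖)
  rw [Finset.card_univ, Fintype.card_fin] at h2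
  exact (pow_le_pow_left₀ (norm_nonneg _) h1 2).trans h2

theorem ST_unit (m : ℕ) (hm1 : 1 ≤ m) (φ : ℝ → ℝ) (hφ : ST_phi φ) :
    ∃ C : ℝ, 0 < C ∧ ∀ δ : ℝ, 0 < δ → δ ≤ 1 → ∀ f : EuclideanSpace ℝ (Fin (m + 1)) → ℂ, Continuous f →
      ST_nice volume f → ∀ w : EuclideanSpace ℝ (Fin (m + 1)) → ℝ≥0∞, Measurable w →
      ∫⁻ t in Set.Icc (1:ℝ) 2, ∫⁻ x, ‖ST_S φ δ t f x‖ₑ ^ 2 * w x ≤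
        ENNReal.ofReal (C * δ ^ (2 / ((m:ℝ) + 2))) * ∑ j, ∫⁻ y, ‖ST_D (ST_u (m + 1) j) f y‖ₑ ^ 2 *
          ST_U (m + 1) (((m:ℝ) + 2) / 2) w ((2:ℝ) • ST_u (m + 1) j) y := by
  obtain ⟨q, hq, hq2⟩ := ST_qs (m + 1)
  have hl := fun j => ST_local m hm1 φ hφ (q j) (hq j)
  choose C hC hl using hl
  refine ⟨((m + 1 : ℕ) : ℝ) * ∑ j, C j, ?_, ?_⟩
  · apply mul_pos (by positivity)
    exact Finset.sum_pos (fun j _ => hC j) Finset.univ_nonempty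
  intro δ hδ hδ1 f hf hn w hw
  have hgn := fun j => ST_D_nice (ST_u (m + 1) j) hf hn
  have hmeas : ∀ j, Measurable (fun p : ℝ × EuclideanSpace ℝ (Fin (m + 1)) =>
      ‖ST_L φ (q j) δ p.1 (ST_D (ST_u (m + 1) j) f) p.2‖ₑ ^ 2 * w p.2) := by
    intro j
    have h1 := ST_L_meas hφ (hq j) δ (hgn j).2.1
    exact (h1.enorm.pow_const 2).mul (hw.comp measurable_snd)
  have hmeas1 : ∀ j t, Measurable (fun x => ‖ST_L φ (q j) δ t (ST_D (ST_u (m + 1) j) f) x‖ₑ ^ 2 * w x) := by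
    intro j t
    have h0 : Measurable (fun x : EuclideanSpace ℝ (Fin (m + 1)) => (t, x)) := by fun_prop
    have h3 := (hmeas j).comp h0
    simp only [Function.comp_def] at h3
    exact h3
  have hmeas2 : ∀ j, Measurable (fun t => ∫⁻ x, ‖ST_L φ (q j) δ t (ST_D (ST_u (m + 1) j) f) x‖ₑ ^ 2 * w x) :=
    fun j => (hmeas j).lintegral_prod_right'
  calc _ ≤ ∫⁻ t in Set.Icc (1:ℝ) 2, ((m + 1 : ℕ) : ℝ≥0∞) * ∑ j, ∫⁻ x, ‖ST_L φ (q j) δ t (ST_D (ST_u (m + 1) j) f) x‖ₑ ^ 2 * w x := by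
        apply setLIntegral_mono' measurableSet_Icc
        intro t ht
        rw [← lintegral_finsetSum _ (fun j _ => hmeas1 j t), ← lintegral_const_mul' _ _ (by simp)]
        apply lintegral_mono
        intro x
        dsimp only
        rw [ST_S_decomp hφ hq hq2 hδ hδ1 ht.1 ht.2 hf hn, ← Finset.sum_mul, ← mul_assoc]
        gcongr
        exact ST_sum_sq _
    _ = ((m + 1 : ℕ) : ℝ≥0∞) * ∑ j, ∫⁻ t in Set.Icc (1:ℝ) 2, ∫⁻ x, ‖ST_L φ (q j) δ t (ST_D (ST_u (m + 1) j) f) x‖ₑ ^ 2 * w x := by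
        rw [lintegral_const_mul' _ _ (by simp), lintegral_finsetSum _ (fun j _ => hmeas2 j)]
    _ ≤ ((m + 1 : ℕ) : ℝ≥0∞) * ∑ j, ENNReal.ofReal ((∑ j, C j) * δ ^ (2 / ((m:ℝ) + 2))) * ∫⁻ y, ‖ST_D (ST_u (m + 1) j) f y‖ₑ ^ 2 *
          ST_U (m + 1) (((m:ℝ) + 2) / 2) w ((2:ℝ) • ST_u (m + 1) j) y := by
        gcongr with j _
        refine (hl j δ hδ hδ1 _ (hgn j) w hw ((2:ℝ) • ST_u (m + 1) j) ?_).trans ?_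
        · rw [norm_smul, ST_u_norm]; norm_num
        · gcongr
          exact Finset.single_le_sum (fun j _ => (hC j).le) (Finset.mem_univ j)
    _ = _ := by
        rw [← Finset.mul_sum, ← mul_assoc, ← ENNReal.ofReal_natCast, ← ENNReal.ofReal_mul (by positivity), mul_assoc]

theorem ST_lint_smul {V : Type*} [NormedAddCommGroup V] [NormedSpace ℝ V] [FiniteDimensional ℝ V]
    [MeasurableSpace V] [BorelSpace V] (μ : Measure V) [μ.IsAddHaarMeasure] (F : V → ℝ≥0∞) {R : ℝ} (hR : 0 < R) :
    ∫⁻ x, F (R • x) ∂μ = ENNReal.ofReal ((R ^ Module.finrank ℝ V)⁻¹) * ∫⁻ x, F x ∂μ := by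
  have he : MeasurableEmbedding (fun x : V => R • x) :=
    (Homeomorph.smulOfNeZero R hR.ne').measurableEmbedding
  have h1 := he.lintegral_map F (μ := μ)
  rw [← h1, show Measure.map (fun x : V => R • x) μ = _ from Measure.map_addHaar_smul μ hR.ne',
    lintegral_smul_measure, abs_of_pos (by positivity), smul_eq_mul]

theorem ST_set_smul {n : ℕ} (h : EuclideanSpace ℝ (Fin n) → ℝ≥0∞) {R : ℝ} (hR : 0 < R)
    (c : EuclideanSpace ℝ (Fin n)) (ρ : ℝ) :
    ∫⁻ z in Metric.ball c ρ, h (R • z) = ENNReal.ofReal ((R ^ n)⁻¹) *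
      ∫⁻ z in Metric.ball (R • c) (R * ρ), h z := by
  rw [← lintegral_indicator measurableSet_ball, ← lintegral_indicator measurableSet_ball]
  have := ST_lint_smul volume ((Metric.ball (R • c) (R * ρ)).indicator h) hR
  rw [finrank_euclideanSpace_fin] at this
  rw [← this]
  congr 1; ext z
  have : z ∈ Metric.ball c ρ ↔ R • z ∈ Metric.ball (R • c) (R * ρ) := by
    rw [Metric.mem_ball, Metric.mem_ball, dist_smul₀, Real.norm_of_nonneg hR.le, mul_lt_mul_iff_right₀ hR]
  by_cases hz : z ∈ Metric.ball c ρ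
  · rw [Set.indicator_of_mem hz, Set.indicator_of_mem (this.1 hz)]
  · rw [Set.indicator_of_notMem hz, Set.indicator_of_notMem (fun h => hz (this.2 h))]

theorem ST_U_smul {n : ℕ} (r : ℝ) (w : EuclideanSpace ℝ (Fin n) → ℝ≥0∞) {R : ℝ} (hR : 0 < R)
    (u y : EuclideanSpace ℝ (Fin n)) :
    ST_U n r (fun x => w (R • x)) u y ≤ ST_U n r w (R • u) (R • y) := by
  conv_lhs => unfold ST_U
  refine iSup_le fun c => iSup_le fun ρ => iSup_le fun hρ => iSup_le fun h1 => iSup_le fun h2 => ?_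
  have key : ∀ z, z ∈ Metric.ball c ρ → R • z ∈ Metric.ball (R • c) (R * ρ) := by
    intro z hz
    rw [Metric.mem_ball] at hz ⊢
    rw [dist_smul₀, Real.norm_of_nonneg hR.le]
    exact mul_lt_mul_of_pos_left hz hR
  have h3 := ST_set_smul (fun z => w z ^ r) hR c ρ
  have h4 := ST_set_smul (fun z => 1) hR c ρ
  rw [setLIntegral_one, setLIntegral_one] at h4
  rw [h3, h4, ENNReal.mul_div_mul_left _ _ (by rw [Ne, ENNReal.ofReal_eq_zero, not_le]; positivity) (by simp)]
  refine ST_U_le (by positivity) (key _ h1) ?_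
  rw [← smul_add]; exact key _ h2

theorem ST_D_smul {n : ℕ} (R : ℝ) (u : EuclideanSpace ℝ (Fin n)) (f : EuclideanSpace ℝ (Fin n) → ℂ)
    (y : EuclideanSpace ℝ (Fin n)) : ST_D u (fun x => f (R • x)) y = ST_D (R • u) f (R • y) := by
  unfold ST_D ST_av
  simp only [smul_add, smul_comm R _ u]

theorem ST_fourier_smul {n : ℕ} (f : EuclideanSpace ℝ (Fin n) → ℂ) {R : ℝ} (hR : 0 < R)
    (ξ : EuclideanSpace ℝ (Fin n)) :
    𝓕 (fun x => f (R⁻¹ • x)) ξ = ((R ^ n : ℝ) : ℂ) * 𝓕 f (R • ξ) := by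
  rw [ST_fourier_e, ST_fourier_e]
  have := Measure.integral_comp_smul volume (fun y => ST_ee (-⟪y, R • ξ⟫) * f y) R⁻¹
  rw [finrank_euclideanSpace_fin, inv_pow, inv_inv, abs_of_pos (by positivity), Complex.real_smul] at this
  rw [← this]
  congr 1; ext y
  rw [inner_smul_left, inner_smul_right]
  simp [hR.ne']

theorem ST_S_smul {n : ℕ} (φ : ℝ → ℝ) (δ t : ℝ) (f : EuclideanSpace ℝ (Fin n) → ℂ) {R : ℝ} (hR : 0 < R)
    (x : EuclideanSpace ℝ (Fin n)) :
    ST_S φ δ t (fun x => f (R⁻¹ • x)) (R • x) = ST_S φ δ (R * t) f x := by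
  unfold ST_S
  rw [ST_fourierInv_e, ST_fourierInv_e]
  have := Measure.integral_comp_smul volume (fun ξ => ST_ee ⟪ξ, x⟫ *
    (((φ (δ⁻¹ * (1 - ‖ξ‖ ^ 2 / (R * t) ^ 2)) : ℝ) : ℂ) * 𝓕 f ξ)) R
  rw [finrank_euclideanSpace_fin, abs_of_pos (by positivity), Complex.real_smul] at this
  have h2 : ∀ a b : ℂ, b = ((R ^ n)⁻¹ : ℝ) * a → a = ((R ^ n : ℝ) : ℂ) * b := by
    intro a b h
    rw [h, ← mul_assoc, ← ofReal_mul, mul_inv_cancel₀ (by positivity)]; simp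
  rw [h2 _ _ this, ← integral_const_mul]
  congr 1; ext ξ
  rw [ST_fourier_smul f hR, inner_smul_left, inner_smul_right, norm_smul, mul_pow, mul_pow, Real.norm_of_nonneg hR.le,
    mul_div_mul_left _ _ (by simpa using hR.ne')]
  simp
  ring

theorem ST_scale (m : ℕ) (hm1 : 1 ≤ m) (φ : ℝ → ℝ) (hφ : ST_phi φ) :
    ∃ C : ℝ, 0 < C ∧ ∀ δ : ℝ, 0 < δ → δ ≤ 1 → ∀ f : EuclideanSpace ℝ (Fin (m + 1)) → ℂ, Continuous f →
      ST_nice volume f → ∀ w : EuclideanSpace ℝ (Fin (m + 1)) → ℝ≥0∞, Measurable w → ∀ R : ℝ, 0 < R →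
      ∫⁻ t in Set.Ico R (2 * R), (∫⁻ x, ‖ST_S φ δ t f x‖ₑ ^ 2 * w x) * ENNReal.ofReal t⁻¹ ≤
        ENNReal.ofReal (C * δ ^ (2 / ((m:ℝ) + 2))) * ∑ j, ∫⁻ y, ‖ST_D (R⁻¹ • ST_u (m + 1) j) f y‖ₑ ^ 2 *
          ST_U (m + 1) (((m:ℝ) + 2) / 2) w ((2:ℝ) • (R⁻¹ • ST_u (m + 1) j)) y := by
  obtain ⟨C, hC, h⟩ := ST_unit m hm1 φ hφ
  refine ⟨C, hC, ?_⟩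
  intro δ hδ hδ1 f hf hn w hw R hR
  have hRi : 0 < R⁻¹ := by positivity
  have hn' : ST_nice volume (fun x => f (R⁻¹ • x)) := by
    obtain ⟨h1, h2, K, hK⟩ := hn
    exact ⟨by fun_prop, h2.comp_smul hRi.ne', K, fun x => hK _⟩
  have h1 := h δ hδ hδ1 (fun x => f (R⁻¹ • x)) (by fun_prop) hn' (fun x => w (R⁻¹ • x)) (by fun_prop)
  set F : ℝ → ℝ≥0∞ := fun t => ∫⁻ x, ‖ST_S φ δ t f x‖ₑ ^ 2 * w x with hF
  have hFs : ∀ t, F (R * t) = ENNReal.ofReal ((R ^ (m + 1))⁻¹) *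
      ∫⁻ x, ‖ST_S φ δ t (fun x => f (R⁻¹ • x)) x‖ₑ ^ 2 * w (R⁻¹ • x) := by
    intro t
    have := ST_lint_smul volume (fun x => ‖ST_S φ δ t (fun x => f (R⁻¹ • x)) x‖ₑ ^ 2 * w (R⁻¹ • x)) hR
    rw [finrank_euclideanSpace_fin] at this
    rw [← this, hF]
    simp only [ST_S_smul φ δ t f hR, smul_smul, inv_mul_cancel₀ hR.ne', one_smul]
  have h2 : ∫⁻ t in Set.Ico R (2 * R), F t * ENNReal.ofReal t⁻¹ ≤ ∫⁻ t in Set.Icc (1:ℝ) 2, F (R * t) := by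
    calc _ ≤ ∫⁻ t in Set.Icc R (2 * R), ENNReal.ofReal R⁻¹ * F t := by
          refine (lintegral_mono_set Set.Ico_subset_Icc_self).trans ?_
          apply setLIntegral_mono' measurableSet_Icc
          intro t ht
          rw [mul_comm]
          gcongr
          exact ht.1
      _ = ENNReal.ofReal R⁻¹ * ∫⁻ t in Set.Icc R (2 * R), F t := lintegral_const_mul' _ _ (by simp)
      _ = _ := by
          rw [← lintegral_indicator measurableSet_Icc, ← lintegral_indicator measurableSet_Icc]
          have := ST_lint_smul (volume : Measure ℝ) ((Set.Icc R (2 * R)).indicator F) hR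
          rw [Module.finrank_self, pow_one] at this
          rw [← this]
          congr 1; ext t
          have hi : t ∈ Set.Icc (1:ℝ) 2 ↔ R • t ∈ Set.Icc R (2 * R) := by
            rw [smul_eq_mul, Set.mem_Icc, Set.mem_Icc, le_mul_iff_one_le_right hR, mul_comm 2 R,
              mul_le_mul_iff_right₀ hR]
          by_cases hz : t ∈ Set.Icc (1:ℝ) 2
          · rw [Set.indicator_of_mem hz, Set.indicator_of_mem (hi.1 hz)]; rfl
          · rw [Set.indicator_of_notMem hz, Set.indicator_of_notMem (fun h => hz (hi.2 h))]
  refine h2.trans ?_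
  simp only [hFs]
  rw [lintegral_const_mul' _ _ (by simp)]
  refine (mul_le_mul_right h1 _).trans ?_
  rw [mul_left_comm, Finset.mul_sum]
  gcongr with j _
  have h5 := ST_lint_smul volume (fun y => ‖ST_D (R⁻¹ • ST_u (m + 1) j) f y‖ₑ ^ 2 *
          ST_U (m + 1) (((m:ℝ) + 2) / 2) w ((2:ℝ) • (R⁻¹ • ST_u (m + 1) j)) y) hRi
  calc _ ≤ ENNReal.ofReal ((R ^ (m + 1))⁻¹) * ∫⁻ y, ‖ST_D (R⁻¹ • ST_u (m + 1) j) f (R⁻¹ • y)‖ₑ ^ 2 *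
          ST_U (m + 1) (((m:ℝ) + 2) / 2) w ((2:ℝ) • (R⁻¹ • ST_u (m + 1) j)) (R⁻¹ • y) := by
        refine mul_le_mul_right (lintegral_mono fun y => ?_) _
        dsimp only
        rw [ST_D_smul]
        refine mul_le_mul_right ?_ _
        refine (ST_U_smul _ w hRi _ _).trans ?_
        rw [smul_comm]
    _ = _ := by
        rw [h5, finrank_euclideanSpace_fin, ← mul_assoc, ← ENNReal.ofReal_mul (by positivity)]
        rw [inv_pow, inv_inv, inv_mul_cancel₀ (by positivity)]
        simp

theorem ST_S_meas {n : ℕ} {φ : ℝ → ℝ} (hφ : ST_phi φ)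
    (δ : ℝ) {g : EuclideanSpace ℝ (Fin n) → ℂ} (hg : Integrable g) :
    Measurable (fun p : ℝ × EuclideanSpace ℝ (Fin n) => ST_S φ δ p.1 g p.2) := by
  have h1 := hφ.1.continuous.measurable
  have h2 := (ST_fourier_continuous hg).measurable
  have h3 := ST_ee_cont.measurable
  unfold ST_S
  simp only [ST_fourierInv_e]
  have h4 : Measurable (fun p : (ℝ × EuclideanSpace ℝ (Fin n)) × EuclideanSpace ℝ (Fin n) =>
      ST_ee ⟪p.2, p.1.2⟫ * (((φ (δ⁻¹ * (1 - ‖p.2‖ ^ 2 / p.1.1 ^ 2)) : ℝ) : ℂ) * 𝓕 g p.2)) := by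
    fun_prop
  exact (h4.stronglyMeasurable.integral_prod_right').measurable

theorem ST_all (m : ℕ) (hm1 : 1 ≤ m) (φ : ℝ → ℝ) (hφ : ST_phi φ) :
    ∃ C : ℝ, 0 < C ∧ ∀ δ : ℝ, 0 < δ → δ ≤ 1 → ∀ f : EuclideanSpace ℝ (Fin (m + 1)) → ℂ, Continuous f →
      ST_nice volume f → ∀ w : EuclideanSpace ℝ (Fin (m + 1)) → ℝ≥0∞, Measurable w →
      ∫⁻ x, (∫⁻ t in Set.Ioi (0:ℝ), ‖ST_S φ δ t f x‖ₑ ^ 2 * ENNReal.ofReal t⁻¹) * w x ≤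
        ENNReal.ofReal (C * δ ^ (2 / ((m:ℝ) + 2))) * ∫⁻ y, ‖f y‖ₑ ^ 2 *
          ST_U (m + 1) (((m:ℝ) + 2) / 2) w 0 y := by
  obtain ⟨C, hC, h⟩ := ST_scale m hm1 φ hφ
  refine ⟨C * ((m + 1 : ℕ) * 4), by positivity, ?_⟩
  intro δ hδ hδ1 f hf hn w hw
  have hS := ST_S_meas hφ δ hn.2.1
  set Y := ∫⁻ y, ‖f y‖ₑ ^ 2 * ST_U (m + 1) (((m:ℝ) + 2) / 2) w 0 y with hY
  have hSx : ∀ x, Measurable (fun t : ℝ => ST_S φ δ t f x) := by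
    intro x
    have h0 : Measurable (fun t : ℝ => (t, x)) := by fun_prop
    have h3 := hS.comp h0
    simp only [Function.comp_def] at h3
    exact h3
  have hSt : ∀ t, Measurable (fun x => ST_S φ δ t f x) := by
    intro t
    have h0 : Measurable (fun x : EuclideanSpace ℝ (Fin (m + 1)) => (t, x)) := by fun_prop
    have h3 := hS.comp h0
    simp only [Function.comp_def] at h3
    exact h3
  have hsw : Measurable (fun p : EuclideanSpace ℝ (Fin (m + 1)) × ℝ =>
      ‖ST_S φ δ p.2 f p.1‖ₑ ^ 2 * ENNReal.ofReal p.2⁻¹ * w p.1) := by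
    have h0 : Measurable (fun p : EuclideanSpace ℝ (Fin (m + 1)) × ℝ => (p.2, p.1)) := by fun_prop
    have h3 := hS.comp h0
    simp only [Function.comp_def] at h3
    have h4 : Measurable (fun p : EuclideanSpace ℝ (Fin (m + 1)) × ℝ => ENNReal.ofReal p.2⁻¹) := by fun_prop
    exact ((h3.enorm.pow_const 2).mul h4).mul (hw.comp measurable_fst)
  have e1 : ∫⁻ x, (∫⁻ t in Set.Ioi (0:ℝ), ‖ST_S φ δ t f x‖ₑ ^ 2 * ENNReal.ofReal t⁻¹) * w x =
      ∫⁻ t in Set.Ioi (0:ℝ), (∫⁻ x, ‖ST_S φ δ t f x‖ₑ ^ 2 * w x) * ENNReal.ofReal t⁻¹ := by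
    calc _ = ∫⁻ x, ∫⁻ t in Set.Ioi (0:ℝ), ‖ST_S φ δ t f x‖ₑ ^ 2 * ENNReal.ofReal t⁻¹ * w x := by
          congr 1; ext x
          rw [lintegral_mul_const]
          exact ((hSx x).enorm.pow_const 2).mul (by fun_prop)
      _ = ∫⁻ t in Set.Ioi (0:ℝ), ∫⁻ x, ‖ST_S φ δ t f x‖ₑ ^ 2 * ENNReal.ofReal t⁻¹ * w x :=
          lintegral_lintegral_swap hsw.aemeasurable
      _ = _ := by
          congr 1; ext t
          rw [← lintegral_mul_const' _ _ (by simp)]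
          congr 1; ext x
          ring
  rw [e1]
  have hcov : Set.Ioi (0:ℝ) ⊆ ⋃ k : ℤ, Set.Ico ((2:ℝ) ^ k) (2 * (2:ℝ) ^ k) := by
    intro t ht
    obtain ⟨k, hk⟩ := exists_mem_Ico_zpow (x := t) (y := (2:ℝ)) ht (by norm_num)
    rw [Set.mem_iUnion]
    refine ⟨k, hk.1, ?_⟩
    have := hk.2
    rw [zpow_add_one₀ (by norm_num)] at this
    linarith
  refine (lintegral_mono_set hcov).trans ?_
  refine (lintegral_iUnion_le _ _).trans ?_
  refine (ENNReal.tsum_le_tsum fun k => h δ hδ hδ1 f hf hn w hw ((2:ℝ) ^ k) (by positivity)).trans ?_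
  rw [ENNReal.tsum_mul_left, Summable.tsum_finsetSum (fun _ _ => ENNReal.summable)]
  have h5 : ∀ j : Fin (m + 1), ∑' k : ℤ, ∫⁻ y, ‖ST_D (((2:ℝ) ^ k)⁻¹ • ST_u (m + 1) j) f y‖ₑ ^ 2 *
          ST_U (m + 1) (((m:ℝ) + 2) / 2) w ((2:ℝ) • (((2:ℝ) ^ k)⁻¹ • ST_u (m + 1) j)) y ≤ 4 * Y := by
    intro j
    refine le_trans (le_of_eq ?_) (ST_tele (((m:ℝ) + 2) / 2) w (ST_u (m + 1) j) hf)
    rw [← (Equiv.neg ℤ).tsum_eq]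
    simp only [Equiv.neg_apply, zpow_neg, inv_inv]
  refine (mul_le_mul_right (Finset.sum_le_sum fun j _ => h5 j) _).trans (le_of_eq ?_)
  rw [Finset.sum_const, Finset.card_univ, Fintype.card_fin, nsmul_eq_mul,
    show C * ((m + 1 : ℕ) * 4) * δ ^ (2 / ((m:ℝ) + 2)) = C * δ ^ (2 / ((m:ℝ) + 2)) * ((m + 1 : ℕ) * 4) by ring,
    ENNReal.ofReal_mul (by positivity : 0 ≤ C * δ ^ (2 / ((m:ℝ) + 2))), ENNReal.ofReal_mul (by positivity : (0:ℝ) ≤ ((m + 1 : ℕ) : ℝ)),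
    ENNReal.ofReal_natCast]
  simp only [ENNReal.ofReal_ofNat]
  ring

theorem squareFn_weighted_L2_bound (n : ℕ) (hn : 2 ≤ n) (φ : ℝ → ℝ)
    (hφsmooth : ContDiff ℝ (⊤ : ℕ∞) φ) (hφbdd : ∀ s : ℝ, |φ s| ≤ 1)
    (hφsupp : ∀ s : ℝ, 1 / 2 < |s| → φ s = 0) :
    ∃ C : ℝ, 0 < C ∧ ∀ δ : ℝ, 0 < δ → δ ≤ 1 →
      ∀ f : SchwartzMap (EuclideanSpace ℝ (Fin n)) ℂ,
      ∀ w : EuclideanSpace ℝ (Fin n) → ℝ, Measurable w → (∀ x, 0 ≤ w x) →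
        ∫⁻ x, squareFn n φ δ (⇑f) x ^ 2 * ENNReal.ofReal (w x) ∂volume
          ≤ ENNReal.ofReal (C * δ ^ (2 / ((n : ℝ) + 1))) *
              ∫⁻ x, (‖f x‖₊ : ℝ≥0∞) ^ 2 *
                uncenteredMaximalR n (((n : ℝ) + 1) / 2) w x ∂volume := by
  obtain ⟨m, rfl⟩ : ∃ m, n = m + 1 := ⟨n - 1, by omega⟩
  have hφ : ST_phi φ := ⟨hφsmooth, hφsupp⟩
  obtain ⟨C, hC, h⟩ := ST_all m (by omega) φ hφ
  refine ⟨C, hC, ?_⟩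
  intro δ hδ hδ1 f w hw hw0
  have hn : ST_nice volume (⇑f) := by
    refine ⟨f.continuous.measurable, f.integrable, ?_⟩
    obtain ⟨K, hK⟩ := f.decay 0 0
    exact ⟨K, fun x => by simpa using hK.2 x⟩
  have h1 := h δ hδ hδ1 f f.continuous hn (fun x => ENNReal.ofReal (w x)) (by fun_prop)
  have e1 : 2 / (((m + 1 : ℕ) : ℝ) + 1) = 2 / ((m:ℝ) + 2) := by push_cast; ring
  have e2 : (((m + 1 : ℕ) : ℝ) + 1) / 2 = ((m:ℝ) + 2) / 2 := by push_cast; ring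
  rw [e1, e2]
  have e3 : ∀ x, squareFn (m + 1) φ δ (⇑f) x ^ 2 =
      ∫⁻ t in Set.Ioi (0:ℝ), ‖ST_S φ δ t f x‖ₑ ^ 2 * ENNReal.ofReal t⁻¹ := by
    intro x
    unfold squareFn
    rw [← ENNReal.rpow_natCast, ← ENNReal.rpow_mul]
    norm_num
    congr 1; ext t
    congr 2
    rw [← enorm_eq_nnnorm]
    congr 1
    unfold ST_S
    rw [ST_fourierInv_e]
    congr 1; ext ξ
    unfold ST_ee
    rw [real_inner_comm]
    rw [mul_comm]
    congr 2
    push_cast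
    ring
  have e4 : ∀ y, ST_U (m + 1) (((m:ℝ) + 2) / 2) (fun x => ENNReal.ofReal (w x)) 0 y ≤
      uncenteredMaximalR (m + 1) (((m:ℝ) + 2) / 2) w y := by
    intro y
    unfold ST_U uncenteredMaximalR
    refine iSup_le fun c => iSup_le fun ρ => iSup_le fun hρ => iSup_le fun h1 => iSup_le fun h2 => ?_
    refine le_iSup_of_le c (le_iSup_of_le ρ (le_iSup_of_le hρ (le_iSup_of_le h1 (le_of_eq ?_))))
    have : ∀ z, ENNReal.ofReal (w z) = (‖w z‖₊ : ℝ≥0∞) := by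
      intro z
      rw [← enorm_eq_nnnorm, ← ofReal_norm, Real.norm_of_nonneg (hw0 z)]
    simp only [this]
  simp only [e3]
  refine h1.trans ?_
  refine mul_le_mul_right (lintegral_mono fun y => ?_) _
  exact mul_le_mul_right (e4 y) _
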